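/- (Baker's metric discrepancy bound) Let (n_k)_{k ≥ 1} be a strictly increasing sequence of positive integers and let ε > 0. Then for Lebesgue-almost every x ∈ [0,1], D_N^*(⟨n_1 x⟩, …, ⟨n_N x⟩) = O( (log N)^{3/2+ε} / √N ) as N → ∞, where the implied constant may depend on x. -/

import Mathlib

open MeasureTheory Filter Real Asymptotics

/-- The star-discrepancy of the points `x 1, …, x N` in the unit interval:
`D_N^* = sup_{0 ≤ a ≤ 1} | (1/N) ∑_{k=1}^N 1_{[0,a)}(x_k) - a |`. -/
noncomputable def starDiscrepancy (N : ℕ) (x : ℕ → ℝ) : ℝ :=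
  ⨆ a : Set.Icc (0 : ℝ) 1,
    |(∑ k ∈ Finset.Icc 1 N,
        (Set.Ico (0 : ℝ) (a : ℝ)).indicator (fun _ => (1 : ℝ)) (x k)) / N - (a : ℝ)|

/-- Piecewise linear cutoff, equal to `1` up to `2 ^ i` and to `0` from `2 ^ (i + 1)` on. -/
noncomputable def cutoff (i : ℕ) (d : ℤ) : ℝ := max 0 (min 1 (2 - d / 2 ^ i))

/-- A nonnegative bump supported in `(2 ^ i, 2 ^ (i + 2))`. -/
noncomputable def bump (i : ℕ) (d : ℤ) : ℝ := cutoff (i + 1) d - cutoff i d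

/-- A symmetric plateau equal to `1` for `|d| ≤ 2 ^ (i + 2)`, supported in `|d| < 2 ^ (i + 3)`. -/
noncomputable def plateau (i : ℕ) (d : ℤ) : ℝ := cutoff (i + 2) d + cutoff (i + 2) (-d) - 1

lemma cutoff_nonneg (i : ℕ) (d : ℤ) : 0 ≤ cutoff i d := le_max_left _ _

lemma cutoff_le_one (i : ℕ) (d : ℤ) : cutoff i d ≤ 1 :=
  max_le zero_le_one (min_le_left _ _)

lemma cutoff_eq_one {i : ℕ} {d : ℤ} (h : d ≤ 2 ^ i) : cutoff i d = 1 := by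
  have h' : (d : ℝ) ≤ 2 ^ i := by exact_mod_cast h
  have : (d : ℝ) / 2 ^ i ≤ 1 := by rw [div_le_one (by positivity)]; exact h'
  unfold cutoff
  rw [min_eq_left (by linarith), max_eq_right zero_le_one]

lemma cutoff_eq_zero {i : ℕ} {d : ℤ} (h : 2 ^ (i + 1) ≤ d) : cutoff i d = 0 := by
  have h' : (2 : ℝ) ^ (i + 1) ≤ d := by exact_mod_cast h
  have : 2 ≤ (d : ℝ) / 2 ^ i := by
    rw [le_div_iff₀ (by positivity)]; rw [pow_succ] at h'; linarith
  unfold cutoff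
  exact max_eq_left ((min_le_right _ _).trans (by linarith))

lemma cutoff_eq_linear {i : ℕ} {d : ℤ} (h : 2 ^ i ≤ d) (h' : d ≤ 2 ^ (i + 1)) :
    cutoff i d = 2 - d / 2 ^ i := by
  have h1 : (2 : ℝ) ^ i ≤ d := by exact_mod_cast h
  have h2 : (d : ℝ) ≤ 2 ^ (i + 1) := by exact_mod_cast h'
  have h3 : 1 ≤ (d : ℝ) / 2 ^ i := by rw [le_div_iff₀ (by positivity)]; linarith
  have h4 : (d : ℝ) / 2 ^ i ≤ 2 := by
    rw [div_le_iff₀ (by positivity)]; rw [pow_succ] at h2; linarith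
  unfold cutoff
  rw [min_eq_right (by linarith), max_eq_right (by linarith)]

lemma abs_cutoff_sub_le (i : ℕ) (c d : ℤ) :
    |cutoff i c - cutoff i d| ≤ |(c : ℝ) - d| / 2 ^ i := by
  unfold cutoff
  calc _ ≤ |(0 : ℝ) - 0| ⊔ |min 1 (2 - (c : ℝ) / 2 ^ i) - min 1 (2 - (d : ℝ) / 2 ^ i)| :=
        abs_max_sub_max_le_max _ _ _ _
    _ ≤ |(0 : ℝ) - 0| ⊔ (|(1 : ℝ) - 1| ⊔ |(2 - (c : ℝ) / 2 ^ i) - (2 - (d : ℝ) / 2 ^ i)|) :=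
        max_le_max le_rfl (abs_min_sub_min_le_max _ _ _ _)
    _ = |(c : ℝ) - d| / 2 ^ i := by
        have : (2 - (c : ℝ) / 2 ^ i) - (2 - (d : ℝ) / 2 ^ i) = -(((c : ℝ) - d) / 2 ^ i) := by ring
        rw [this, abs_neg, abs_div, abs_of_pos (by positivity : (0 : ℝ) < 2 ^ i)]
        simp only [sub_self, abs_zero]
        rw [max_eq_right, max_eq_right] <;> positivity

lemma cutoff_mono (i : ℕ) (d : ℤ) : cutoff i d ≤ cutoff (i + 1) d := by
  rcases le_total d 0 with h | h
  · rw [cutoff_eq_one (h.trans (by positivity)), cutoff_eq_one (h.trans (by positivity))]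
  · have h' : (0 : ℝ) ≤ d := by exact_mod_cast h
    unfold cutoff
    gcongr
    · norm_num
    · omega

lemma bump_nonneg (i : ℕ) (d : ℤ) : 0 ≤ bump i d := sub_nonneg.2 (cutoff_mono i d)

lemma lt_of_bump_ne_zero {i : ℕ} {d : ℤ} (h : bump i d ≠ 0) : 2 ^ i < d ∧ d < 2 ^ (i + 2) := by
  constructor
  · by_contra! h'
    exact h (by rw [bump, cutoff_eq_one h', cutoff_eq_one (h'.trans (by gcongr <;> omega)),
      sub_self])
  · by_contra! h'
    refine h ?_
    rw [bump, cutoff_eq_zero h', cutoff_eq_zero (le_trans (by gcongr <;> omega) h'), sub_self]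

lemma sum_range_bump (n : ℕ) (d : ℤ) :
    ∑ i ∈ Finset.range n, bump i d = cutoff n d - cutoff 0 d :=
  Finset.sum_range_sub (fun i => cutoff i d) n

lemma sum_bump_le_one (T : Finset ℕ) (d : ℤ) : ∑ i ∈ T, bump i d ≤ 1 := by
  obtain ⟨n, hn⟩ := T.exists_nat_subset_range
  calc _ ≤ ∑ i ∈ Finset.range n, bump i d :=
        Finset.sum_le_sum_of_subset_of_nonneg hn fun i _ _ => bump_nonneg i d
    _ ≤ 1 := by
        rw [sum_range_bump]
        linarith [cutoff_nonneg 0 d, cutoff_le_one n d]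

lemma plateau_eq_one {i : ℕ} {d : ℤ} (h : |d| ≤ 2 ^ (i + 2)) : plateau i d = 1 := by
  rw [plateau, cutoff_eq_one ((le_abs_self d).trans h), cutoff_eq_one ((neg_le_abs d).trans h)]
  norm_num

lemma abs_lt_of_plateau_ne_zero {i : ℕ} {d : ℤ} (h : plateau i d ≠ 0) : |d| < 2 ^ (i + 3) := by
  by_contra! h'
  refine h ?_
  have hp : (0 : ℤ) < 2 ^ (i + 3) := by positivity
  have hq : (0 : ℤ) < 2 ^ (i + 2) := by positivity
  rcases abs_cases d with ⟨h1, h2⟩ | ⟨h1, h2⟩ <;> rw [h1] at h'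
  · rw [plateau, cutoff_eq_zero h', cutoff_eq_one (by omega)]; norm_num
  · rw [plateau, cutoff_eq_zero h', cutoff_eq_one (by omega)]; norm_num

lemma abs_plateau_le_one (i : ℕ) (d : ℤ) : |plateau i d| ≤ 1 := by
  have := cutoff_nonneg (i + 2) d
  have := cutoff_nonneg (i + 2) (-d)
  have := cutoff_le_one (i + 2) d
  have := cutoff_le_one (i + 2) (-d)
  rw [abs_le, plateau]; constructor <;> linarith

/-- `f` is bounded by `C` and has first differences and total second variation
at most `C / 2 ^ i`. -/
structure SmoothAt (i : ℕ) (C : ℝ) (f : ℤ → ℝ) : Prop where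
  bound : ∀ n, |f n| ≤ C
  diff : ∀ n, |f (n + 1) - f n| ≤ C / 2 ^ i
  second : ∀ T : Finset ℤ, ∑ n ∈ T, |f (n + 2) - 2 * f (n + 1) + f n| ≤ C / 2 ^ i

namespace SmoothAt

variable {i : ℕ} {C C' : ℝ} {f g : ℤ → ℝ}

lemma nonneg (h : SmoothAt i C f) : 0 ≤ C := (abs_nonneg _).trans (h.bound 0)

lemma mono (h : SmoothAt i C f) (hC : C ≤ C') : SmoothAt i C' f where
  bound n := (h.bound n).trans hC
  diff n := (h.diff n).trans (by gcongr)
  second T := (h.second T).trans (by gcongr)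

lemma mono_scale (h : SmoothAt i C f) {i' : ℕ} (hi : i' ≤ i) : SmoothAt i' C f := by
  have hC := h.nonneg
  have : C / 2 ^ i ≤ C / 2 ^ i' := by
    gcongr
    norm_num
  exact ⟨h.bound, fun n => (h.diff n).trans this, fun T => (h.second T).trans this⟩

lemma add (hf : SmoothAt i C f) (hg : SmoothAt i C' g) :
    SmoothAt i (C + C') (fun n => f n + g n) where
  bound n := (abs_add_le _ _).trans (add_le_add (hf.bound n) (hg.bound n))
  diff n := by
    rw [add_div]
    refine le_trans ?_ (add_le_add (hf.diff n) (hg.diff n))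
    rw [show f (n + 1) + g (n + 1) - (f n + g n)
      = (f (n + 1) - f n) + (g (n + 1) - g n) by ring]
    exact abs_add_le _ _
  second T := by
    rw [add_div]
    refine le_trans ?_ (add_le_add (hf.second T) (hg.second T))
    rw [← Finset.sum_add_distrib]
    refine Finset.sum_le_sum fun n _ => ?_
    rw [show f (n + 2) + g (n + 2) - 2 * (f (n + 1) + g (n + 1)) + (f n + g n)
      = (f (n + 2) - 2 * f (n + 1) + f n) + (g (n + 2) - 2 * g (n + 1) + g n) by ring]
    exact abs_add_le _ _

lemma neg (hf : SmoothAt i C f) : SmoothAt i C (fun n => -f n) where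
  bound n := by rw [abs_neg]; exact hf.bound n
  diff n := by
    refine le_of_eq_of_le ?_ (hf.diff n)
    rw [← abs_neg]; congr 1; ring
  second T := by
    refine le_of_eq_of_le ?_ (hf.second T)
    refine Finset.sum_congr rfl fun n _ => ?_
    rw [← abs_neg]; congr 1; ring

lemma sub (hf : SmoothAt i C f) (hg : SmoothAt i C' g) :
    SmoothAt i (C + C') (fun n => f n - g n) := by
  simpa only [sub_eq_add_neg] using hf.add hg.neg

lemma reflect (hf : SmoothAt i C f) (x : ℤ) : SmoothAt i C (fun n => f (x - n)) where
  bound n := hf.bound _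
  diff n := by
    have := hf.diff (x - n - 1)
    rw [abs_sub_comm]
    convert this using 4 <;> ring
  second T := by
    have h := hf.second (T.image fun n => x - n - 2)
    rw [Finset.sum_image (by intro a _ b _ h; simp only at h; omega)] at h
    refine le_of_eq_of_le (Finset.sum_congr rfl fun n _ => ?_) h
    have e1 : x - (n + 2) = x - n - 2 := by ring
    have e2 : x - (n + 1) = x - n - 2 + 1 := by ring
    have e3 : x - n = x - n - 2 + 2 := by ring
    rw [e1, e2]
    conv_lhs => rw [e3]
    congr 1; ring_nf

lemma neg_arg (hf : SmoothAt i C f) : SmoothAt i C (fun n => f (-n)) := by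
  simpa using hf.reflect 0

/-- The product of a function smooth at a coarse scale with a function smooth at scale `i`
and supported on a window of that scale is smooth at scale `i`. -/
lemma mul (hf : SmoothAt i C f) (hg : SmoothAt i C' g) (a : ℤ)
    (hs : ∀ n, g n ≠ 0 → a ≤ n ∧ n < a + 2 ^ (i + 5)) :
    SmoothAt i (70 * (C * C')) (fun n => f n * g n) := by
  have hC := hf.nonneg
  have hC' := hg.nonneg
  have hCC : 0 ≤ C * C' := mul_nonneg hC hC'
  have hp : (1 : ℝ) ≤ 2 ^ i := one_le_pow₀ (by norm_num)
  have hp0 : (0 : ℝ) < 2 ^ i := by positivity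
  refine ⟨fun n => ?_, fun n => ?_, fun T => ?_⟩
  · rw [abs_mul]
    calc |f n| * |g n| ≤ C * C' := by gcongr <;> [exact hf.bound n; exact hg.bound n]
      _ ≤ _ := by linarith
  · have e : f (n + 1) * g (n + 1) - f n * g n
      = f (n + 1) * (g (n + 1) - g n) + (f (n + 1) - f n) * g n := by ring
    rw [e]
    calc _ ≤ |f (n + 1)| * |g (n + 1) - g n| + |f (n + 1) - f n| * |g n| := by
          rw [← abs_mul, ← abs_mul]; exact abs_add_le _ _
      _ ≤ C * (C' / 2 ^ i) + C / 2 ^ i * C' := by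
          gcongr <;> [exact hf.bound _; exact hg.diff n; exact hf.diff n; exact hg.bound _]
      _ = 2 * (C * C') / 2 ^ i := by ring
      _ ≤ _ := by gcongr; linarith
  · have e : ∀ n, |f (n + 2) * g (n + 2) - 2 * (f (n + 1) * g (n + 1)) + f n * g n|
        ≤ C * |g (n + 2) - 2 * g (n + 1) + g n| + 2 * (C / 2 ^ i) * |g (n + 1) - g n|
          + C' * |f (n + 2) - 2 * f (n + 1) + f n| := by
      intro n
      have e' : f (n + 2) * g (n + 2) - 2 * (f (n + 1) * g (n + 1)) + f n * g n
        = f (n + 2) * (g (n + 2) - 2 * g (n + 1) + g n)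
          + 2 * (f (n + 1 + 1) - f (n + 1)) * (g (n + 1) - g n)
          + g n * (f (n + 2) - 2 * f (n + 1) + f n) := by
        rw [show n + 1 + 1 = n + 2 by ring]; ring
      rw [e']
      refine (abs_add_le _ _).trans (add_le_add ((abs_add_le _ _).trans (add_le_add ?_ ?_)) ?_)
      · rw [abs_mul]; gcongr; exact hf.bound _
      · rw [abs_mul, abs_mul, abs_two]; gcongr; exact hf.diff _
      · rw [abs_mul]; gcongr; exact hg.bound _
    have hdiff : ∑ n ∈ T, |g (n + 1) - g n| ≤ 33 * C' := by
      have : ∑ n ∈ T, |g (n + 1) - g n|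
          = ∑ n ∈ T with n ∈ Finset.Ico (a - 1) (a + 2 ^ (i + 5)), |g (n + 1) - g n| := by
        rw [Finset.sum_filter]
        refine Finset.sum_congr rfl fun n _ => ?_
        split_ifs with h
        · rfl
        · have h1 : g n = 0 := by
            by_contra h'
            have := hs n h'
            exact h (Finset.mem_Ico.2 ⟨by omega, by omega⟩)
          have h2 : g (n + 1) = 0 := by
            by_contra h'
            have := hs _ h'
            exact h (Finset.mem_Ico.2 ⟨by omega, by omega⟩)
          rw [h1, h2]; simp
      rw [this]
      calc _ ≤ ∑ n ∈ Finset.Ico (a - 1) (a + 2 ^ (i + 5)), |g (n + 1) - g n| :=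
            Finset.sum_le_sum_of_subset_of_nonneg
              (fun n hn => (Finset.mem_filter.1 hn).2) fun _ _ _ => abs_nonneg _
        _ ≤ ∑ n ∈ Finset.Ico (a - 1) (a + 2 ^ (i + 5)), C' / 2 ^ i :=
            Finset.sum_le_sum fun n _ => hg.diff n
        _ = (2 ^ (i + 5) + 1) * (C' / 2 ^ i) := by
            rw [Finset.sum_const, nsmul_eq_mul, Int.card_Ico]
            congr 1
            have : a + 2 ^ (i + 5) - (a - 1) = ((2 ^ (i + 5) + 1 : ℕ) : ℤ) := by push_cast; ring
            rw [this, Int.toNat_natCast]; push_cast; ring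
        _ ≤ (33 * 2 ^ i) * (C' / 2 ^ i) := by
            gcongr
            rw [pow_add]; linarith
        _ = 33 * C' := by field_simp
    calc _ ≤ ∑ n ∈ T, (C * |g (n + 2) - 2 * g (n + 1) + g n|
            + 2 * (C / 2 ^ i) * |g (n + 1) - g n| + C' * |f (n + 2) - 2 * f (n + 1) + f n|) :=
          Finset.sum_le_sum fun n _ => e n
      _ = C * ∑ n ∈ T, |g (n + 2) - 2 * g (n + 1) + g n|
            + 2 * (C / 2 ^ i) * ∑ n ∈ T, |g (n + 1) - g n|
            + C' * ∑ n ∈ T, |f (n + 2) - 2 * f (n + 1) + f n| := by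
          rw [Finset.sum_add_distrib, Finset.sum_add_distrib, Finset.mul_sum, Finset.mul_sum,
            Finset.mul_sum]
      _ ≤ C * (C' / 2 ^ i) + 2 * (C / 2 ^ i) * (33 * C') + C' * (C / 2 ^ i) := by
          gcongr <;> [exact hg.second T; exact hf.second T]
      _ = 68 * (C * C') / 2 ^ i := by ring
      _ ≤ _ := by gcongr; linarith

end SmoothAt

lemma smoothAt_cutoff (i : ℕ) : SmoothAt i 4 (cutoff i) := by
  have hd : ∀ n, |cutoff i (n + 1) - cutoff i n| ≤ 1 / 2 ^ i := fun n => by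
    refine (abs_cutoff_sub_le i (n + 1) n).trans ?_
    push_cast
    simp
  refine ⟨fun n => ?_, fun n => (hd n).trans (by gcongr; norm_num), fun T => ?_⟩
  · rw [abs_of_nonneg (cutoff_nonneg _ _)]
    linarith [cutoff_le_one i n]
  · have hz : ∀ n : ℤ, n ∉ ({2 ^ i - 1, 2 ^ (i + 1) - 1} : Finset ℤ) →
        |cutoff i (n + 2) - 2 * cutoff i (n + 1) + cutoff i n| = 0 := by
      intro n hn
      simp only [Finset.mem_insert, Finset.mem_singleton, not_or] at hn
      rw [abs_eq_zero]
      have h2 : (2 : ℤ) ^ (i + 1) = 2 * 2 ^ i := by ring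
      have hp : (0 : ℤ) < 2 ^ i := by positivity
      rcases le_or_gt (n + 2) (2 ^ i) with h | h
      · rw [cutoff_eq_one h, cutoff_eq_one (by omega), cutoff_eq_one (by omega)]; norm_num
      rcases le_or_gt (2 ^ (i + 1)) n with h' | h'
      · rw [cutoff_eq_zero h', cutoff_eq_zero (by omega), cutoff_eq_zero (by omega)]; norm_num
      rw [cutoff_eq_linear (by omega) (by omega), cutoff_eq_linear (by omega) (by omega),
        cutoff_eq_linear (by omega) (by omega)]
      push_cast
      ring
    have h2 : ∀ n, |cutoff i (n + 2) - 2 * cutoff i (n + 1) + cutoff i n| ≤ 2 / 2 ^ i := by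
      intro n
      have e : cutoff i (n + 2) - 2 * cutoff i (n + 1) + cutoff i n
        = (cutoff i (n + 1 + 1) - cutoff i (n + 1)) - (cutoff i (n + 1) - cutoff i n) := by
        rw [show n + 1 + 1 = n + 2 by ring]; ring
      rw [e]
      refine (abs_sub _ _).trans ?_
      have := hd (n + 1)
      have := hd n
      rw [show (2 : ℝ) / 2 ^ i = 1 / 2 ^ i + 1 / 2 ^ i by ring]
      linarith
    calc _ ≤ ∑ n ∈ T ∪ {2 ^ i - 1, 2 ^ (i + 1) - 1},
            |cutoff i (n + 2) - 2 * cutoff i (n + 1) + cutoff i n| :=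
          Finset.sum_le_sum_of_subset_of_nonneg Finset.subset_union_left
            fun _ _ _ => abs_nonneg _
      _ = ∑ n ∈ ({2 ^ i - 1, 2 ^ (i + 1) - 1} : Finset ℤ),
            |cutoff i (n + 2) - 2 * cutoff i (n + 1) + cutoff i n| :=
          (Finset.sum_subset Finset.subset_union_right fun n _ hn => hz n hn).symm
      _ ≤ ({2 ^ i - 1, 2 ^ (i + 1) - 1} : Finset ℤ).card • (2 / 2 ^ i) :=
          Finset.sum_le_card_nsmul _ _ _ fun n _ => h2 n
      _ ≤ 2 • ((2 : ℝ) / 2 ^ i) := by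
          gcongr
          exact Finset.card_le_two
      _ = 4 / 2 ^ i := by rw [nsmul_eq_mul]; push_cast; ring

lemma smoothAt_bump (i : ℕ) : SmoothAt i 8 (bump i) := by
  have := ((smoothAt_cutoff (i + 1)).mono_scale (Nat.le_succ i)).sub (smoothAt_cutoff i)
  norm_num at this
  exact this

lemma smoothAt_const (i : ℕ) : SmoothAt i 1 (fun _ => 1) :=
  ⟨fun n => by simp, fun n => by simp, fun T => by norm_num⟩

lemma smoothAt_plateau (i : ℕ) : SmoothAt i 9 (plateau i) := by
  have h := (smoothAt_cutoff (i + 2)).mono_scale (show i ≤ i + 2 by omega)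
  have := (h.add h.neg_arg).sub (smoothAt_const i)
  norm_num at this
  exact this

lemma abs_bump_sub_le (i : ℕ) (c d : ℤ) :
    |bump i c - bump i d| ≤ 2 * |(c : ℝ) - d| / 2 ^ i := by
  have h1 := abs_cutoff_sub_le i c d
  have h2 := abs_cutoff_sub_le (i + 1) c d
  have h3 : |(c : ℝ) - d| / 2 ^ (i + 1) ≤ |(c : ℝ) - d| / 2 ^ i := by
    gcongr
    · norm_num
    · omega
  unfold bump
  calc _ = |(cutoff (i + 1) c - cutoff (i + 1) d) - (cutoff i c - cutoff i d)| := by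
        congr 1; ring
    _ ≤ _ := abs_sub _ _
    _ ≤ |(c : ℝ) - d| / 2 ^ i + |(c : ℝ) - d| / 2 ^ i := add_le_add (h2.trans h3) h1
    _ = _ := by ring

/-- The character `t ↦ exp (2 π i t)`. -/
noncomputable def unitExp (t : ℝ) : ℂ := Complex.exp (Complex.I * ((2 * π * t : ℝ) : ℂ))

lemma norm_unitExp (t : ℝ) : ‖unitExp t‖ = 1 := by
  rw [unitExp, mul_comm, Complex.norm_exp_ofReal_mul_I]

lemma unitExp_add (s t : ℝ) : unitExp (s + t) = unitExp s * unitExp t := by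
  rw [unitExp, unitExp, unitExp, ← Complex.exp_add]
  congr 1
  push_cast
  ring

lemma unitExp_neg (t : ℝ) : unitExp (-t) = star (unitExp t) := by
  rw [unitExp, unitExp, Complex.star_def, ← Complex.exp_conj]
  rw [map_mul, Complex.conj_ofReal, Complex.conj_I]
  push_cast
  ring_nf

lemma four_mul_abs_le_norm_one_sub_unitExp {x : ℝ} (hx : |x| ≤ 1 / 2) :
    4 * |x| ≤ ‖1 - unitExp x‖ := by
  rw [norm_sub_rev, unitExp, Complex.norm_exp_I_mul_ofReal_sub_one, norm_mul]
  have h := Real.mul_le_sin (x := π * |x|) (by positivity) (by nlinarith [Real.pi_pos])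
  have e : 2 * π * x / 2 = π * x := by ring
  have h' : |Real.sin (π * x)| = |Real.sin (π * |x|)| := by
    rcases abs_cases x with ⟨h1, _⟩ | ⟨h1, _⟩ <;> rw [h1]
    rw [mul_neg, Real.sin_neg, abs_neg]
  rw [e, Real.norm_eq_abs, Real.norm_eq_abs, h', abs_two]
  have e2 : 2 / π * (π * |x|) = 2 * |x| := by field_simp
  rw [e2] at h
  linarith [le_abs_self (Real.sin (π * |x|))]

/-- Summation by parts twice for a finitely supported exponential sum. -/
lemma norm_sum_mul_unitExp_mul_sq_le {f : ℤ → ℝ} {S : Finset ℤ} (hS : ∀ n, f n ≠ 0 → n ∈ S)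
    {V : ℝ} (hV : ∀ T : Finset ℤ, ∑ n ∈ T, |f (n + 2) - 2 * f (n + 1) + f n| ≤ V) (x : ℝ) :
    ‖∑ n ∈ S, (f n : ℂ) * unitExp (n * x)‖ * ‖1 - unitExp x‖ ^ 2 ≤ V := by
  set F : ℤ → ℂ := fun n => (f n : ℂ) * unitExp (n * x) with hF
  set z := unitExp x
  have hsum : ∀ k : ℤ, Summable fun n : ℤ => F (n + k) := fun k =>
    summable_of_ne_finset_zero (s := S.image fun n => n - k) fun n hn => by
      have : f (n + k) = 0 := by
        by_contra h
        exact hn (Finset.mem_image.2 ⟨n + k, hS _ h, by ring⟩)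
      simp [hF, this]
  have hts : ∀ k : ℤ, ∑' n : ℤ, F (n + k) = ∑ n ∈ S, F n := fun k => by
    have hk := (Equiv.addRight k).tsum_eq F
    simp only [Equiv.coe_addRight] at hk
    rw [hk]
    refine tsum_eq_sum fun n hn => ?_
    have : f n = 0 := by
      by_contra h
      exact hn (hS _ h)
    simp [hF, this]
  have hz : ∀ n : ℤ, unitExp ((n + 1 : ℤ) * x) = unitExp (n * x) * z := fun n => by
    rw [← unitExp_add]; congr 1; push_cast; ring
  have key : (∑ n ∈ S, F n) * (1 - z) ^ 2
      = ∑' n : ℤ, (((f (n + 2) - 2 * f (n + 1) + f n : ℝ) : ℂ) * unitExp ((n + 2 : ℤ) * x)) := by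
    have e : ∀ n : ℤ, ((f (n + 2) - 2 * f (n + 1) + f n : ℝ) : ℂ) * unitExp ((n + 2 : ℤ) * x)
        = F (n + 2) - 2 * z * F (n + 1) + z ^ 2 * F (n + 0) := fun n => by
      have h1 : unitExp ((n + 2 : ℤ) * x) = unitExp (n * x) * z * z := by
        rw [show n + 2 = n + 1 + 1 by ring, hz, hz]
      simp only [hF, h1, hz, add_zero]
      push_cast
      ring
    simp_rw [e]
    rw [Summable.tsum_add (((hsum 2).sub ((hsum 1).mul_left _))) ((hsum 0).mul_left _),
      Summable.tsum_sub (hsum 2) ((hsum 1).mul_left _), tsum_mul_left, tsum_mul_left, hts, hts,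
      hts]
    ring
  rw [← norm_pow, ← norm_mul, key]
  have hs2 : Summable fun n : ℤ => ‖((f (n + 2) - 2 * f (n + 1) + f n : ℝ) : ℂ)
      * unitExp ((n + 2 : ℤ) * x)‖ := by
    have : ∀ n : ℤ, ‖((f (n + 2) - 2 * f (n + 1) + f n : ℝ) : ℂ)
      * unitExp ((n + 2 : ℤ) * x)‖ = |f (n + 2) - 2 * f (n + 1) + f n| := fun n => by
      rw [norm_mul, norm_unitExp, mul_one, Complex.norm_real, Real.norm_eq_abs]
    simp_rw [this]
    exact summable_of_sum_le (fun _ => abs_nonneg _) hV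
  refine (norm_tsum_le_tsum_norm hs2).trans ?_
  refine hs2.tsum_le_of_sum_le fun T => ?_
  refine le_of_eq_of_le (Finset.sum_congr rfl fun n _ => ?_) (hV T)
  rw [norm_mul, norm_unitExp, mul_one, Complex.norm_real, Real.norm_eq_abs]

lemma norm_sum_mul_unitExp_mul_le {f : ℤ → ℝ} {S : Finset ℤ} (hS : ∀ n, f n ≠ 0 → n ∈ S)
    {i : ℕ} {C : ℝ} (hf : SmoothAt i C f) {x : ℝ} (hx : |x| ≤ 1 / 2) :
    ‖∑ n ∈ S, (f n : ℂ) * unitExp (n * x)‖ * (16 * x ^ 2) ≤ C / 2 ^ i := by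
  refine le_trans ?_ (norm_sum_mul_unitExp_mul_sq_le hS hf.second x)
  gcongr
  calc 16 * x ^ 2 = (4 * |x|) ^ 2 := by rw [mul_pow, sq_abs]; norm_num
    _ ≤ _ := by gcongr; exact four_mul_abs_le_norm_one_sub_unitExp hx

lemma norm_sum_mul_unitExp_le_card {f : ℤ → ℝ} {i : ℕ} {a : ℤ} {B : ℝ}
    (hs : ∀ n, f n ≠ 0 → a ≤ n ∧ n < a + 2 ^ (i + 5)) (hB : ∀ n, |f n| ≤ B) (S : Finset ℤ)
    (x : ℝ) : ‖∑ n ∈ S, (f n : ℂ) * unitExp (n * x)‖ ≤ 2 ^ (i + 5) * B := by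
  have hB0 : 0 ≤ B := (abs_nonneg _).trans (hB 0)
  calc _ ≤ ∑ n ∈ S, |f n| := by
        refine (norm_sum_le _ _).trans (Finset.sum_le_sum fun n _ => ?_)
        rw [norm_mul, norm_unitExp, mul_one, Complex.norm_real, Real.norm_eq_abs]
    _ ≤ ∑ n ∈ S ∪ Finset.Ico a (a + 2 ^ (i + 5)), |f n| :=
        Finset.sum_le_sum_of_subset_of_nonneg Finset.subset_union_left fun _ _ _ => abs_nonneg _
    _ = ∑ n ∈ Finset.Ico a (a + 2 ^ (i + 5)), |f n| :=
        (Finset.sum_subset Finset.subset_union_right fun n _ hn => by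
          by_contra h
          exact hn (Finset.mem_Ico.2 (hs n (by simpa using h)))).symm
    _ ≤ (Finset.Ico a (a + 2 ^ (i + 5))).card • B := Finset.sum_le_card_nsmul _ _ _ fun n _ => hB n
    _ = _ := by
        rw [Int.card_Ico, nsmul_eq_mul]
        have : a + 2 ^ (i + 5) - a = ((2 ^ (i + 5) : ℕ) : ℤ) := by push_cast; ring
        rw [this, Int.toNat_natCast]; push_cast; ring

/-- The point `j` is light with exponent `ν` down to scale `i`: every tile of scale `l ≤ i` over
`j` whose frequency interval lies in that of `M j` at scale `i` carries a `2 ^ (-ν)` fraction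
of mass. -/
def IsLight (b : ℕ) (E : Finset ℕ) (M : ℕ → ℕ) (ν j i : ℕ) : Prop :=
  ∀ l ≤ i, ∀ ξ, ξ / 2 ^ (i + 3) = M j / 2 ^ (i + 3) →
    (E.filter fun j' => j' / 2 ^ (b - l) = j / 2 ^ (b - l) ∧
      M j' / 2 ^ (l + 3) = ξ / 2 ^ (l + 3)).card * 2 ^ ν ≤ 2 ^ (b - l)

lemma div_two_pow_eq_of_le {x y i k : ℕ} (h : x / 2 ^ i = y / 2 ^ i) (hik : i ≤ k) :
    x / 2 ^ k = y / 2 ^ k := by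
  obtain ⟨d, rfl⟩ := Nat.exists_eq_add_of_le hik
  rw [pow_add, ← Nat.div_div_eq_div_mul, ← Nat.div_div_eq_div_mul, h]

lemma IsLight.mono {b : ℕ} {E : Finset ℕ} {M : ℕ → ℕ} {ν j i i' : ℕ}
    (h : IsLight b E M ν j i) (hi : i' ≤ i) : IsLight b E M ν j i' := fun l hl ξ hξ =>
  h l (hl.trans hi) ξ (div_two_pow_eq_of_le hξ (by omega))

/-- Points whose light tiles are comparable to a given frequency are sparse in every block. -/
lemma card_light_le {b : ℕ} {E F : Finset ℕ} {M : ℕ → ℕ} {ν : ℕ} {sc : ℕ → ℕ} (hFE : F ⊆ E)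
    (hb : ∀ j ∈ F, sc j ≤ b) (hL : ∀ j ∈ F, IsLight b E M ν j (sc j)) (i q ξ : ℕ) :
    (F.filter fun j => j / 2 ^ (b - i) = q ∧ i ≤ sc j ∧
      M j / 2 ^ (sc j + 3) = ξ / 2 ^ (sc j + 3)).card * 2 ^ ν ≤ 2 * 2 ^ (b - i) := by
  set U := F.filter fun j => i ≤ sc j ∧ M j / 2 ^ (sc j + 3) = ξ / 2 ^ (sc j + 3) with hU
  have key : ∀ d l, b - l = d → l ≤ b → ∀ q, (∃ j ∈ U, j / 2 ^ (b - l) = q ∧ l ≤ sc j) →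
      (U.filter fun j => j / 2 ^ (b - l) = q).card * 2 ^ ν ≤ 2 * 2 ^ (b - l) := by
    intro d
    induction d with
    | zero =>
      rintro l hl hlb q ⟨j0, hj0, hq, hs⟩
      obtain ⟨hF0, -, hξ⟩ := Finset.mem_filter.1 hj0
      have h := hL j0 hF0 l hs ξ hξ.symm
      refine le_trans (Nat.mul_le_mul_right _ (Finset.card_le_card ?_)) (h.trans (by omega))
      intro j hj
      obtain ⟨hjU, hjq⟩ := Finset.mem_filter.1 hj
      rw [hl, pow_zero, Nat.div_one] at hjq hq
      obtain rfl : j = j0 := by omega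
      have : sc j = l := by have := hb j hF0; omega
      exact Finset.mem_filter.2 ⟨hFE hF0, rfl, by rw [← this]; exact hξ⟩
    | succ d ih =>
      rintro l hl hlb q ⟨j0, hj0, hq, hs⟩
      obtain ⟨hF0, -, hξ⟩ := Finset.mem_filter.1 hj0
      have h := hL j0 hF0 l hs ξ hξ.symm
      set T := E.filter fun j' => j' / 2 ^ (b - l) = j0 / 2 ^ (b - l) ∧
        M j' / 2 ^ (l + 3) = ξ / 2 ^ (l + 3)
      have hpow : (2 : ℕ) ^ (b - l) = 2 * 2 ^ (b - (l + 1)) := by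
        rw [show b - l = b - (l + 1) + 1 by omega, pow_succ]; ring
      have hdd : ∀ j, j / 2 ^ (b - l) = j / 2 ^ (b - (l + 1)) / 2 := fun j => by
        rw [Nat.div_div_eq_div_mul, hpow, mul_comm]
      set V : ℕ → Finset ℕ := fun q' => U.filter fun j => j / 2 ^ (b - (l + 1)) = q'
      have hchild : ∀ q', q' / 2 = q → (V q').card * 2 ^ ν ≤ 2 * 2 ^ (b - (l + 1)) ∨
          V q' ⊆ T.filter fun j => j / 2 ^ (b - (l + 1)) = q' := by
        intro q' hq'
        by_cases hocc : ∃ j ∈ U, j / 2 ^ (b - (l + 1)) = q' ∧ l + 1 ≤ sc j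
        · exact Or.inl (ih (l + 1) (by omega) (by omega) q' hocc)
        · right
          push Not at hocc
          intro j hj
          obtain ⟨hjU, hjq⟩ := Finset.mem_filter.1 hj
          obtain ⟨hjF, -, hjξ⟩ := Finset.mem_filter.1 hjU
          refine Finset.mem_filter.2 ⟨Finset.mem_filter.2 ⟨hFE hjF, ?_, ?_⟩, hjq⟩
          · rw [hq, hdd, hjq, hq']
          · exact div_two_pow_eq_of_le hjξ (by have := hocc j hjU hjq; omega)
      have hsplit : (U.filter fun j => j / 2 ^ (b - l) = q)
          ⊆ V (2 * q) ∪ V (2 * q + 1) := by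
        intro j hj
        obtain ⟨hjU, hjq⟩ := Finset.mem_filter.1 hj
        rw [hdd] at hjq
        rcases (by omega : j / 2 ^ (b - (l + 1)) = 2 * q ∨ j / 2 ^ (b - (l + 1)) = 2 * q + 1)
          with h | h
        · exact Finset.mem_union_left _ (Finset.mem_filter.2 ⟨hjU, h⟩)
        · exact Finset.mem_union_right _ (Finset.mem_filter.2 ⟨hjU, h⟩)
      have hcard := (Finset.card_le_card hsplit).trans (Finset.card_union_le _ _)
      have hT : ∀ q', (T.filter fun j => j / 2 ^ (b - (l + 1)) = q').card * 2 ^ ν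
          ≤ 2 ^ (b - l) := fun q' =>
        (Nat.mul_le_mul_right _ (Finset.card_le_card (Finset.filter_subset _ _))).trans h
      have hcard' := Nat.mul_le_mul_right (2 ^ ν) hcard
      rw [add_mul] at hcard'
      rcases hchild (2 * q) (by omega) with h1 | h1 <;>
        rcases hchild (2 * q + 1) (by omega) with h2 | h2
      · omega
      · have := Nat.mul_le_mul_right (2 ^ ν) (Finset.card_le_card h2)
        have := hT (2 * q + 1)
        omega
      · have := Nat.mul_le_mul_right (2 ^ ν) (Finset.card_le_card h1)
        have := hT (2 * q)
        omega
      · have := Nat.mul_le_mul_right (2 ^ ν) (Finset.card_le_card h1)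
        have := hT (2 * q)
        have := Nat.mul_le_mul_right (2 ^ ν) (Finset.card_le_card h2)
        have := hT (2 * q + 1)
        omega
  have hUq : (F.filter fun j => j / 2 ^ (b - i) = q ∧ i ≤ sc j ∧
      M j / 2 ^ (sc j + 3) = ξ / 2 ^ (sc j + 3)) = U.filter fun j => j / 2 ^ (b - i) = q := by
    ext j; simp only [hU, Finset.mem_filter]; tauto
  rw [hUq]
  rcases (U.filter fun j => j / 2 ^ (b - i) = q).eq_empty_or_nonempty with h | ⟨j, hj⟩
  · rw [h]; simp
  · obtain ⟨hjU, hjq⟩ := Finset.mem_filter.1 hj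
    obtain ⟨hjF, hji, -⟩ := Finset.mem_filter.1 hjU
    exact key _ i rfl (hji.trans (hb j hjF)) q ⟨j, hjU, hjq, hji⟩

lemma sum_range_inv_add_sq_le {R : ℝ} (hR : 1 ≤ R) (n : ℕ) :
    ∑ k ∈ Finset.range n, 1 / ((k : ℝ) + R) ^ 2 ≤ 2 / R := by
  have : ∑ k ∈ Finset.range n, 1 / ((k : ℝ) + R) ^ 2 ≤ 2 / R - 1 / ((n : ℝ) + R - 1 / 2) := by
    induction n with
    | zero =>
      simp only [Finset.range_zero, Finset.sum_empty, Nat.cast_zero, zero_add, sub_nonneg]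
      rw [div_le_div_iff₀ (by linarith) (by linarith)]; linarith
    | succ n ih =>
      rw [Finset.sum_range_succ]
      have hn : (0 : ℝ) ≤ n := Nat.cast_nonneg n
      have : 1 / ((n : ℝ) + R) ^ 2
          ≤ 1 / ((n : ℝ) + R - 1 / 2) - 1 / (((n + 1 : ℕ) : ℝ) + R - 1 / 2) := by
        push_cast
        rw [div_sub_div _ _ (by linarith) (by linarith),
          div_le_div_iff₀ (by positivity) (by nlinarith)]
        nlinarith
      linarith
  have hn : (0 : ℝ) ≤ n := Nat.cast_nonneg n
  have : 0 ≤ 1 / ((n : ℝ) + R - 1 / 2) := div_nonneg zero_le_one (by linarith)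
  linarith

lemma sum_inv_abs_sub_add_sq_le {R : ℝ} (hR : 1 ≤ R) (T : Finset ℕ) (q : ℕ) :
    ∑ k ∈ T, 1 / (|(k : ℝ) - q| + R) ^ 2 ≤ 4 / R := by
  have hhalf : ∀ (U : Finset ℕ) (φ : ℕ → ℕ), Set.InjOn φ U →
      ∑ k ∈ U, 1 / ((φ k : ℝ) + R) ^ 2 ≤ 2 / R := by
    intro U φ hφ
    obtain ⟨n, hn⟩ := (U.image φ).exists_nat_subset_range
    rw [← Finset.sum_image (f := fun k : ℕ => 1 / ((k : ℝ) + R) ^ 2) hφ]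
    exact (Finset.sum_le_sum_of_subset_of_nonneg hn fun _ _ _ => by positivity).trans
      (sum_range_inv_add_sq_le hR n)
  have h1 := hhalf (T.filter fun k => q ≤ k) (fun k => k - q) (by
    intro a ha c hc h
    simp only [Finset.coe_filter, Set.mem_ofPred_eq] at ha hc h
    omega)
  have h2 := hhalf (T.filter fun k => ¬ q ≤ k) (fun k => q - k) (by
    intro a ha c hc h
    simp only [Finset.coe_filter, Set.mem_ofPred_eq] at ha hc h
    omega)
  rw [← Finset.sum_filter_add_sum_filter_not T (fun k => q ≤ k)]
  refine (add_le_add (le_of_eq_of_le (Finset.sum_congr rfl fun k hk => ?_) h1)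
    (le_of_eq_of_le (Finset.sum_congr rfl fun k hk => ?_) h2)).trans (by ring_nf; rfl)
  · have := (Finset.mem_filter.1 hk).2
    rw [Nat.cast_sub this, abs_of_nonneg (sub_nonneg.2 (by exact_mod_cast this))]
  · have := (Finset.mem_filter.1 hk).2
    rw [Nat.cast_sub (by omega), abs_of_nonpos (sub_nonpos.2 (by exact_mod_cast (by omega)))]
    ring

/-- The dual maximal operator with multipliers `m j` at the points `j / 2 ^ b`. -/
noncomputable def osc (b : ℕ) (F : Finset ℕ) (g : ℕ → ℂ) (m : ℕ → ℤ → ℝ) (n : ℤ) : ℂ :=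
  ∑ j ∈ F, g j * (m j n : ℂ) * unitExp (n * ((j : ℝ) / 2 ^ b))

/-- The correlation of two multipliers at the points `j / 2 ^ b` and `j' / 2 ^ b`. -/
noncomputable def kern (b : ℕ) (S : Finset ℤ) (u v : ℤ → ℝ) (j j' : ℕ) : ℂ :=
  ∑ n ∈ S, ((u n * v n : ℝ) : ℂ) * unitExp (n * (((j : ℝ) - j') / 2 ^ b))

lemma norm_kern_comm (b : ℕ) (S : Finset ℤ) (u v : ℤ → ℝ) (j j' : ℕ) :
    ‖kern b S u v j j'‖ = ‖kern b S v u j' j‖ := by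
  have : kern b S v u j' j = star (kern b S u v j j') := by
    rw [kern, kern, star_sum]
    refine Finset.sum_congr rfl fun n _ => ?_
    rw [star_mul', ← unitExp_neg, Complex.star_def, Complex.conj_ofReal, mul_comm (v n)]
    congr 2
    ring
  rw [this, norm_star]

lemma sum_osc_mul_star_osc (b : ℕ) (F F' : Finset ℕ) (g : ℕ → ℂ) (m : ℕ → ℤ → ℝ)
    (S : Finset ℤ) :
    ∑ n ∈ S, osc b F g m n * star (osc b F' g m n)
      = ∑ j ∈ F, ∑ j' ∈ F', g j * star (g j') * kern b S (m j) (m j') j j' := by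
  simp_rw [osc, star_sum, Finset.sum_mul_sum, kern]
  rw [Finset.sum_comm]
  refine Finset.sum_congr rfl fun j _ => ?_
  rw [Finset.sum_comm]
  refine Finset.sum_congr rfl fun j' _ => ?_
  rw [Finset.mul_sum]
  refine Finset.sum_congr rfl fun n _ => ?_
  have h1 : unitExp (n * (((j : ℝ) - j') / 2 ^ b))
      = unitExp (n * ((j : ℝ) / 2 ^ b)) * star (unitExp (n * ((j' : ℝ) / 2 ^ b))) := by
    rw [← unitExp_neg, ← unitExp_add]; congr 1; ring
  rw [h1]
  simp only [star_mul', Complex.star_def, Complex.conj_ofReal]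
  push_cast
  ring

lemma norm_sum_osc_mul_star_osc_le (b : ℕ) (F F' : Finset ℕ) {g : ℕ → ℂ} (hg : ∀ j, ‖g j‖ ≤ 1)
    (m : ℕ → ℤ → ℝ) (S : Finset ℤ) :
    ‖∑ n ∈ S, osc b F g m n * star (osc b F' g m n)‖
      ≤ ∑ j ∈ F, ∑ j' ∈ F', ‖kern b S (m j) (m j') j j'‖ := by
  rw [sum_osc_mul_star_osc]
  refine (norm_sum_le _ _).trans (Finset.sum_le_sum fun j _ => ?_)
  refine (norm_sum_le _ _).trans (Finset.sum_le_sum fun j' _ => ?_)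
  rw [norm_mul, norm_mul, norm_star]
  have := mul_le_one₀ (hg j) (norm_nonneg _) (hg j')
  exact mul_le_of_le_one_left (norm_nonneg _) this

lemma sum_norm_sq_osc_eq (b : ℕ) (F : Finset ℕ) (g : ℕ → ℂ) (m : ℕ → ℤ → ℝ) (S : Finset ℤ) :
    ∑ n ∈ S, ‖osc b F g m n‖ ^ 2 = ‖∑ n ∈ S, osc b F g m n * star (osc b F g m n)‖ := by
  have : ∑ n ∈ S, osc b F g m n * star (osc b F g m n)
      = ((∑ n ∈ S, ‖osc b F g m n‖ ^ 2 : ℝ) : ℂ) := by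
    push_cast
    refine Finset.sum_congr rfl fun n _ => ?_
    rw [Complex.star_def, Complex.mul_conj, Complex.normSq_eq_norm_sq]
    push_cast; rfl
  rw [this, Complex.norm_real, Real.norm_eq_abs, abs_of_nonneg (by positivity)]

lemma sum_norm_sq_osc_le (b : ℕ) (F : Finset ℕ) {g : ℕ → ℂ} (hg : ∀ j, ‖g j‖ ≤ 1)
    (m : ℕ → ℤ → ℝ) (S : Finset ℤ) :
    ∑ n ∈ S, ‖osc b F g m n‖ ^ 2 ≤ ∑ j ∈ F, ∑ j' ∈ F, ‖kern b S (m j) (m j') j j'‖ := by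
  rw [sum_norm_sq_osc_eq]
  exact norm_sum_osc_mul_star_osc_le b F F hg m S

/-- A multiplier of scale `i`, of size `2 ^ (-r)`, supported in a window of length
`2 ^ (i + 5)`. -/
structure IsScaleAtom (i r : ℕ) (f : ℤ → ℝ) : Prop where
  smooth : SmoothAt i 16384 f
  small : ∀ n, |f n| ≤ 16384 / 2 ^ r
  window : ∃ a : ℤ, ∀ n, f n ≠ 0 → a ≤ n ∧ n < a + 2 ^ (i + 5)

lemma exists_support_finset {F : Finset ℕ} {m : ℕ → ℤ → ℝ} {sc : ℕ → ℕ} {r : ℕ}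
    (hm : ∀ j ∈ F, IsScaleAtom (sc j) r (m j)) (S : Finset ℤ) :
    ∃ S' : Finset ℤ, S ⊆ S' ∧ ∀ j ∈ F, ∀ n, m j n ≠ 0 → n ∈ S' := by
  classical
  have : ∀ j, ∃ a : ℤ, j ∈ F → ∀ n, m j n ≠ 0 → a ≤ n ∧ n < a + 2 ^ (sc j + 5) := fun j => by
    by_cases h : j ∈ F
    · obtain ⟨a, ha⟩ := (hm j h).window; exact ⟨a, fun _ => ha⟩
    · exact ⟨0, fun h' => absurd h' h⟩
  choose a ha using this
  refine ⟨S ∪ F.biUnion fun j => Finset.Ico (a j) (a j + 2 ^ (sc j + 5)),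
    Finset.subset_union_left, fun j hj n hn => Finset.mem_union_right _
      (Finset.mem_biUnion.2 ⟨j, hj, Finset.mem_Ico.2 (ha j hj n hn)⟩)⟩

lemma abs_div_sub_le {q s j j' : ℕ} (hs : 0 < s) (hq : j / s = q) :
    (|(q : ℝ) - ((j' / s : ℕ) : ℝ)| - 1) * s ≤ |(j : ℝ) - j'| := by
  have h1 := Nat.div_add_mod j s
  have h2 := Nat.div_add_mod j' s
  have h3 := Nat.mod_lt j hs
  have h4 := Nat.mod_lt j' hs
  rw [hq] at h1
  have e1 : (j : ℝ) = s * q + ((j % s : ℕ) : ℝ) := by exact_mod_cast h1.symm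
  have e2 : (j' : ℝ) = s * ((j' / s : ℕ) : ℝ) + ((j' % s : ℕ) : ℝ) := by exact_mod_cast h2.symm
  have e3 : ((j % s : ℕ) : ℝ) < s := by exact_mod_cast h3
  have e4 : ((j' % s : ℕ) : ℝ) < s := by exact_mod_cast h4
  have e5 : (0 : ℝ) ≤ ((j % s : ℕ) : ℝ) := Nat.cast_nonneg _
  have e6 : (0 : ℝ) ≤ ((j' % s : ℕ) : ℝ) := Nat.cast_nonneg _
  set A : ℝ := ((j' / s : ℕ) : ℝ)
  set x : ℝ := ((j % s : ℕ) : ℝ)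
  set y : ℝ := ((j' % s : ℕ) : ℝ)
  rw [e1, e2]
  rcases abs_cases ((q : ℝ) - A) with ⟨h, _⟩ | ⟨h, _⟩ <;> rw [h]
  · refine le_trans ?_ (le_abs_self _); nlinarith
  · refine le_trans ?_ (neg_le_abs _); nlinarith

lemma abs_sub_div_le_half {b j j' : ℕ} (hj : 2 * j ≤ 2 ^ b) (hj' : 2 * j' ≤ 2 ^ b) :
    |((j : ℝ) - j') / 2 ^ b| ≤ 1 / 2 := by
  have h1 : (2 : ℝ) * j ≤ 2 ^ b := by exact_mod_cast hj
  have h2 : (2 : ℝ) * j' ≤ 2 ^ b := by exact_mod_cast hj'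
  have h3 : (0 : ℝ) ≤ j := Nat.cast_nonneg _
  have h4 : (0 : ℝ) ≤ j' := Nat.cast_nonneg _
  rw [abs_div, abs_of_pos (by positivity : (0 : ℝ) < 2 ^ b), div_le_iff₀ (by positivity), abs_le]
  constructor <;> linarith

/-- Correlation decay for two atoms. -/
lemma norm_kern_le {b i' r : ℕ} {S : Finset ℤ} {u v : ℤ → ℝ} (hi' : i' ≤ b)
    (hu : SmoothAt i' 16384 u) (hur : ∀ n, |u n| ≤ 16384 / 2 ^ r)
    (hv : IsScaleAtom i' r v) (hS : ∀ n, v n ≠ 0 → n ∈ S)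
    {j j' : ℕ} (hj : 2 * j ≤ 2 ^ b) (hj' : 2 * j' ≤ 2 ^ b) :
    ‖kern b S u v j j'‖ ≤ 2 ^ 35 * 2 ^ i' /
      (|((j / 2 ^ (b - i') : ℕ) : ℝ) - ((j' / 2 ^ (b - i') : ℕ) : ℝ)| + 2 ^ r) ^ 2 := by
  obtain ⟨a, ha⟩ := hv.window
  set c : ℝ := |((j / 2 ^ (b - i') : ℕ) : ℝ) - ((j' / 2 ^ (b - i') : ℕ) : ℝ)| with hc
  have hc0 : 0 ≤ c := abs_nonneg _
  have hp : (0 : ℝ) < 2 ^ i' := by positivity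
  have hr : (1 : ℝ) ≤ 2 ^ r := one_le_pow₀ (by norm_num)
  rw [le_div_iff₀ (by positivity)]
  set x := ((j : ℝ) - j') / 2 ^ b with hx
  have hsmall : ‖kern b S u v j j'‖ * (2 ^ r) ^ 2 ≤ 2 ^ 33 * 2 ^ i' := by
    have h := norm_sum_mul_unitExp_le_card (f := fun n => u n * v n) (B := (16384 / 2 ^ r) ^ 2)
      (fun n hn => ha n (right_ne_zero_of_mul hn))
      (fun n => by
        rw [abs_mul, sq]
        gcongr
        · exact hur n
        · exact hv.small n) S x
    calc ‖kern b S u v j j'‖ * (2 ^ r) ^ 2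
        ≤ 2 ^ (i' + 5) * (16384 / 2 ^ r) ^ 2 * (2 ^ r) ^ 2 := by gcongr; exact h
      _ = 2 ^ 33 * 2 ^ i' := by field_simp; ring
  rcases lt_or_ge c 2 with h2 | h2
  · have : (c + 2 ^ r) ^ 2 ≤ 9 * (2 ^ r) ^ 2 := by nlinarith
    by_cases h1 : c ≤ 1
    · have : (c + 2 ^ r) ^ 2 ≤ 4 * (2 ^ r) ^ 2 := by nlinarith
      nlinarith [norm_nonneg (kern b S u v j j')]
    · exfalso
      rw [not_le] at h1
      have hz : c = ((|((j / 2 ^ (b - i') : ℕ) : ℤ) - ((j' / 2 ^ (b - i') : ℕ) : ℤ)| : ℤ) : ℝ) := by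
        rw [hc]; push_cast; rfl
      rw [hz] at h1 h2
      have h1' : (1 : ℤ) < |((j / 2 ^ (b - i') : ℕ) : ℤ) - ((j' / 2 ^ (b - i') : ℕ) : ℤ)| := by
        exact_mod_cast h1
      have h2' : |((j / 2 ^ (b - i') : ℕ) : ℤ) - ((j' / 2 ^ (b - i') : ℕ) : ℤ)| < (2 : ℤ) := by
        exact_mod_cast h2
      omega
  · have hD := abs_div_sub_le (j' := j') (by positivity : 0 < 2 ^ (b - i'))
      (rfl : j / 2 ^ (b - i') = _)
    rw [← hc] at hD
    push_cast at hD
    have hb : (2 : ℝ) ^ b = 2 ^ (b - i') * 2 ^ i' := by rw [← pow_add]; congr 1; omega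
    have hxc : c ≤ 2 * 2 ^ i' * |x| := by
      rw [hx, abs_div, abs_of_pos (by positivity : (0 : ℝ) < 2 ^ b), hb]
      have e : 2 * 2 ^ i' * (|(j : ℝ) - j'| / (2 ^ (b - i') * 2 ^ i'))
        = 2 * |(j : ℝ) - j'| / 2 ^ (b - i') := by field_simp
      rw [e, le_div_iff₀ (by positivity)]
      have : (0 : ℝ) < 2 ^ (b - i') := by positivity
      nlinarith
    have hk := norm_sum_mul_unitExp_mul_le (f := fun n => u n * v n)
      (fun n hn => hS n (right_ne_zero_of_mul hn)) (hu.mul hv.smooth a ha)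
      (abs_sub_div_le_half hj hj')
    rw [← hx] at hk
    have hk' : ‖kern b S u v j j'‖ * (16 * x ^ 2) ≤ 70 * (16384 * 16384) / 2 ^ i' := hk
    rw [le_div_iff₀ hp] at hk'
    have hc2 : c ^ 2 ≤ 4 * (2 ^ i') ^ 2 * x ^ 2 := by
      rw [← sq_abs x]
      calc c ^ 2 ≤ (2 * 2 ^ i' * |x|) ^ 2 := by gcongr
        _ = _ := by ring
    have hlarge : ‖kern b S u v j j'‖ * c ^ 2 ≤ 2 ^ 33 * 2 ^ i' := by
      calc _ ≤ ‖kern b S u v j j'‖ * (4 * (2 ^ i') ^ 2 * x ^ 2) := by gcongr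
        _ = (‖kern b S u v j j'‖ * (16 * x ^ 2) * 2 ^ i') * (2 ^ i' / 4) := by ring
        _ ≤ (70 * (16384 * 16384)) * (2 ^ i' / 4) := by gcongr
        _ ≤ _ := by linarith
    have : (c + 2 ^ r) ^ 2 ≤ 2 * c ^ 2 + 2 * (2 ^ r) ^ 2 := by nlinarith [sq_nonneg (c - 2 ^ r)]
    have hk := norm_nonneg (kern b S u v j j')
    nlinarith

/-- The square function estimate for a family of atoms with nested or disjoint supports over
light points. -/
lemma sum_norm_sq_osc_atom_le {b ν r : ℕ} {E F : Finset ℕ} {M sc : ℕ → ℕ} (hFE : F ⊆ E)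
    (hb : ∀ j ∈ F, sc j ≤ b) (hF : ∀ j ∈ F, 2 * j ≤ 2 ^ b)
    (hL : ∀ j ∈ F, IsLight b E M ν j (sc j)) {m : ℕ → ℤ → ℝ}
    (hm : ∀ j ∈ F, IsScaleAtom (sc j) r (m j))
    (hn : ∀ j ∈ F, ∀ j' ∈ F, sc j' ≤ sc j → (∃ n, m j n ≠ 0 ∧ m j' n ≠ 0) →
      M j / 2 ^ (sc j + 3) = M j' / 2 ^ (sc j + 3))
    {g : ℕ → ℂ} (hg : ∀ j, ‖g j‖ ≤ 1) (S : Finset ℤ) :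
    ∑ n ∈ S, ‖osc b F g m n‖ ^ 2 ≤ 2 ^ 39 * (2 ^ b * F.card / 2 ^ ν / 2 ^ r) := by
  obtain ⟨S', hSS', hS'⟩ := exists_support_finset hm S
  have hr : (1 : ℝ) ≤ 2 ^ r := one_le_pow₀ (by norm_num)
  have hrow : ∀ j' ∈ F, ∑ j ∈ F with sc j' ≤ sc j, ‖kern b S' (m j) (m j') j j'‖
      ≤ 2 ^ 38 * (2 ^ b / 2 ^ ν / 2 ^ r) := by
    intro j' hj'
    set s := b - sc j' with hs
    set U := F.filter fun j => sc j' ≤ sc j ∧ M j / 2 ^ (sc j + 3) = M j' / 2 ^ (sc j + 3)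
    have hb' : (2 : ℝ) ^ b = 2 ^ s * 2 ^ (sc j') := by
      rw [← pow_add]; congr 1; have := hb j' hj'; omega
    calc _ = ∑ j ∈ U, ‖kern b S' (m j) (m j') j j'‖ := by
          symm
          refine Finset.sum_subset (fun j hj => ?_) fun j hj hjU => ?_
          · have := Finset.mem_filter.1 hj
            exact Finset.mem_filter.2 ⟨this.1, this.2.1⟩
          · obtain ⟨hjF, hsc⟩ := Finset.mem_filter.1 hj
            have hno : ∀ n, m j n * m j' n = 0 := by
              by_contra! h
              obtain ⟨n, hn0⟩ := h
              exact hjU (Finset.mem_filter.2 ⟨hjF, hsc, hn j hjF j' hj' hsc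
                ⟨n, left_ne_zero_of_mul hn0, right_ne_zero_of_mul hn0⟩⟩)
            simp [kern, hno]
      _ ≤ ∑ j ∈ U, 2 ^ 35 * 2 ^ (sc j') /
            (|((j / 2 ^ s : ℕ) : ℝ) - ((j' / 2 ^ s : ℕ) : ℝ)| + 2 ^ r) ^ 2 := by
          refine Finset.sum_le_sum fun j hj => ?_
          obtain ⟨hjF, hsc, -⟩ := Finset.mem_filter.1 hj
          exact norm_kern_le (hb j' hj') ((hm j hjF).smooth.mono_scale hsc) (hm j hjF).small
            (hm j' hj') (hS' j' hj') (hF j hjF) (hF j' hj')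
      _ = ∑ q ∈ U.image (fun j : ℕ => (j / 2 ^ s : ℕ)), ∑ j ∈ U with j / 2 ^ s = q,
            2 ^ 35 * 2 ^ (sc j') /
              (|((j / 2 ^ s : ℕ) : ℝ) - ((j' / 2 ^ s : ℕ) : ℝ)| + 2 ^ r) ^ 2 :=
          (Finset.sum_fiberwise_of_maps_to (fun j hj => Finset.mem_image_of_mem _ hj) _).symm
      _ ≤ ∑ q ∈ U.image (fun j : ℕ => (j / 2 ^ s : ℕ)), ((2 : ℝ) ^ 36 * (2 ^ b / 2 ^ ν)) *
            (1 / (|(q : ℝ) - ((j' / 2 ^ s : ℕ) : ℝ)| + 2 ^ r) ^ 2) := by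
          refine Finset.sum_le_sum fun q _ => ?_
          have hcard := card_light_le hFE hb hL (sc j') q (M j')
          have hsub : U.filter (fun j => j / 2 ^ s = q) ⊆ F.filter fun j =>
              j / 2 ^ (b - sc j') = q ∧ sc j' ≤ sc j ∧
                M j / 2 ^ (sc j + 3) = M j' / 2 ^ (sc j + 3) := by
            intro j hj
            obtain ⟨hjU, hq⟩ := Finset.mem_filter.1 hj
            obtain ⟨hjF, h1, h2⟩ := Finset.mem_filter.1 hjU
            exact Finset.mem_filter.2 ⟨hjF, hq, h1, h2⟩
          have hcard2 : ((U.filter fun j => j / 2 ^ s = q).card : ℝ) * 2 ^ ν ≤ 2 * 2 ^ s := by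
            exact_mod_cast (Nat.mul_le_mul_right _ (Finset.card_le_card hsub)).trans hcard
          rw [Finset.sum_congr rfl (g := fun _ => 2 ^ 35 * 2 ^ (sc j') /
              (|(q : ℝ) - ((j' / 2 ^ s : ℕ) : ℝ)| + 2 ^ r) ^ 2)
            (fun j hj => by rw [(Finset.mem_filter.1 hj).2]), Finset.sum_const, nsmul_eq_mul]
          have hcard3 : ((U.filter fun j => j / 2 ^ s = q).card : ℝ) ≤ 2 * 2 ^ s / 2 ^ ν := by
            rw [le_div_iff₀ (by positivity)]; exact hcard2
          calc _ ≤ (2 * 2 ^ s / 2 ^ ν) * (2 ^ 35 * 2 ^ (sc j') /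
              (|(q : ℝ) - ((j' / 2 ^ s : ℕ) : ℝ)| + 2 ^ r) ^ 2) := by gcongr
            _ = _ := by rw [hb']; ring
      _ ≤ (2 ^ 36 * (2 ^ b / 2 ^ ν)) * (4 / 2 ^ r) := by
          rw [← Finset.mul_sum]
          gcongr
          exact sum_inv_abs_sub_add_sq_le hr _ _
      _ = _ := by ring
  have hsq : ∑ n ∈ S, ‖osc b F g m n‖ ^ 2 ≤ ∑ n ∈ S', ‖osc b F g m n‖ ^ 2 :=
    Finset.sum_le_sum_of_subset_of_nonneg hSS' fun _ _ _ => by positivity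
  refine hsq.trans ((sum_norm_sq_osc_le b F hg m S').trans ?_)
  have hle : ∀ j ∈ F, ∀ j' ∈ F, ‖kern b S' (m j) (m j') j j'‖
      ≤ (if sc j' ≤ sc j then ‖kern b S' (m j) (m j') j j'‖ else 0)
        + (if sc j ≤ sc j' then ‖kern b S' (m j') (m j) j' j‖ else 0) := by
    intro j _ j' _
    have := norm_kern_comm b S' (m j) (m j') j j'
    have h0 := norm_nonneg (kern b S' (m j) (m j') j j')
    rw [← this]
    split_ifs <;> linarith
  calc _ ≤ ∑ j ∈ F, ∑ j' ∈ F, ((if sc j' ≤ sc j then ‖kern b S' (m j) (m j') j j'‖ else 0)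
        + (if sc j ≤ sc j' then ‖kern b S' (m j') (m j) j' j‖ else 0)) :=
        Finset.sum_le_sum fun j hj => Finset.sum_le_sum fun j' hj' => hle j hj j' hj'
    _ = 2 * ∑ j' ∈ F, ∑ j ∈ F with sc j' ≤ sc j, ‖kern b S' (m j) (m j') j j'‖ := by
        simp_rw [Finset.sum_add_distrib, Finset.sum_filter]
        rw [Finset.sum_comm]
        ring
    _ ≤ 2 * ∑ j' ∈ F, 2 ^ 38 * (2 ^ b / 2 ^ ν / 2 ^ r) := by
        gcongr with j' hj'
        exact hrow j' hj'
    _ = _ := by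
        rw [Finset.sum_const, nsmul_eq_mul]; ring

/-- The `ℓ²` norm over a finite set of frequencies. -/
noncomputable def l2norm (S : Finset ℤ) (G : ℤ → ℂ) : ℝ := √(∑ n ∈ S, ‖G n‖ ^ 2)

lemma l2norm_eq_norm (S : Finset ℤ) (G : ℤ → ℂ) :
    l2norm S G = ‖(WithLp.toLp 2 (fun n : S => G n) : EuclideanSpace ℂ S)‖ := by
  rw [EuclideanSpace.norm_eq, l2norm, ← Finset.sum_coe_sort]

lemma l2norm_nonneg (S : Finset ℤ) (G : ℤ → ℂ) : 0 ≤ l2norm S G := Real.sqrt_nonneg _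

lemma l2norm_add_le (S : Finset ℤ) (G H : ℤ → ℂ) :
    l2norm S (fun n => G n + H n) ≤ l2norm S G + l2norm S H := by
  simp only [l2norm_eq_norm]
  have h := norm_add_le (WithLp.toLp 2 (fun n : S => G n) : EuclideanSpace ℂ S)
    (WithLp.toLp 2 (fun n : S => H n))
  rw [← WithLp.toLp_add] at h
  exact h

lemma l2norm_sub_le (S : Finset ℤ) (G H : ℤ → ℂ) :
    l2norm S (fun n => G n - H n) ≤ l2norm S G + l2norm S H := by
  simp only [l2norm_eq_norm]
  have h := norm_sub_le (WithLp.toLp 2 (fun n : S => G n) : EuclideanSpace ℂ S)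
    (WithLp.toLp 2 (fun n : S => H n))
  rw [← WithLp.toLp_sub] at h
  exact h

lemma l2norm_sum_le {ι : Type*} (T : Finset ι) (S : Finset ℤ) (G : ι → ℤ → ℂ) :
    l2norm S (fun n => ∑ t ∈ T, G t n) ≤ ∑ t ∈ T, l2norm S (G t) := by
  classical
  induction T using Finset.induction_on with
  | empty => simp [l2norm]
  | insert a T ha ih =>
    simp_rw [Finset.sum_insert ha]
    exact (l2norm_add_le S _ _).trans (by gcongr)

lemma l2norm_mono (S : Finset ℤ) {G H : ℤ → ℂ} (h : ∀ n, ‖G n‖ ≤ ‖H n‖) :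
    l2norm S G ≤ l2norm S H := by
  unfold l2norm
  gcongr with n
  exact h n

lemma osc_add (b : ℕ) (F : Finset ℕ) (g : ℕ → ℂ) (u v : ℕ → ℤ → ℝ) (n : ℤ) :
    osc b F g (fun j n => u j n + v j n) n = osc b F g u n + osc b F g v n := by
  simp only [osc, ← Finset.sum_add_distrib]
  refine Finset.sum_congr rfl fun j _ => ?_
  push_cast; ring

lemma osc_sub (b : ℕ) (F : Finset ℕ) (g : ℕ → ℂ) (u v : ℕ → ℤ → ℝ) (n : ℤ) :
    osc b F g (fun j n => u j n - v j n) n = osc b F g u n - osc b F g v n := by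
  simp only [osc, ← Finset.sum_sub_distrib]
  refine Finset.sum_congr rfl fun j _ => ?_
  push_cast; ring

lemma osc_sum {ι : Type*} (T : Finset ι) (b : ℕ) (F : Finset ℕ) (g : ℕ → ℂ)
    (u : ι → ℕ → ℤ → ℝ) (n : ℤ) :
    osc b F g (fun j n => ∑ t ∈ T, u t j n) n = ∑ t ∈ T, osc b F g (u t) n := by
  simp only [osc]
  rw [Finset.sum_comm]
  refine Finset.sum_congr rfl fun j _ => ?_
  push_cast
  rw [Finset.mul_sum, Finset.sum_mul]

lemma osc_const_mul (b : ℕ) (F : Finset ℕ) (g : ℕ → ℂ) (p : ℤ → ℝ) (u : ℕ → ℤ → ℝ) (n : ℤ) :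
    osc b F g (fun j n => p n * u j n) n = (p n : ℂ) * osc b F g u n := by
  simp only [osc, Finset.mul_sum]
  refine Finset.sum_congr rfl fun j _ => ?_
  push_cast; ring

lemma osc_congr {b : ℕ} {F : Finset ℕ} {g : ℕ → ℂ} {u v : ℕ → ℤ → ℝ}
    (h : ∀ j ∈ F, ∀ n, u j n = v j n) (n : ℤ) : osc b F g u n = osc b F g v n :=
  Finset.sum_congr rfl fun j hj => by rw [h j hj]

lemma l2norm_osc_atom_le {b ν r : ℕ} {E F : Finset ℕ} {M sc : ℕ → ℕ} (hFE : F ⊆ E)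
    (hb : ∀ j ∈ F, sc j ≤ b) (hF : ∀ j ∈ F, 2 * j ≤ 2 ^ b)
    (hL : ∀ j ∈ F, IsLight b E M ν j (sc j)) {m : ℕ → ℤ → ℝ}
    (hm : ∀ j ∈ F, IsScaleAtom (sc j) r (m j))
    (hn : ∀ j ∈ F, ∀ j' ∈ F, sc j' ≤ sc j → (∃ n, m j n ≠ 0 ∧ m j' n ≠ 0) →
      M j / 2 ^ (sc j + 3) = M j' / 2 ^ (sc j + 3))
    {g : ℕ → ℂ} (hg : ∀ j, ‖g j‖ ≤ 1) (S : Finset ℤ) :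
    l2norm S (osc b F g m) ≤ 2 ^ 20 * √(2 ^ b * F.card / 2 ^ ν) * (3 / 4) ^ r := by
  refine Real.sqrt_le_iff.2 ⟨by positivity, ?_⟩
  refine (sum_norm_sq_osc_atom_le hFE hb hF hL hm hn hg S).trans ?_
  rw [mul_pow, mul_pow, Real.sq_sqrt (by positivity),
    show (((3 : ℝ) / 4) ^ r) ^ 2 = ((3 / 4) ^ 2) ^ r by rw [← pow_mul, ← pow_mul, mul_comm]]
  have : (1 : ℝ) / 2 ^ r ≤ ((3 / 4) ^ 2) ^ r := by
    rw [← one_div_pow]; gcongr; norm_num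
  have h2 : (2 : ℝ) ^ 39 ≤ (2 ^ 20) ^ 2 := by norm_num
  rw [div_eq_mul_one_div _ ((2 : ℝ) ^ r), ← mul_assoc]
  exact mul_le_mul (mul_le_mul_of_nonneg_right h2 (by positivity)) this (by positivity)
    (by positivity)

/-- The bump at scale `i` below `M`, retained only when the relevant binary digit of `M` is `1`. -/
noncomputable def digitBump (M i : ℕ) (n : ℤ) : ℝ :=
  if M / 2 ^ (i + 2) % 2 = 1 then bump i ((M : ℤ) - n) else 0

lemma smoothAt_zero (i : ℕ) : SmoothAt i 0 (fun _ => 0) :=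
  ⟨fun n => by simp, fun n => by simp, fun T => by simp⟩

lemma smoothAt_digitBump (M i : ℕ) : SmoothAt i 8 (digitBump M i) := by
  by_cases h : M / 2 ^ (i + 2) % 2 = 1
  · have : digitBump M i = fun n => bump i ((M : ℤ) - n) := by ext n; simp [digitBump, h]
    rw [this]
    exact (smoothAt_bump i).reflect M
  · have : digitBump M i = fun _ => 0 := by ext n; simp [digitBump, h]
    rw [this]
    exact (smoothAt_zero i).mono (by norm_num)

lemma digitBump_nonneg (M i : ℕ) (n : ℤ) : 0 ≤ digitBump M i n := by
  unfold digitBump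
  split_ifs
  exacts [bump_nonneg _ _, le_rfl]

lemma digitBump_le_bump (M i : ℕ) (n : ℤ) : digitBump M i n ≤ bump i ((M : ℤ) - n) := by
  unfold digitBump
  split_ifs
  exacts [le_rfl, bump_nonneg _ _]

lemma sum_digitBump_le_one (T : Finset ℕ) (M : ℕ) (n : ℤ) : ∑ i ∈ T, digitBump M i n ≤ 1 :=
  (Finset.sum_le_sum fun i _ => digitBump_le_bump M i n).trans (sum_bump_le_one T _)

lemma digitBump_ne_zero {M i : ℕ} {n : ℤ} (h : digitBump M i n ≠ 0) :
    M / 2 ^ (i + 2) % 2 = 1 ∧ 2 ^ i < (M : ℤ) - n ∧ (M : ℤ) - n < 2 ^ (i + 2) := by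
  unfold digitBump at h
  split_ifs at h with h'
  · exact ⟨h', lt_of_bump_ne_zero h⟩
  · exact absurd rfl h

lemma digitBump_eq_of_div_eq {M ξ k i : ℕ} (h : M / 2 ^ (k + 3) = ξ / 2 ^ (k + 3)) (hi : k < i)
    (n : ℤ) : digitBump M i n
      = if ξ / 2 ^ (i + 2) % 2 = 1 then bump i ((M : ℤ) - n) else 0 := by
  rw [digitBump, div_two_pow_eq_of_le h (by omega)]

lemma isScaleAtom_digitBump (M i : ℕ) : IsScaleAtom i 0 (digitBump M i) where
  smooth := (smoothAt_digitBump M i).mono (by norm_num)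
  small n := ((smoothAt_digitBump M i).bound n).trans (by norm_num)
  window := ⟨M - 2 ^ (i + 2), fun n hn => by
    obtain ⟨-, h1, h2⟩ := digitBump_ne_zero hn
    have h3 : (2 : ℤ) ^ (i + 2) = 4 * 2 ^ i := by ring
    have h4 : (2 : ℤ) ^ (i + 5) = 32 * 2 ^ i := by ring
    omega⟩

lemma isScaleAtom_zero (i r : ℕ) : IsScaleAtom i r (fun _ => 0) where
  smooth := (smoothAt_zero i).mono (by norm_num)
  small n := by simp only [abs_zero]; positivity
  window := ⟨0, fun n hn => absurd rfl hn⟩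

lemma isScaleAtom_plateau (ξ : ℤ) (i : ℕ) : IsScaleAtom i 0 (fun n => plateau i (ξ - n)) where
  smooth := ((smoothAt_plateau i).reflect ξ).mono (by norm_num)
  small n := (abs_plateau_le_one i _).trans (by norm_num)
  window := ⟨ξ - 2 ^ (i + 3), fun n hn => by
    have h1 := abs_lt.1 (abs_lt_of_plateau_ne_zero hn)
    have h3 : (2 : ℤ) ^ (i + 3) = 8 * 2 ^ i := by ring
    have h4 : (2 : ℤ) ^ (i + 5) = 32 * 2 ^ i := by ring
    omega⟩

/-- The transition terms created by truncating a sum of bumps with a plateau. -/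
noncomputable def edgeBump (ξ k : ℕ) (n : ℤ) : ℝ :=
  (digitBump ξ (k + 1) n + digitBump ξ (k + 2) n) * plateau k ((ξ : ℤ) - n)

lemma isScaleAtom_edgeBump (ξ k : ℕ) : IsScaleAtom k 0 (edgeBump ξ k) := by
  have hw : ∀ n, plateau k ((ξ : ℤ) - n) ≠ 0 →
      (ξ : ℤ) - 2 ^ (k + 3) ≤ n ∧ n < (ξ : ℤ) - 2 ^ (k + 3) + 2 ^ (k + 5) := fun n hn => by
    have h1 := abs_lt.1 (abs_lt_of_plateau_ne_zero hn)
    have h3 : (2 : ℤ) ^ (k + 3) = 8 * 2 ^ k := by ring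
    have h4 : (2 : ℤ) ^ (k + 5) = 32 * 2 ^ k := by ring
    omega
  have h := (((smoothAt_digitBump ξ (k + 1)).mono_scale (by omega : k ≤ k + 1)).add
    ((smoothAt_digitBump ξ (k + 2)).mono_scale (by omega : k ≤ k + 2))).mul
      ((smoothAt_plateau k).reflect ξ) _ hw
  have hs : SmoothAt k 16384 (edgeBump ξ k) := h.mono (by norm_num)
  exact ⟨hs, fun n => by simpa using hs.bound n,
    ⟨_, fun n hn => hw n (right_ne_zero_of_mul hn)⟩⟩

lemma sum_digitBump_eq_plateau {ξ k B : ℕ} (hk : k + 3 ≤ B) (n : ℤ) :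
    ∑ i ∈ Finset.range (k + 1), digitBump ξ i n
      = (∑ i ∈ Finset.range B, digitBump ξ i n) * plateau k ((ξ : ℤ) - n) - edgeBump ξ k n := by
  have h1 : ∀ i ∈ Finset.range (k + 1),
      digitBump ξ i n * plateau k ((ξ : ℤ) - n) = digitBump ξ i n := by
    intro i hi
    by_cases h : digitBump ξ i n = 0
    · rw [h, zero_mul]
    · obtain ⟨-, h2, h3⟩ := digitBump_ne_zero h
      have hpos : (0 : ℤ) < 2 ^ i := by positivity
      rw [plateau_eq_one, mul_one]
      rw [abs_of_pos (by omega)]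
      refine h3.le.trans ?_
      have := Finset.mem_range.1 hi
      gcongr
      · norm_num
      · omega
  have h2 : ∀ i ∈ Finset.Ico (k + 3) B, digitBump ξ i n * plateau k ((ξ : ℤ) - n) = 0 := by
    intro i hi
    by_contra h
    obtain ⟨-, h2, h3⟩ := digitBump_ne_zero (left_ne_zero_of_mul h)
    have h4 := abs_lt.1 (abs_lt_of_plateau_ne_zero (right_ne_zero_of_mul h))
    have h5 : (2 : ℤ) ^ (k + 3) ≤ 2 ^ i := by
      have := (Finset.mem_Ico.1 hi).1
      gcongr
      norm_num
    omega
  rw [← Finset.sum_range_add_sum_Ico _ hk, add_mul, Finset.sum_mul (Finset.Ico _ _),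
    Finset.sum_eq_zero h2, Finset.sum_range_succ _ (k + 2), Finset.sum_range_succ _ (k + 1),
    add_zero, add_mul, add_mul, Finset.sum_mul, Finset.sum_congr rfl h1, edgeBump]
  ring

/-- The difference of bumps at `M` and at the top frequency `ξ` is a small atom. -/
lemma isScaleAtom_bump_sub {M ξ k r : ℕ} (h : M / 2 ^ (k + 3) = ξ / 2 ^ (k + 3)) :
    IsScaleAtom (k + 1 + r) r
      (fun n => bump (k + 1 + r) ((M : ℤ) - n) - bump (k + 1 + r) ((ξ : ℤ) - n)) where
  smooth := (((smoothAt_bump _).reflect M).sub ((smoothAt_bump _).reflect ξ)).mono (by norm_num)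
  small n := by
    refine (abs_bump_sub_le _ _ _).trans ?_
    have hlt : |(M : ℝ) - ξ| ≤ 2 ^ (k + 3) := by
      have h1 := Nat.div_add_mod M (2 ^ (k + 3))
      have h2 := Nat.div_add_mod ξ (2 ^ (k + 3))
      have h3 := Nat.mod_lt M (by positivity : 0 < 2 ^ (k + 3))
      have h4 := Nat.mod_lt ξ (by positivity : 0 < 2 ^ (k + 3))
      rw [h] at h1
      have h5 : (M : ℝ) ≤ ξ + 2 ^ (k + 3) := by exact_mod_cast (by omega : M ≤ ξ + 2 ^ (k + 3))
      have h6 : (ξ : ℝ) ≤ M + 2 ^ (k + 3) := by exact_mod_cast (by omega : ξ ≤ M + 2 ^ (k + 3))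
      rw [abs_le]; constructor <;> linarith
    have e : (((M : ℤ) - n : ℤ) : ℝ) - (((ξ : ℤ) - n : ℤ) : ℝ) = (M : ℝ) - ξ := by
      push_cast; ring
    rw [e, div_le_div_iff₀ (by positivity) (by positivity)]
    calc 2 * |(M : ℝ) - ξ| * 2 ^ r ≤ 2 * 2 ^ (k + 3) * 2 ^ r := by gcongr
      _ = 8 * 2 ^ (k + 1 + r) := by ring
      _ ≤ 16384 * 2 ^ (k + 1 + r) := by gcongr; norm_num
  window := by
    have h1 := Nat.div_add_mod M (2 ^ (k + 3))
    have h2 := Nat.div_add_mod ξ (2 ^ (k + 3))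
    have h3 := Nat.mod_lt M (by positivity : 0 < 2 ^ (k + 3))
    have h4 := Nat.mod_lt ξ (by positivity : 0 < 2 ^ (k + 3))
    rw [h] at h1
    have hA : M ≤ ξ + 2 ^ (k + 3) := by omega
    have hB : ξ ≤ M + 2 ^ (k + 3) := by omega
    have hA' : (M : ℤ) ≤ ξ + 2 ^ (k + 3) := by exact_mod_cast hA
    have hB' : (ξ : ℤ) ≤ M + 2 ^ (k + 3) := by exact_mod_cast hB
    have hpow : (2 : ℤ) ^ (k + 3) ≤ 4 * 2 ^ (k + 1 + r) := by
      rw [show (4 : ℤ) * 2 ^ (k + 1 + r) = 2 ^ (k + 3 + r) by ring]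
      exact pow_le_pow_right₀ (by norm_num) (by omega)
    have e1 : (2 : ℤ) ^ (k + 1 + r + 2) = 4 * 2 ^ (k + 1 + r) := by ring
    have e2 : (2 : ℤ) ^ (k + 1 + r + 5) = 32 * 2 ^ (k + 1 + r) := by ring
    have hpos : (0 : ℤ) < 2 ^ (k + 1 + r) := by positivity
    refine ⟨ξ - 8 * 2 ^ (k + 1 + r), fun n hn => ?_⟩
    have : bump (k + 1 + r) ((M : ℤ) - n) ≠ 0 ∨ bump (k + 1 + r) ((ξ : ℤ) - n) ≠ 0 := by
      by_contra! hc
      exact hn (by rw [hc.1, hc.2, sub_zero])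
    rcases this with h' | h' <;> have h'' := lt_of_bump_ne_zero h' <;> omega

/-- The part of the multiplier of `M` with scales in `[i0, i1]`. -/
noncomputable def digitSum (M i0 i1 : ℕ) (n : ℤ) : ℝ := ∑ i ∈ Finset.Icc i0 i1, digitBump M i n

lemma digitSum_decomp {M ξ i0 i1 b : ℕ} (h01 : i0 ≤ i1) (hb : i1 ≤ b)
    (h : M / 2 ^ (i0 + 3) = ξ / 2 ^ (i0 + 3)) (n : ℤ) :
    digitSum M i0 i1 n = digitBump M i0 n
      + (∑ r ∈ Finset.range b, (if i0 + 1 + r ≤ i1 ∧ ξ / 2 ^ (i0 + 1 + r + 2) % 2 = 1 then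
          bump (i0 + 1 + r) ((M : ℤ) - n) - bump (i0 + 1 + r) ((ξ : ℤ) - n) else 0)
      + (((∑ i ∈ Finset.range (b + 3), digitBump ξ i n) * plateau i1 ((ξ : ℤ) - n)
          - edgeBump ξ i1 n)
        - ((∑ i ∈ Finset.range (b + 3), digitBump ξ i n) * plateau i0 ((ξ : ℤ) - n)
          - edgeBump ξ i0 n))) := by
  rw [← sum_digitBump_eq_plateau (by omega), ← sum_digitBump_eq_plateau (by omega)]
  have hreindex : ∀ f : ℕ → ℝ, ∑ r ∈ Finset.range b, (if i0 + 1 + r ≤ i1 then f (i0 + 1 + r)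
      else 0) = ∑ i ∈ Finset.Ico (i0 + 1) (i1 + 1), f i := fun f => by
    rw [← Finset.sum_filter, Finset.sum_Ico_eq_sum_range]
    refine Finset.sum_congr ?_ fun _ _ => rfl
    ext r; simp only [Finset.mem_filter, Finset.mem_range]; omega
  have h1 : digitSum M i0 i1 n = digitBump M i0 n
      + ∑ i ∈ Finset.Ico (i0 + 1) (i1 + 1), digitBump M i n := by
    have hI : Finset.Icc i0 i1 = Finset.Ico i0 (i1 + 1) := by
      ext i; simp only [Finset.mem_Icc, Finset.mem_Ico]; omega
    rw [digitSum, hI, Finset.sum_eq_sum_Ico_succ_bot (by omega)]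
  have h2 : ∑ i ∈ Finset.range (i1 + 1), digitBump ξ i n
      - ∑ i ∈ Finset.range (i0 + 1), digitBump ξ i n
      = ∑ i ∈ Finset.Ico (i0 + 1) (i1 + 1), digitBump ξ i n :=
    (Finset.sum_Ico_eq_sub _ (by omega)).symm
  simp_rw [ite_and]
  rw [h1, h2, hreindex (fun i => if ξ / 2 ^ (i + 2) % 2 = 1 then
    bump i ((M : ℤ) - n) - bump i ((ξ : ℤ) - n) else 0), ← Finset.sum_add_distrib]
  congr 1
  refine Finset.sum_congr rfl fun i hi => ?_
  rw [digitBump_eq_of_div_eq h (by have := (Finset.mem_Ico.1 hi).1; omega), digitBump]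
  split_ifs <;> ring

lemma sum_geom_three_quarters_le (b : ℕ) : ∑ r ∈ Finset.range b, ((3 : ℝ) / 4) ^ r ≤ 4 := by
  rw [geom_sum_eq (by norm_num)]
  have : (0 : ℝ) ≤ (3 / 4) ^ b := by positivity
  rw [div_le_iff_of_neg (by norm_num)]
  linarith

/-- The tree estimate: all multipliers share the top frequency `ξ`. -/
lemma l2norm_osc_tree_le {b ν : ℕ} {E F : Finset ℕ} {M i0 i1 : ℕ → ℕ} {ξ : ℕ} (hFE : F ⊆ E)
    (h01 : ∀ j ∈ F, i0 j ≤ i1 j) (hb : ∀ j ∈ F, i1 j ≤ b) (hF : ∀ j ∈ F, 2 * j ≤ 2 ^ b)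
    (hL : ∀ j ∈ F, IsLight b E M ν j (i1 j))
    (hξ : ∀ j ∈ F, M j / 2 ^ (i0 j + 3) = ξ / 2 ^ (i0 j + 3))
    {g : ℕ → ℂ} (hg : ∀ j, ‖g j‖ ≤ 1) (S : Finset ℤ) :
    l2norm S (osc b F g (fun j => digitSum (M j) (i0 j) (i1 j)))
      ≤ 2 ^ 24 * √(2 ^ b * F.card / 2 ^ ν) := by
  set X := √(2 ^ b * F.card / 2 ^ ν) with hX
  have hX0 : 0 ≤ X := Real.sqrt_nonneg _
  have main : ∀ (r : ℕ) (sc : ℕ → ℕ) (m : ℕ → ℤ → ℝ), (∀ j ∈ F, i0 j ≤ sc j) →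
      (∀ j ∈ F, sc j ≤ i1 j) → (∀ j ∈ F, IsScaleAtom (sc j) r (m j)) →
      l2norm S (osc b F g m) ≤ 2 ^ 20 * X * (3 / 4) ^ r := by
    intro r sc m h0 h1 hm
    refine l2norm_osc_atom_le hFE (fun j hj => (h1 j hj).trans (hb j hj)) hF
      (fun j hj => (hL j hj).mono (h1 j hj)) hm (fun j hj j' hj' hs _ => ?_) hg S
    rw [div_two_pow_eq_of_le (hξ j hj) (by have := h0 j hj; omega),
      div_two_pow_eq_of_le (hξ j' hj') (by have := h0 j' hj'; omega)]
  have main0 : ∀ (sc : ℕ → ℕ) (m : ℕ → ℤ → ℝ), (∀ j ∈ F, i0 j ≤ sc j) →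
      (∀ j ∈ F, sc j ≤ i1 j) → (∀ j ∈ F, IsScaleAtom (sc j) 0 (m j)) →
      l2norm S (osc b F g m) ≤ 2 ^ 20 * X := fun sc m h0 h1 hm => by
    simpa using main 0 sc m h0 h1 hm
  set p : ℤ → ℝ := fun n => ∑ i ∈ Finset.range (b + 3), digitBump ξ i n with hp
  have hp1 : ∀ n, |p n| ≤ 1 := fun n => by
    rw [abs_of_nonneg (Finset.sum_nonneg fun i _ => digitBump_nonneg _ _ _)]
    exact sum_digitBump_le_one _ _ _
  set d : ℕ → ℕ → ℤ → ℝ := fun r j n =>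
    if i0 j + 1 + r ≤ i1 j ∧ ξ / 2 ^ (i0 j + 1 + r + 2) % 2 = 1 then
      bump (i0 j + 1 + r) ((M j : ℤ) - n) - bump (i0 j + 1 + r) ((ξ : ℤ) - n) else 0 with hd
  have hdr : ∀ r, l2norm S (osc b F g (d r)) ≤ 2 ^ 20 * X * (3 / 4) ^ r := fun r => by
    refine main r (fun j => if i0 j + 1 + r ≤ i1 j then i0 j + 1 + r else i0 j) (d r)
      (fun j hj => ?_) (fun j hj => ?_) fun j hj => ?_
    · split_ifs <;> omega
    · have := h01 j hj
      split_ifs <;> omega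
    · by_cases hc : i0 j + 1 + r ≤ i1 j ∧ ξ / 2 ^ (i0 j + 1 + r + 2) % 2 = 1
      · have e : d r j = fun n => bump (i0 j + 1 + r) ((M j : ℤ) - n)
            - bump (i0 j + 1 + r) ((ξ : ℤ) - n) := by
          ext n; simp only [hd]; rw [if_pos hc]
        rw [e, if_pos hc.1]
        exact isScaleAtom_bump_sub (hξ j hj)
      · have e : d r j = fun n => 0 := by
          ext n; simp only [hd]; rw [if_neg hc]
        rw [e]
        exact isScaleAtom_zero _ _
  have hplat : ∀ k : ℕ → ℕ, (∀ j ∈ F, i0 j ≤ k j) → (∀ j ∈ F, k j ≤ i1 j) →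
      l2norm S (osc b F g (fun j n => p n * plateau (k j) ((ξ : ℤ) - n) - edgeBump ξ (k j) n))
        ≤ 2 ^ 21 * X := by
    intro k h0 h1
    have e : osc b F g (fun j n => p n * plateau (k j) ((ξ : ℤ) - n) - edgeBump ξ (k j) n)
        = fun n => osc b F g (fun j n => p n * plateau (k j) ((ξ : ℤ) - n)) n
          - osc b F g (fun j => edgeBump ξ (k j)) n := by
      ext n; rw [← osc_sub]
    rw [e]
    refine (l2norm_sub_le _ _ _).trans ?_
    have h2 : l2norm S (osc b F g (fun j n => p n * plateau (k j) ((ξ : ℤ) - n)))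
        ≤ l2norm S (osc b F g (fun j n => plateau (k j) ((ξ : ℤ) - n))) := by
      refine l2norm_mono S fun n => ?_
      rw [osc_const_mul b F g p (fun j n => plateau (k j) ((ξ : ℤ) - n)), norm_mul,
        Complex.norm_real, Real.norm_eq_abs]
      exact mul_le_of_le_one_left (norm_nonneg _) (hp1 n)
    have h3 := main0 k _ h0 h1 fun j _ => isScaleAtom_plateau ξ (k j)
    have h4 := main0 k _ h0 h1 fun j _ => isScaleAtom_edgeBump ξ (k j)
    linarith
  have e : osc b F g (fun j => digitSum (M j) (i0 j) (i1 j)) = fun n =>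
      osc b F g (fun j => digitBump (M j) (i0 j)) n + (∑ r ∈ Finset.range b, osc b F g (d r) n
      + (osc b F g (fun j n => p n * plateau (i1 j) ((ξ : ℤ) - n) - edgeBump ξ (i1 j) n) n
        - osc b F g (fun j n => p n * plateau (i0 j) ((ξ : ℤ) - n) - edgeBump ξ (i0 j) n) n)) := by
    ext n
    rw [← osc_sub, ← osc_sum, ← osc_add, ← osc_add]
    exact osc_congr (fun j hj n => digitSum_decomp (h01 j hj) (hb j hj) (hξ j hj) n) n
  rw [e]
  have t0 := main0 i0 _ (fun _ _ => le_rfl) h01 fun j _ => isScaleAtom_digitBump (M j) (i0 j)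
  have t1 : ∑ r ∈ Finset.range b, l2norm S (osc b F g (d r)) ≤ 2 ^ 22 * X := by
    calc ∑ r ∈ Finset.range b, l2norm S (osc b F g (d r))
        ≤ ∑ r ∈ Finset.range b, 2 ^ 20 * X * (3 / 4) ^ r := Finset.sum_le_sum fun r _ => hdr r
      _ ≤ 2 ^ 20 * X * 4 := by
          rw [← Finset.mul_sum]
          gcongr
          exact sum_geom_three_quarters_le b
      _ = 2 ^ 22 * X := by ring
  have t2 := hplat i1 h01 fun _ _ => le_rfl
  have t3 := hplat i0 (fun _ _ => le_rfl) h01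
  have s1 := l2norm_add_le S (osc b F g (fun j => digitBump (M j) (i0 j))) (fun n =>
    ∑ r ∈ Finset.range b, osc b F g (d r) n
      + (osc b F g (fun j n => p n * plateau (i1 j) ((ξ : ℤ) - n) - edgeBump ξ (i1 j) n) n
        - osc b F g (fun j n => p n * plateau (i0 j) ((ξ : ℤ) - n) - edgeBump ξ (i0 j) n) n))
  have s2 := l2norm_add_le S (fun n => ∑ r ∈ Finset.range b, osc b F g (d r) n) (fun n =>
    osc b F g (fun j n => p n * plateau (i1 j) ((ξ : ℤ) - n) - edgeBump ξ (i1 j) n) n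
      - osc b F g (fun j n => p n * plateau (i0 j) ((ξ : ℤ) - n) - edgeBump ξ (i0 j) n) n)
  have s3 := l2norm_sub_le S
    (osc b F g (fun j n => p n * plateau (i1 j) ((ξ : ℤ) - n) - edgeBump ξ (i1 j) n))
    (osc b F g (fun j n => p n * plateau (i0 j) ((ξ : ℤ) - n) - edgeBump ξ (i0 j) n))
  have s4 := l2norm_sum_le (Finset.range b) S fun r => osc b F g (d r)
  linarith

lemma div_eq_of_digitBump_ne_zero {M i : ℕ} {n : ℤ} (h : digitBump M i n ≠ 0) :
    n / 2 ^ (i + 3) = ((M / 2 ^ (i + 3) : ℕ) : ℤ) := by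
  obtain ⟨h1, h2, h3⟩ := digitBump_ne_zero h
  have e1 : (2 : ℕ) ^ (i + 2) = 4 * 2 ^ i := by ring
  have e2 : (2 : ℕ) ^ (i + 3) = 8 * 2 ^ i := by ring
  have e3 : (2 : ℤ) ^ (i + 2) = 4 * 2 ^ i := by ring
  have e4 : (2 : ℤ) ^ (i + 3) = 8 * 2 ^ i := by ring
  have hM := Nat.div_add_mod M (2 ^ (i + 2))
  have hM' := Nat.mod_lt M (by positivity : 0 < 2 ^ (i + 2))
  have hq := Nat.div_add_mod (M / 2 ^ (i + 2)) 2
  have hdd : M / 2 ^ (i + 3) = M / 2 ^ (i + 2) / 2 := by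
    rw [Nat.div_div_eq_div_mul, ← pow_succ]
  rw [hdd]
  set q := M / 2 ^ (i + 2)
  set t := q / 2
  set x := M % 2 ^ (i + 2)
  rw [h1] at hq
  rw [← hq] at hM
  have hMz : (M : ℤ) = 2 ^ (i + 3) * t + 2 ^ (i + 2) + x := by
    have : M = 2 ^ (i + 3) * t + 2 ^ (i + 2) + x := by rw [← hM]; ring
    exact_mod_cast this
  have hx : (x : ℤ) < 2 ^ (i + 2) := by exact_mod_cast hM'
  have hx0 : (0 : ℤ) ≤ x := Int.natCast_nonneg _
  have hp : (0 : ℤ) < 2 ^ i := by positivity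
  rw [Int.ediv_eq_iff_of_pos (by positivity)]
  constructor <;> nlinarith

lemma div_eq_div_of_digitBump_mul_ne_zero {M M' i i' : ℕ} {n : ℤ} (hi : i' ≤ i)
    (h : digitBump M i n ≠ 0) (h' : digitBump M' i' n ≠ 0) :
    M / 2 ^ (i + 3) = M' / 2 ^ (i + 3) := by
  have h1 := div_eq_of_digitBump_ne_zero h
  have h2 := div_eq_of_digitBump_ne_zero h'
  obtain ⟨d, rfl⟩ := Nat.exists_eq_add_of_le hi
  have e : i' + d + 3 = (i' + 3) + d := by omega
  have h3 : n / 2 ^ (i' + d + 3) = ((M' / 2 ^ (i' + d + 3) : ℕ) : ℤ) := by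
    rw [e, pow_add (2 : ℤ) (i' + 3) d, pow_add (2 : ℕ) (i' + 3) d,
      ← Int.ediv_ediv_of_nonneg (by positivity), h2, ← Nat.div_div_eq_div_mul]
    push_cast
    rfl
  rw [h1] at h3
  exact_mod_cast h3

lemma sum_Icc_inv_two_pow_le (a c : ℕ) : ∑ i ∈ Finset.Icc a c, (1 : ℝ) / 2 ^ i ≤ 2 / 2 ^ a := by
  have h : ∀ n, ∑ r ∈ Finset.range n, (1 : ℝ) / 2 ^ (a + r) ≤ 2 / 2 ^ a := fun n => by
    have : ∑ r ∈ Finset.range n, (1 : ℝ) / 2 ^ (a + r)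
        = (1 / 2 ^ a) * ∑ r ∈ Finset.range n, ((1 : ℝ) / 2) ^ r := by
      rw [Finset.mul_sum]
      refine Finset.sum_congr rfl fun r _ => ?_
      rw [pow_add, one_div_pow]; field_simp
    rw [this, geom_sum_eq (by norm_num), div_eq_mul_one_div 2, mul_comm 2]
    gcongr
    rw [div_le_iff_of_neg (by norm_num)]
    have : (0 : ℝ) ≤ (1 / 2) ^ n := by positivity
    linarith
  have hI : Finset.Icc a c = Finset.Ico a (c + 1) := by
    ext i; simp only [Finset.mem_Icc, Finset.mem_Ico]; omega
  rw [hI, Finset.sum_Ico_eq_sum_range]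
  exact h _

lemma smoothAt_digitSum {M a c i : ℕ} (hi : i ≤ a) : SmoothAt i 16 (digitSum M a c) where
  bound n := by
    rw [digitSum, abs_of_nonneg (Finset.sum_nonneg fun i _ => digitBump_nonneg _ _ _)]
    exact (sum_digitBump_le_one _ _ _).trans (by norm_num)
  diff n := by
    have hle : (2 : ℝ) / 2 ^ a ≤ 2 / 2 ^ i := by gcongr; norm_num
    rw [digitSum, digitSum, ← Finset.sum_sub_distrib]
    calc _ ≤ ∑ k ∈ Finset.Icc a c, |digitBump M k (n + 1) - digitBump M k n| :=
          Finset.abs_sum_le_sum_abs _ _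
      _ ≤ ∑ k ∈ Finset.Icc a c, 8 * (1 / 2 ^ k) := Finset.sum_le_sum fun k _ => by
          rw [mul_one_div]; exact (smoothAt_digitBump M k).diff n
      _ ≤ 8 * (2 / 2 ^ a) := by
          rw [← Finset.mul_sum]; gcongr; exact sum_Icc_inv_two_pow_le a c
      _ ≤ 8 * (2 / 2 ^ i) := by gcongr
      _ = 16 / 2 ^ i := by ring
  second T := by
    have hle : (2 : ℝ) / 2 ^ a ≤ 2 / 2 ^ i := by gcongr; norm_num
    calc ∑ n ∈ T, |digitSum M a c (n + 2) - 2 * digitSum M a c (n + 1) + digitSum M a c n|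
        ≤ ∑ n ∈ T, ∑ k ∈ Finset.Icc a c,
          |digitBump M k (n + 2) - 2 * digitBump M k (n + 1) + digitBump M k n| := by
          refine Finset.sum_le_sum fun n _ => ?_
          rw [digitSum, digitSum, digitSum, Finset.mul_sum, ← Finset.sum_sub_distrib,
            ← Finset.sum_add_distrib]
          exact Finset.abs_sum_le_sum_abs _ _
      _ ≤ ∑ k ∈ Finset.Icc a c, 8 * (1 / 2 ^ k) := by
          rw [Finset.sum_comm]
          refine Finset.sum_le_sum fun k _ => ?_
          rw [mul_one_div]; exact (smoothAt_digitBump M k).second T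
      _ ≤ 8 * (2 / 2 ^ a) := by
          rw [← Finset.mul_sum]; gcongr; exact sum_Icc_inv_two_pow_le a c
      _ ≤ 8 * (2 / 2 ^ i) := by gcongr
      _ = 16 / 2 ^ i := by ring

/-- Decay of the correlation of a digit bump with coarser multipliers at a separated point. -/
lemma norm_kern_digitSum_le {b M M' a c i : ℕ} (ha : i ≤ a) {S : Finset ℤ}
    (hS : ∀ n, digitBump M' i n ≠ 0 → n ∈ S) {j j' : ℕ} {X : ℝ} (hX : 0 < X)
    (hsep : ∀ k, a ≤ k → k ≤ c → M / 2 ^ (k + 3) = M' / 2 ^ (k + 3) → X ≤ |(j : ℝ) - j'|)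
    (hj : 2 * j ≤ 2 ^ b) (hj' : 2 * j' ≤ 2 ^ b) :
    ‖kern b S (digitSum M a c) (digitBump M' i) j j'‖
      ≤ if X ≤ |(j : ℝ) - j'| then 560 * (2 ^ b) ^ 2 / ((j : ℝ) - j') ^ 2 * (1 / 2 ^ i) else 0 := by
  split_ifs with h
  · obtain ⟨w, hw⟩ := (isScaleAtom_digitBump M' i).window
    have hk := norm_sum_mul_unitExp_mul_le (f := fun n => digitSum M a c n * digitBump M' i n)
      (fun n hn => hS n (right_ne_zero_of_mul hn))
      ((smoothAt_digitSum ha).mul (smoothAt_digitBump M' i) w hw)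
      (abs_sub_div_le_half hj hj')
    have hk' : ‖kern b S (digitSum M a c) (digitBump M' i) j j'‖
      * (16 * (((j : ℝ) - j') / 2 ^ b) ^ 2) ≤ 70 * (16 * 8) / 2 ^ i := hk
    have h0 : 0 < ((j : ℝ) - j') ^ 2 := by
      rw [← sq_abs]; have := hX.trans_le h; positivity
    rw [div_mul_eq_mul_div, le_div_iff₀ h0]
    rw [div_pow] at hk'
    have e : ‖kern b S (digitSum M a c) (digitBump M' i) j j'‖ * ((j : ℝ) - j') ^ 2
        = ‖kern b S (digitSum M a c) (digitBump M' i) j j'‖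
          * (16 * (((j : ℝ) - j') ^ 2 / (2 ^ b) ^ 2)) * ((2 ^ b) ^ 2 / 16) := by
      field_simp
    rw [e]
    refine (mul_le_mul_of_nonneg_right hk' (by positivity)).trans (le_of_eq ?_)
    ring
  · have hz : ∀ n, digitSum M a c n * digitBump M' i n = 0 := by
      intro n
      by_contra hn
      obtain ⟨k, hk, hkn⟩ := Finset.exists_ne_zero_of_sum_ne_zero (left_ne_zero_of_mul hn)
      obtain ⟨h1, h2⟩ := Finset.mem_Icc.1 hk
      exact h (hsep k h1 h2 (div_eq_div_of_digitBump_mul_ne_zero (ha.trans h1) hkn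
        (right_ne_zero_of_mul hn)))
    simp [kern, hz]

lemma digitSum_mul_digitSum (M M' a a' c c' : ℕ) (n : ℤ) :
    digitSum M a c n * digitSum M' a' c' n
      = (∑ i ∈ Finset.Icc a' c', digitSum M (max a i) c n * digitBump M' i n)
        + ∑ i ∈ Finset.Icc a c, digitBump M i n * digitSum M' (max a' (i + 1)) c' n := by
  have h1 : ∑ i ∈ Finset.Icc a' c', digitSum M (max a i) c n * digitBump M' i n
      = ∑ i ∈ Finset.Icc a c, ∑ i' ∈ Finset.Icc a' c',
        if i' ≤ i then digitBump M i n * digitBump M' i' n else 0 := by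
    rw [Finset.sum_comm]
    refine Finset.sum_congr rfl fun i' _ => ?_
    rw [digitSum, Finset.sum_mul, ← Finset.sum_filter]
    refine Finset.sum_congr ?_ fun _ _ => rfl
    ext i; simp only [Finset.mem_filter, Finset.mem_Icc, max_le_iff]; tauto
  have h2 : ∑ i ∈ Finset.Icc a c, digitBump M i n * digitSum M' (max a' (i + 1)) c' n
      = ∑ i ∈ Finset.Icc a c, ∑ i' ∈ Finset.Icc a' c',
        if i' ≤ i then 0 else digitBump M i n * digitBump M' i' n := by
    refine Finset.sum_congr rfl fun i _ => ?_
    rw [digitSum, Finset.mul_sum]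
    simp_rw [← ite_not (p := _ ≤ i)]
    rw [← Finset.sum_filter]
    refine Finset.sum_congr ?_ fun _ _ => rfl
    ext i'; simp only [Finset.mem_filter, Finset.mem_Icc, max_le_iff, not_le, Nat.lt_iff_add_one_le]
    tauto
  rw [h1, h2, ← Finset.sum_add_distrib, digitSum, digitSum, Finset.sum_mul_sum]
  refine Finset.sum_congr rfl fun i _ => ?_
  rw [← Finset.sum_add_distrib]
  refine Finset.sum_congr rfl fun i' _ => ?_
  split_ifs <;> simp

lemma sum_inv_sq_sub_le {X : ℝ} (hX : 0 < X) (F : Finset ℕ) (q : ℕ) :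
    ∑ j ∈ F, (if X ≤ |(j : ℝ) - q| then 1 / ((j : ℝ) - q) ^ 2 else 0) ≤ 16 / X := by
  have hR : 1 ≤ max 1 X := le_max_left _ _
  calc _ ≤ ∑ j ∈ F, 4 * (1 / (|(j : ℝ) - q| + max 1 X) ^ 2) := by
        refine Finset.sum_le_sum fun j _ => ?_
        split_ifs with h
        · have h0 : 0 < |(j : ℝ) - q| := hX.trans_le h
          have h1 : 1 ≤ |(j : ℝ) - q| := by
            have hz : |(j : ℝ) - q| = ((|(j : ℤ) - q| : ℤ) : ℝ) := by push_cast; rfl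
            rw [hz] at h0 ⊢
            exact_mod_cast (by exact_mod_cast h0 : (0 : ℤ) < |(j : ℤ) - q|)
          have h2 : max 1 X ≤ |(j : ℝ) - q| := max_le h1 h
          rw [← sq_abs, mul_one_div, div_le_div_iff₀ (by positivity) (by positivity)]
          nlinarith
        · positivity
    _ ≤ 4 * (4 / max 1 X) := by
        rw [← Finset.mul_sum]; gcongr; exact sum_inv_abs_sub_add_sq_le hR F q
    _ ≤ 4 * (4 / X) := by gcongr; exact le_max_right _ _
    _ = 16 / X := by ring

lemma l2norm_sq (S : Finset ℤ) (G : ℤ → ℂ) : l2norm S G ^ 2 = ∑ n ∈ S, ‖G n‖ ^ 2 :=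
  Real.sq_sqrt (by positivity)

lemma sum_norm_sq_osc_le_diag_add {ι : Type*} [DecidableEq ι] (R : ℕ → ι) (b : ℕ) (F : Finset ℕ)
    {g : ℕ → ℂ} (hg : ∀ j, ‖g j‖ ≤ 1) (m : ℕ → ℤ → ℝ) (S : Finset ℤ) :
    ∑ n ∈ S, ‖osc b F g m n‖ ^ 2
      ≤ (∑ ρ ∈ F.image R, ∑ n ∈ S, ‖osc b (F.filter fun j => R j = ρ) g m n‖ ^ 2)
        + ∑ j' ∈ F, ∑ j ∈ F with R j ≠ R j', ‖kern b S (m j) (m j') j j'‖ := by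
  set c : ℕ → ℕ → ℂ := fun j j' => g j * star (g j') * kern b S (m j) (m j') j j' with hc
  have hsplit : ∑ n ∈ S, osc b F g m n * star (osc b F g m n)
      = (∑ ρ ∈ F.image R, ∑ n ∈ S, osc b (F.filter fun j => R j = ρ) g m n
          * star (osc b (F.filter fun j => R j = ρ) g m n))
        + ∑ j' ∈ F, ∑ j ∈ F with R j ≠ R j', c j j' := by
    simp_rw [sum_osc_mul_star_osc]
    have e1 : ∑ ρ ∈ F.image R, ∑ j ∈ F with R j = ρ, ∑ j' ∈ F with R j' = ρ, c j j'
        = ∑ j' ∈ F, ∑ j ∈ F with R j = R j', c j j' := by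
      rw [← Finset.sum_fiberwise_of_maps_to (t := F.image R) (g := R)
        (fun j hj => Finset.mem_image_of_mem R hj)]
      refine Finset.sum_congr rfl fun ρ _ => ?_
      rw [Finset.sum_comm]
      refine Finset.sum_congr rfl fun j hj => ?_
      rw [(Finset.mem_filter.1 hj).2]
    rw [e1, ← Finset.sum_add_distrib, Finset.sum_comm]
    exact Finset.sum_congr rfl fun j' _ => (Finset.sum_filter_add_sum_filter_not _ _ _).symm
  rw [sum_norm_sq_osc_eq, hsplit]
  refine (norm_add_le _ _).trans (add_le_add ?_ ?_)
  · refine (norm_sum_le _ _).trans (Finset.sum_le_sum fun ρ _ => ?_)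
    rw [sum_norm_sq_osc_eq]
  · refine (norm_sum_le _ _).trans (Finset.sum_le_sum fun j' _ => ?_)
    refine (norm_sum_le _ _).trans (Finset.sum_le_sum fun j _ => ?_)
    rw [hc, norm_mul, norm_mul, norm_star]
    have hgg := mul_le_one₀ (hg j) (norm_nonneg _) (hg j')
    exact mul_le_of_le_one_left (norm_nonneg _) hgg

/-- The forest estimate: trees with separated tops. -/
lemma l2norm_osc_forest_le {ι : Type*} [DecidableEq ι] {b ν h : ℕ} {E F : Finset ℕ}
    {M i0 i1 : ℕ → ℕ} (R : ℕ → ι) (l ξ : ι → ℕ) (hFE : F ⊆ E)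
    (h01 : ∀ j ∈ F, i0 j ≤ i1 j) (hb : ∀ j ∈ F, i1 j ≤ b) (hF : ∀ j ∈ F, 2 * j ≤ 2 ^ b)
    (hL : ∀ j ∈ F, IsLight b E M ν j (i1 j))
    (hl : ∀ j ∈ F, l (R j) + (h + ν) ≤ i0 j)
    (hξ : ∀ j ∈ F, M j / 2 ^ (i0 j + 3) = ξ (R j) / 2 ^ (i0 j + 3))
    (hsep : ∀ j ∈ F, ∀ j' ∈ F, R j ≠ R j' → ∀ i i', i0 j ≤ i → i ≤ i1 j → i0 j' ≤ i' →
      i' ≤ i1 j' → i' ≤ i → M j / 2 ^ (i + 3) = M j' / 2 ^ (i + 3) →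
      (2 : ℝ) ^ (b - l (R j')) / 2 ^ h ≤ |(j : ℝ) - j'|)
    {g : ℕ → ℂ} (hg : ∀ j, ‖g j‖ ≤ 1) (S : Finset ℤ) :
    l2norm S (osc b F g (fun j => digitSum (M j) (i0 j) (i1 j)))
      ≤ 2 ^ 25 * √(2 ^ b * F.card / 2 ^ ν) := by
  set m : ℕ → ℤ → ℝ := fun j => digitSum (M j) (i0 j) (i1 j) with hm
  obtain ⟨S', hSS', hS'⟩ : ∃ S' : Finset ℤ, S ⊆ S' ∧
      ∀ j ∈ F, ∀ i ≤ b, ∀ n, digitBump (M j) i n ≠ 0 → n ∈ S' := by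
    have : ∀ i, ∃ S' : Finset ℤ, S ⊆ S' ∧ ∀ j ∈ F, ∀ n, digitBump (M j) i n ≠ 0 → n ∈ S' :=
      fun i => exists_support_finset (sc := fun _ => i) (r := 0)
        (fun j _ => isScaleAtom_digitBump (M j) i) S
    choose T hT1 hT2 using this
    refine ⟨(Finset.range (b + 1)).biUnion T, fun n hn =>
      Finset.mem_biUnion.2 ⟨0, by simp, hT1 0 hn⟩, fun j hj i hi n hn =>
      Finset.mem_biUnion.2 ⟨i, Finset.mem_range.2 (by omega), hT2 i j hj n hn⟩⟩
  have row : ∀ t, ∀ j' ∈ F, ∑ j ∈ F with R j ≠ R j', ∑ i ∈ Finset.Icc (i0 j') (i1 j'),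
      ‖kern b S' (digitSum (M j) (max (i0 j) (i + t)) (i1 j)) (digitBump (M j') i) j j'‖
        ≤ 17920 * (2 ^ b / 2 ^ ν) := by
    intro t j' hj'
    set X : ℝ := 2 ^ (b - l (R j')) / 2 ^ h with hX
    have hX0 : 0 < X := by positivity
    have hl' := hl j' hj'
    have h01' := h01 j' hj'
    have hb' := hb j' hj'
    calc _ ≤ ∑ j ∈ F with R j ≠ R j', ∑ i ∈ Finset.Icc (i0 j') (i1 j'),
          ((560 * (2 ^ b) ^ 2) * (if X ≤ |(j : ℝ) - j'| then 1 / ((j : ℝ) - j') ^ 2 else 0))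
            * (1 / 2 ^ i) := by
          refine Finset.sum_le_sum fun j hj => Finset.sum_le_sum fun i hi => ?_
          obtain ⟨hjF, hR⟩ := Finset.mem_filter.1 hj
          obtain ⟨hi0, hi1⟩ := Finset.mem_Icc.1 hi
          refine (norm_kern_digitSum_le (X := X) (by omega) (hS' j' hj' i (by omega)) hX0
            (fun k hk hk1 hM => ?_) (hF j hjF) (hF j' hj')).trans (le_of_eq ?_)
          · exact hsep j hjF j' hj' hR k i (by omega) hk1 hi0 hi1 (by omega) hM
          · split_ifs <;> ring
      _ = (560 * (2 ^ b) ^ 2) * ((∑ j ∈ F with R j ≠ R j',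
            if X ≤ |(j : ℝ) - j'| then 1 / ((j : ℝ) - j') ^ 2 else 0)
            * ∑ i ∈ Finset.Icc (i0 j') (i1 j'), (1 : ℝ) / 2 ^ i) := by
          rw [Finset.sum_mul_sum, Finset.mul_sum]
          refine Finset.sum_congr rfl fun j _ => ?_
          rw [Finset.mul_sum]
          exact Finset.sum_congr rfl fun i _ => by ring
      _ ≤ (560 * (2 ^ b) ^ 2) * (16 / X * (2 / 2 ^ (l (R j') + (h + ν)))) := by
          gcongr
          · exact sum_inv_sq_sub_le hX0 _ _
          · refine (sum_Icc_inv_two_pow_le _ _).trans ?_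
            gcongr
            norm_num
      _ = _ := by
          have hbl : (2 : ℝ) ^ b = 2 ^ (b - l (R j')) * 2 ^ l (R j') := by
            rw [← pow_add]; congr 1; omega
          rw [hX, hbl, pow_add, pow_add]
          field_simp
          norm_num
  have hcross : ∑ j' ∈ F, ∑ j ∈ F with R j ≠ R j', ‖kern b S' (m j) (m j') j j'‖
      ≤ 2 * (17920 * (2 ^ b * F.card / 2 ^ ν)) := by
    have hk : ∀ j j', ‖kern b S' (m j) (m j') j j'‖
        ≤ (∑ i ∈ Finset.Icc (i0 j') (i1 j'), ‖kern b S'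
            (digitSum (M j) (max (i0 j) (i + 0)) (i1 j)) (digitBump (M j') i) j j'‖)
          + ∑ i ∈ Finset.Icc (i0 j) (i1 j), ‖kern b S'
            (digitSum (M j') (max (i0 j') (i + 1)) (i1 j')) (digitBump (M j) i) j' j‖ := by
      intro j j'
      have : kern b S' (m j) (m j') j j'
          = (∑ i ∈ Finset.Icc (i0 j') (i1 j'), kern b S'
              (digitSum (M j) (max (i0 j) (i + 0)) (i1 j)) (digitBump (M j') i) j j')
            + ∑ i ∈ Finset.Icc (i0 j) (i1 j), kern b S' (digitBump (M j) i)
              (digitSum (M j') (max (i0 j') (i + 1)) (i1 j')) j j' := by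
        simp only [kern, hm]
        rw [Finset.sum_comm, Finset.sum_comm (s := Finset.Icc (i0 j) (i1 j)),
          ← Finset.sum_add_distrib]
        refine Finset.sum_congr rfl fun n _ => ?_
        rw [digitSum_mul_digitSum, ← Finset.sum_mul, ← Finset.sum_mul, ← add_mul]
        push_cast
        rfl
      rw [this]
      refine (norm_add_le _ _).trans (add_le_add (norm_sum_le _ _) ?_)
      refine (norm_sum_le _ _).trans (Finset.sum_le_sum fun i _ => ?_)
      rw [norm_kern_comm]
    have hsum : ∀ t, ∑ j' ∈ F, ∑ j ∈ F with R j ≠ R j', ∑ i ∈ Finset.Icc (i0 j') (i1 j'),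
        ‖kern b S' (digitSum (M j) (max (i0 j) (i + t)) (i1 j)) (digitBump (M j') i) j j'‖
          ≤ 17920 * (2 ^ b * F.card / 2 ^ ν) := fun t => by
      refine (Finset.sum_le_sum fun j' hj' => row t j' hj').trans (le_of_eq ?_)
      rw [Finset.sum_const, nsmul_eq_mul]; ring
    calc _ ≤ ∑ j' ∈ F, ∑ j ∈ F with R j ≠ R j',
          ((∑ i ∈ Finset.Icc (i0 j') (i1 j'), ‖kern b S'
            (digitSum (M j) (max (i0 j) (i + 0)) (i1 j)) (digitBump (M j') i) j j'‖)
          + ∑ i ∈ Finset.Icc (i0 j) (i1 j), ‖kern b S'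
            (digitSum (M j') (max (i0 j') (i + 1)) (i1 j')) (digitBump (M j) i) j' j‖) :=
          Finset.sum_le_sum fun j' _ => Finset.sum_le_sum fun j _ => hk j j'
      _ = (∑ j' ∈ F, ∑ j ∈ F with R j ≠ R j', ∑ i ∈ Finset.Icc (i0 j') (i1 j'), ‖kern b S'
            (digitSum (M j) (max (i0 j) (i + 0)) (i1 j)) (digitBump (M j') i) j j'‖)
          + ∑ j' ∈ F, ∑ j ∈ F with R j ≠ R j', ∑ i ∈ Finset.Icc (i0 j') (i1 j'), ‖kern b S'
            (digitSum (M j) (max (i0 j) (i + 1)) (i1 j)) (digitBump (M j') i) j j'‖ := by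
          simp_rw [Finset.sum_add_distrib]
          congr 1
          simp_rw [Finset.sum_filter]
          rw [Finset.sum_comm]
          simp_rw [ne_comm]
      _ ≤ _ := by linarith [hsum 0, hsum 1]
  have hdiag : ∑ ρ ∈ F.image R, ∑ n ∈ S', ‖osc b (F.filter fun j => R j = ρ) g m n‖ ^ 2
      ≤ 2 ^ 48 * (2 ^ b * F.card / 2 ^ ν) := by
    calc _ ≤ ∑ ρ ∈ F.image R,
          2 ^ 48 * ((2 : ℝ) ^ b * ((F.filter fun j => R j = ρ).card : ℝ) / 2 ^ ν) := by
          refine Finset.sum_le_sum fun ρ _ => ?_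
          have hsub : F.filter (fun j => R j = ρ) ⊆ F := Finset.filter_subset _ _
          have ht := l2norm_osc_tree_le (F := F.filter fun j => R j = ρ) (ξ := ξ ρ)
            (hsub.trans hFE) (fun j hj => h01 j (hsub hj)) (fun j hj => hb j (hsub hj))
            (fun j hj => hF j (hsub hj)) (fun j hj => hL j (hsub hj))
            (fun j hj => by rw [hξ j (hsub hj), (Finset.mem_filter.1 hj).2]) hg S'
          rw [← l2norm_sq]
          refine (pow_le_pow_left₀ (l2norm_nonneg _ _) ht 2).trans (le_of_eq ?_)
          rw [mul_pow, Real.sq_sqrt (by positivity)]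
          norm_num
      _ = 2 ^ 48 * ((2 : ℝ) ^ b *
          ((∑ ρ ∈ F.image R, (F.filter fun j => R j = ρ).card : ℕ) : ℝ) / 2 ^ ν) := by
          rw [← Finset.mul_sum, ← Finset.sum_div, ← Finset.mul_sum]; push_cast; rfl
      _ = _ := by
          rw [← Finset.card_eq_sum_card_fiberwise fun j hj => Finset.mem_image_of_mem R hj]
  have hall : l2norm S (osc b F g m) ^ 2 ≤ 2 ^ 50 * (2 ^ b * F.card / 2 ^ ν) := by
    have h1 : l2norm S (osc b F g m) ^ 2 ≤ ∑ n ∈ S', ‖osc b F g m n‖ ^ 2 := by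
      rw [l2norm_sq]
      exact Finset.sum_le_sum_of_subset_of_nonneg hSS' fun _ _ _ => by positivity
    have h2 := sum_norm_sq_osc_le_diag_add R b F hg m S'
    have h3 : (0 : ℝ) ≤ 2 ^ b * F.card / 2 ^ ν := by positivity
    linarith
  refine le_of_sq_le_sq (hall.trans (le_of_eq ?_)) (by positivity)
  rw [mul_pow, Real.sq_sqrt (by positivity)]
  norm_num

/-- The tile `(i, q, p)` of scale `i` over the point `j`: `q` is the index of the spatial block
of length `2 ^ (b - i)` and `p` the index of the frequency block of length `2 ^ (i + 3)`. -/
def tile (b : ℕ) (M : ℕ → ℕ) (j i : ℕ) : ℕ × ℕ × ℕ := (i, j / 2 ^ (b - i), M j / 2 ^ (i + 3))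

/-- The tile order: `P ≤ P'` if the spatial block of `P` lies in that of `P'` and the frequency
block of `P` contains that of `P'`. -/
def TileLE (P P' : ℕ × ℕ × ℕ) : Prop :=
  P'.1 ≤ P.1 ∧ P.2.1 / 2 ^ (P.1 - P'.1) = P'.2.1 ∧ P'.2.2 / 2 ^ (P.1 - P'.1) = P.2.2

instance (P P' : ℕ × ℕ × ℕ) : Decidable (TileLE P P') := by unfold TileLE; infer_instance

lemma TileLE.refl (P : ℕ × ℕ × ℕ) : TileLE P P := by simp [TileLE]

lemma TileLE.trans {P P' P'' : ℕ × ℕ × ℕ} (h : TileLE P P') (h' : TileLE P' P'') :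
    TileLE P P'' := by
  obtain ⟨h1, h2, h3⟩ := h
  obtain ⟨h1', h2', h3'⟩ := h'
  have e : P.1 - P''.1 = (P.1 - P'.1) + (P'.1 - P''.1) := by omega
  refine ⟨h1'.trans h1, ?_, ?_⟩
  · rw [e, pow_add, ← Nat.div_div_eq_div_mul, h2, h2']
  · rw [e, add_comm, pow_add, ← Nat.div_div_eq_div_mul, h3', h3]

lemma TileLE.eq_of_fst_eq {P P' : ℕ × ℕ × ℕ} (h : TileLE P P') (he : P.1 = P'.1) : P' = P := by
  obtain ⟨-, h2, h3⟩ := h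
  rw [he, Nat.sub_self, pow_zero, Nat.div_one] at h2 h3
  exact Prod.ext he.symm (Prod.ext h2.symm h3)

lemma tileLE_tile {b : ℕ} {M : ℕ → ℕ} {j i i' : ℕ} (h : i' ≤ i) (hb : i ≤ b) :
    TileLE (tile b M j i) (tile b M j i') := by
  refine ⟨h, ?_, ?_⟩
  · simp only [tile]
    rw [Nat.div_div_eq_div_mul, ← pow_add]; congr 2; omega
  · simp only [tile]
    rw [Nat.div_div_eq_div_mul, ← pow_add]; congr 2; omega

/-- The spatial block of the tile `P` contains `x`. -/
def InBlock (b x : ℕ) (P : ℕ × ℕ × ℕ) : Prop := x / 2 ^ (b - P.1) = P.2.1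

instance (b x : ℕ) (P : ℕ × ℕ × ℕ) : Decidable (InBlock b x P) := by
  unfold InBlock; infer_instance

lemma InBlock.of_tileLE {b x : ℕ} {P P' : ℕ × ℕ × ℕ} (h : InBlock b x P) (hP : TileLE P P')
    (hb : P.1 ≤ b) : InBlock b x P' := by
  obtain ⟨h1, h2, -⟩ := hP
  unfold InBlock at *
  rw [← h2, ← h, Nat.div_div_eq_div_mul, ← pow_add]
  congr 2; omega

lemma inBlock_tile (b : ℕ) (M : ℕ → ℕ) (j i : ℕ) : InBlock b j (tile b M j i) := rfl

/-- Tiles over a common point with a common upper bound are comparable. -/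
lemma tileLE_or_tileLE {b x : ℕ} {R R' Q : ℕ × ℕ × ℕ} (hb : R.1 ≤ b) (hb' : R'.1 ≤ b)
    (hx : InBlock b x R) (hx' : InBlock b x R') (hQ : TileLE R Q) (hQ' : TileLE R' Q) :
    TileLE R R' ∨ TileLE R' R := by
  have key : ∀ R R' : ℕ × ℕ × ℕ, R.1 ≤ b → InBlock b x R → InBlock b x R' → TileLE R Q →
      TileLE R' Q → R'.1 ≤ R.1 → TileLE R R' := by
    intro R R' hb hx hx' hQ hQ' hl
    refine ⟨hl, ?_, ?_⟩
    · unfold InBlock at hx hx'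
      rw [← hx, ← hx', Nat.div_div_eq_div_mul, ← pow_add]
      congr 2; omega
    · obtain ⟨h1, -, h3⟩ := hQ
      obtain ⟨h1', -, h3'⟩ := hQ'
      rw [← h3, ← h3', Nat.div_div_eq_div_mul, ← pow_add]
      congr 2; omega
  rcases le_total R'.1 R.1 with h | h
  · exact Or.inl (key R R' hb hx hx' hQ hQ' h)
  · exact Or.inr (key R' R hb' hx' hx hQ' hQ h)

/-- The maximal tiles of a finite family. -/
def maxTiles (A : Finset (ℕ × ℕ × ℕ)) : Finset (ℕ × ℕ × ℕ) :=
  A.filter fun P => ∀ P' ∈ A, TileLE P P' → P' = P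

lemma maxTiles_subset (A : Finset (ℕ × ℕ × ℕ)) : maxTiles A ⊆ A := Finset.filter_subset _ _

lemma exists_maxTiles {A : Finset (ℕ × ℕ × ℕ)} {P : ℕ × ℕ × ℕ} (hP : P ∈ A) :
    ∃ Q ∈ maxTiles A, TileLE P Q := by
  obtain ⟨Q, hQ, hmin⟩ := Finset.exists_min_image (A.filter fun Q => TileLE P Q) (fun Q => Q.1)
    ⟨P, Finset.mem_filter.2 ⟨hP, TileLE.refl P⟩⟩
  obtain ⟨hQA, hPQ⟩ := Finset.mem_filter.1 hQ
  refine ⟨Q, Finset.mem_filter.2 ⟨hQA, fun P' hP' hle => ?_⟩, hPQ⟩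
  have := hmin P' (Finset.mem_filter.2 ⟨hP', hPQ.trans hle⟩)
  exact hle.eq_of_fst_eq (le_antisymm this hle.1)

lemma eq_of_maxTiles {A : Finset (ℕ × ℕ × ℕ)} {R R' : ℕ × ℕ × ℕ} (hR : R ∈ maxTiles A)
    (hR' : R' ∈ maxTiles A) (h : TileLE R R' ∨ TileLE R' R) : R = R' := by
  obtain ⟨h1, h2⟩ := Finset.mem_filter.1 hR
  obtain ⟨h1', h2'⟩ := Finset.mem_filter.1 hR'
  rcases h with h | h
  exacts [(h2 R' h1' h).symm, h2' R h1 h]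

lemma eq_of_maxTiles_of_tileLE {A : Finset (ℕ × ℕ × ℕ)} {b x : ℕ} (hA : ∀ P ∈ A, P.1 ≤ b)
    {R R' Q : ℕ × ℕ × ℕ} (hR : R ∈ maxTiles A) (hR' : R' ∈ maxTiles A)
    (hx : InBlock b x R) (hx' : InBlock b x R') (hQ : TileLE R Q) (hQ' : TileLE R' Q) : R = R' :=
  eq_of_maxTiles hR hR' (tileLE_or_tileLE (hA R (maxTiles_subset _ hR))
    (hA R' (maxTiles_subset _ hR')) hx hx' hQ hQ')

lemma card_block_le {N s q : ℕ} (hs : 0 < s) :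
    ((Finset.range N).filter fun x => x / s = q).card ≤ s := by
  have : (Finset.range N).filter (fun x => x / s = q) ⊆ Finset.Ico (q * s) (q * s + s) := by
    intro x hx
    have h := (Finset.mem_filter.1 hx).2
    have h1 := Nat.div_add_mod x s
    have h2 := Nat.mod_lt x hs
    rw [h, mul_comm] at h1
    rw [Finset.mem_Ico]
    omega
  simpa using Finset.card_le_card this

/-- The tiles over `E`. -/
def tiles (b : ℕ) (E : Finset ℕ) (M : ℕ → ℕ) : Finset (ℕ × ℕ × ℕ) :=
  (E ×ˢ Finset.range (b + 1)).image fun x => tile b M x.1 x.2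

/-- The number of points of `E` in the tile `P`. -/
def mass (b : ℕ) (E : Finset ℕ) (M : ℕ → ℕ) (P : ℕ × ℕ × ℕ) : ℕ :=
  (E.filter fun j => tile b M j P.1 = P).card

/-- The maximal tiles of density more than `2 ^ (-ν - 1)`. -/
def heavyTops (b : ℕ) (E : Finset ℕ) (M : ℕ → ℕ) (ν : ℕ) : Finset (ℕ × ℕ × ℕ) :=
  maxTiles ((tiles b E M).filter fun P => 2 ^ (b - P.1) < mass b E M P * 2 ^ (ν + 1))

/-- The number of maximal heavy tiles above `P`. -/
def topCount (b : ℕ) (E : Finset ℕ) (M : ℕ → ℕ) (ν : ℕ) (P : ℕ × ℕ × ℕ) : ℕ :=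
  ((heavyTops b E M ν).filter fun Q => TileLE P Q).card

/-- The number of maximal heavy tiles over `x`. -/
def overlap (b : ℕ) (E : Finset ℕ) (M : ℕ → ℕ) (ν x : ℕ) : ℕ :=
  ((heavyTops b E M ν).filter fun Q => InBlock b x Q).card

section Counting

variable {b : ℕ} {E : Finset ℕ} {M : ℕ → ℕ} {ν : ℕ}

lemma fst_le_of_mem_tiles {P : ℕ × ℕ × ℕ} (h : P ∈ tiles b E M) : P.1 ≤ b := by
  obtain ⟨x, hx, rfl⟩ := Finset.mem_image.1 h
  have := (Finset.mem_product.1 hx).2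
  have := Finset.mem_range.1 this
  simp only [tile]; omega

lemma fst_le_of_mem_heavyTops {Q : ℕ × ℕ × ℕ} (h : Q ∈ heavyTops b E M ν) : Q.1 ≤ b :=
  fst_le_of_mem_tiles (Finset.mem_filter.1 (maxTiles_subset _ h)).1

lemma topCount_pos {j i : ℕ} (hi : i ≤ b) (h : ¬ IsLight b E M (ν + 1) j i) :
    0 < topCount b E M ν (tile b M j i) := by
  unfold IsLight at h
  push Not at h
  obtain ⟨l, hl, ξ, hξ, hlt⟩ := h
  set P : ℕ × ℕ × ℕ := (l, j / 2 ^ (b - l), ξ / 2 ^ (l + 3)) with hP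
  have hmass : 2 ^ (b - P.1) < mass b E M P * 2 ^ (ν + 1) := by
    simpa [mass, tile, hP] using hlt
  have hpos : 0 < mass b E M P := by
    rcases Nat.eq_zero_or_pos (mass b E M P) with h0 | h0
    · rw [h0, zero_mul] at hmass; exact absurd hmass (Nat.not_lt_zero _)
    · exact h0
  obtain ⟨j', hj'⟩ := Finset.card_pos.1 hpos
  obtain ⟨hj'E, hj'P⟩ := Finset.mem_filter.1 hj'
  have hPt : P ∈ tiles b E M := Finset.mem_image.2 ⟨(j', l), Finset.mem_product.2
    ⟨hj'E, Finset.mem_range.2 (by omega)⟩, hj'P⟩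
  obtain ⟨Q, hQ, hle⟩ := exists_maxTiles
    (A := (tiles b E M).filter fun P => 2 ^ (b - P.1) < mass b E M P * 2 ^ (ν + 1))
    (Finset.mem_filter.2 ⟨hPt, hmass⟩)
  refine Finset.card_pos.2 ⟨Q, Finset.mem_filter.2 ⟨hQ, TileLE.trans (P' := P) ?_ hle⟩⟩
  refine ⟨hl, ?_, ?_⟩
  · simp only [tile, hP]
    rw [Nat.div_div_eq_div_mul, ← pow_add]; congr 2; omega
  · simp only [tile, hP]
    rw [Nat.div_div_eq_div_mul, ← pow_add, ← hξ]; congr 2; omega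

lemma topCount_mono {P P' : ℕ × ℕ × ℕ} (h : TileLE P P') :
    topCount b E M ν P' ≤ topCount b E M ν P :=
  Finset.card_le_card fun Q hQ => by
    obtain ⟨h1, h2⟩ := Finset.mem_filter.1 hQ
    exact Finset.mem_filter.2 ⟨h1, h.trans h2⟩

lemma topCount_le_overlap {x : ℕ} {P : ℕ × ℕ × ℕ} (hP : P.1 ≤ b) (h : InBlock b x P) :
    topCount b E M ν P ≤ overlap b E M ν x :=
  Finset.card_le_card fun Q hQ => by
    obtain ⟨h1, h2⟩ := Finset.mem_filter.1 hQ
    exact Finset.mem_filter.2 ⟨h1, h.of_tileLE h2 hP⟩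

lemma sum_mass_heavyTops_le : ∑ Q ∈ heavyTops b E M ν, mass b E M Q ≤ E.card := by
  simp only [mass]
  rw [← Finset.card_biUnion]
  · exact Finset.card_le_card (Finset.biUnion_subset.2 fun Q _ => Finset.filter_subset _ _)
  · intro Q hQ Q' hQ' hne
    refine Finset.disjoint_left.2 fun j hj hj' => hne ?_
    have h1 := (Finset.mem_filter.1 hj).2
    have h2 := (Finset.mem_filter.1 hj').2
    refine eq_of_maxTiles hQ hQ' ?_
    have hb := fst_le_of_mem_heavyTops hQ
    have hb' := fst_le_of_mem_heavyTops hQ'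
    rw [← h1, ← h2]
    rcases le_total Q'.1 Q.1 with h | h
    · exact Or.inl (tileLE_tile h hb)
    · exact Or.inr (tileLE_tile h hb')

lemma sum_overlap_le : ∑ x ∈ Finset.range (2 ^ b), overlap b E M ν x ≤ 2 ^ (ν + 1) * E.card := by
  calc ∑ x ∈ Finset.range (2 ^ b), overlap b E M ν x
      = ∑ Q ∈ heavyTops b E M ν, ((Finset.range (2 ^ b)).filter fun x => InBlock b x Q).card := by
        simp only [overlap, Finset.card_filter]
        exact Finset.sum_comm
    _ ≤ ∑ Q ∈ heavyTops b E M ν, mass b E M Q * 2 ^ (ν + 1) := by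
        refine Finset.sum_le_sum fun Q hQ => ?_
        have := (Finset.mem_filter.1 (maxTiles_subset _ hQ)).2
        exact (card_block_le (by positivity)).trans this.le
    _ ≤ _ := by
        rw [← Finset.sum_mul, mul_comm]
        gcongr
        exact sum_mass_heavyTops_le

end Counting

open Classical in
/-- The scales over `j` at which the density is about `2 ^ (-ν)` and about `2 ^ k` maximal heavy
tiles lie above. -/
noncomputable def levelScales (b : ℕ) (E : Finset ℕ) (M : ℕ → ℕ) (ν k j : ℕ) : Finset ℕ :=
  (Finset.range (b + 1)).filter fun i => IsLight b E M ν j i ∧ ¬ IsLight b E M (ν + 1) j i ∧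
    Nat.log 2 (topCount b E M ν (tile b M j i)) = k

open Classical in
/-- The maximal tiles of a given level. -/
noncomputable def levelTops (b : ℕ) (E : Finset ℕ) (M : ℕ → ℕ) (ν k : ℕ) :
    Finset (ℕ × ℕ × ℕ) :=
  maxTiles ((tiles b E M).filter fun P => ∃ j ∈ E, ∃ i ∈ levelScales b E M ν k j,
    tile b M j i = P)

section Level

variable {b : ℕ} {E : Finset ℕ} {M : ℕ → ℕ} {ν k : ℕ}

lemma mem_levelScales {j i : ℕ} : i ∈ levelScales b E M ν k j ↔ i ≤ b ∧ IsLight b E M ν j i ∧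
    ¬ IsLight b E M (ν + 1) j i ∧ Nat.log 2 (topCount b E M ν (tile b M j i)) = k := by
  classical
  simp [levelScales]

lemma two_pow_le_topCount {j i : ℕ} (h : i ∈ levelScales b E M ν k j) :
    2 ^ k ≤ topCount b E M ν (tile b M j i) := by
  obtain ⟨hb, -, h2, rfl⟩ := mem_levelScales.1 h
  exact Nat.pow_log_le_self 2 (topCount_pos hb h2).ne'

lemma topCount_lt {j i : ℕ} (h : i ∈ levelScales b E M ν k j) :
    topCount b E M ν (tile b M j i) < 2 * 2 ^ k := by
  obtain ⟨-, -, -, rfl⟩ := mem_levelScales.1 h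
  rw [mul_comm, ← pow_succ]
  exact Nat.lt_pow_succ_log_self (by norm_num) _

lemma mem_levelScales_of_le_of_le {j i i' i'' : ℕ} (h : i ∈ levelScales b E M ν k j)
    (h'' : i'' ∈ levelScales b E M ν k j) (hi : i ≤ i') (hi' : i' ≤ i'') :
    i' ∈ levelScales b E M ν k j := by
  obtain ⟨-, -, h2, h3⟩ := mem_levelScales.1 h
  obtain ⟨hb, h1'', -, h3''⟩ := mem_levelScales.1 h''
  refine mem_levelScales.2 ⟨hi'.trans hb, h1''.mono hi', fun hc => h2 (hc.mono hi), ?_⟩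
  refine le_antisymm ?_ ?_
  · rw [← h3'']
    exact Nat.log_mono_right (topCount_mono (tileLE_tile hi' hb))
  · rw [← h3]
    exact Nat.log_mono_right (topCount_mono (tileLE_tile hi (hi'.trans hb)))

lemma fst_le_of_mem_levelTops {R : ℕ × ℕ × ℕ} (h : R ∈ levelTops b E M ν k) : R.1 ≤ b :=
  fst_le_of_mem_tiles (Finset.mem_filter.1 (maxTiles_subset _ h)).1

lemma two_pow_le_topCount_of_mem_levelTops {R : ℕ × ℕ × ℕ} (h : R ∈ levelTops b E M ν k) :
    2 ^ k ≤ topCount b E M ν R := by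
  obtain ⟨-, j, -, i, hi, rfl⟩ := Finset.mem_filter.1 (maxTiles_subset _ h)
  exact two_pow_le_topCount hi

lemma exists_levelTops {j i : ℕ} (hj : j ∈ E) (hi : i ∈ levelScales b E M ν k j) :
    ∃ R ∈ levelTops b E M ν k, TileLE (tile b M j i) R := by
  classical
  refine exists_maxTiles (Finset.mem_filter.2 ⟨?_, j, hj, i, hi, rfl⟩)
  exact Finset.mem_image.2 ⟨(j, i), Finset.mem_product.2
    ⟨hj, Finset.mem_range.2 (by have := (mem_levelScales.1 hi).1; omega)⟩, rfl⟩

lemma eq_of_levelTops {x : ℕ} {R R' Q : ℕ × ℕ × ℕ} (hR : R ∈ levelTops b E M ν k)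
    (hR' : R' ∈ levelTops b E M ν k) (hx : InBlock b x R) (hx' : InBlock b x R')
    (hQ : TileLE R Q) (hQ' : TileLE R' Q) : R = R' :=
  eq_of_maxTiles_of_tileLE (fun _ hP => fst_le_of_mem_tiles (Finset.mem_filter.1 hP).1)
    hR hR' hx hx' hQ hQ'

/-- The top above a tile of a given level is unique. -/
lemma levelTops_unique {j i : ℕ} (hi : i ∈ levelScales b E M ν k j) {R R' : ℕ × ℕ × ℕ}
    (hR : R ∈ levelTops b E M ν k) (hR' : R' ∈ levelTops b E M ν k)
    (h : TileLE (tile b M j i) R) (h' : TileLE (tile b M j i) R') : R = R' := by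
  by_contra hne
  have hb := (mem_levelScales.1 hi).1
  have hdisj : Disjoint ((heavyTops b E M ν).filter fun Q => TileLE R Q)
      ((heavyTops b E M ν).filter fun Q => TileLE R' Q) := by
    refine Finset.disjoint_left.2 fun Q hQ hQ' => hne ?_
    exact eq_of_levelTops hR hR' ((inBlock_tile b M j i).of_tileLE h hb)
      ((inBlock_tile b M j i).of_tileLE h' hb) (Finset.mem_filter.1 hQ).2
      (Finset.mem_filter.1 hQ').2
  have hle : topCount b E M ν R + topCount b E M ν R' ≤ topCount b E M ν (tile b M j i) := by
    unfold topCount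
    rw [← Finset.card_union_of_disjoint hdisj]
    refine Finset.card_le_card fun Q hQ => ?_
    rcases Finset.mem_union.1 hQ with hQ | hQ <;> obtain ⟨h1, h2⟩ := Finset.mem_filter.1 hQ
    exacts [Finset.mem_filter.2 ⟨h1, h.trans h2⟩, Finset.mem_filter.2 ⟨h1, h'.trans h2⟩]
  have h1 := two_pow_le_topCount_of_mem_levelTops hR
  have h2 := two_pow_le_topCount_of_mem_levelTops hR'
  have h3 := topCount_lt hi
  omega

lemma card_levelTops_inBlock_le (x : ℕ) :
    ((levelTops b E M ν k).filter fun R => InBlock b x R).card ≤ overlap b E M ν x := by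
  have h1 : ((levelTops b E M ν k).filter fun R => InBlock b x R).card
      ≤ ∑ R ∈ (levelTops b E M ν k).filter (fun R => InBlock b x R), topCount b E M ν R := by
    rw [Finset.card_eq_sum_ones]
    refine Finset.sum_le_sum fun R hR => ?_
    exact Nat.one_le_two_pow.trans
      (two_pow_le_topCount_of_mem_levelTops (Finset.mem_filter.1 hR).1)
  refine h1.trans ?_
  unfold topCount
  rw [← Finset.card_biUnion]
  · refine Finset.card_le_card (Finset.biUnion_subset.2 fun R hR Q hQ => ?_)
    obtain ⟨hR1, hR2⟩ := Finset.mem_filter.1 hR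
    obtain ⟨hQ1, hQ2⟩ := Finset.mem_filter.1 hQ
    exact Finset.mem_filter.2 ⟨hQ1, hR2.of_tileLE hQ2 (fst_le_of_mem_levelTops hR1)⟩
  · intro R hR R' hR' hne
    obtain ⟨hR1, hR2⟩ := Finset.mem_filter.1 hR
    obtain ⟨hR1', hR2'⟩ := Finset.mem_filter.1 hR'
    exact Finset.disjoint_left.2 fun Q hQ hQ' => hne (eq_of_levelTops hR1 hR1' hR2 hR2'
      (Finset.mem_filter.1 hQ).2 (Finset.mem_filter.1 hQ').2)

lemma exists_interval_top {j : ℕ} (hj : j ∈ E) (h : (levelScales b E M ν k j).Nonempty) :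
    ∃ i0 i1 R, i0 ≤ i1 ∧ levelScales b E M ν k j = Finset.Icc i0 i1 ∧
      R ∈ levelTops b E M ν k ∧ TileLE (tile b M j i0) R := by
  obtain ⟨R, hR, hle⟩ := exists_levelTops hj ((levelScales b E M ν k j).min'_mem h)
  refine ⟨_, _, R, (levelScales b E M ν k j).min'_le_max' h, ?_, hR, hle⟩
  ext i
  rw [Finset.mem_Icc]
  exact ⟨fun hi => ⟨Finset.min'_le _ _ hi, Finset.le_max' _ _ hi⟩, fun hi =>
    mem_levelScales_of_le_of_le (Finset.min'_mem _ h) (Finset.max'_mem _ h) hi.1 hi.2⟩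

end Level

lemma osc_eq_osc_filter {b : ℕ} {F : Finset ℕ} (p : ℕ → Prop) [DecidablePred p] {g : ℕ → ℂ}
    {u v : ℕ → ℤ → ℝ} (h : ∀ j ∈ F, ∀ n, u j n = if p j then v j n else 0) :
    osc b F g u = osc b (F.filter p) g v := by
  ext n
  rw [osc, osc, Finset.sum_filter]
  refine Finset.sum_congr rfl fun j hj => ?_
  rw [h j hj n]
  split_ifs <;> simp

lemma digitSum_eq_sum_add {M i0 i1 l : ℕ} (hl : l ≤ i0) (m : ℕ) (n : ℤ) :
    digitSum M i0 i1 n = (∑ r ∈ Finset.range m,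
        if i0 ≤ l + r ∧ l + r ≤ i1 then digitBump M (l + r) n else 0)
      + digitSum M (max i0 (l + m)) i1 n := by
  have h1 : ∑ r ∈ Finset.range m, (if i0 ≤ l + r ∧ l + r ≤ i1 then digitBump M (l + r) n else 0)
      = ∑ i ∈ (Finset.Icc i0 i1).filter (fun i => i < l + m), digitBump M i n := by
    have : ∑ r ∈ Finset.range m,
        (if i0 ≤ l + r ∧ l + r ≤ i1 then digitBump M (l + r) n else 0)
        = ∑ i ∈ Finset.Ico l (l + m), if i0 ≤ i ∧ i ≤ i1 then digitBump M i n else 0 := by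
      rw [Finset.sum_Ico_eq_sum_range]; simp
    rw [this, ← Finset.sum_filter]
    refine Finset.sum_congr ?_ fun _ _ => rfl
    ext i; simp only [Finset.mem_filter, Finset.mem_Ico, Finset.mem_Icc]; omega
  have h2 : digitSum M (max i0 (l + m)) i1 n
      = ∑ i ∈ (Finset.Icc i0 i1).filter (fun i => ¬ i < l + m), digitBump M i n := by
    refine Finset.sum_congr ?_ fun _ _ => rfl
    ext i; simp only [Finset.mem_filter, Finset.mem_Icc]; omega
  rw [h1, h2, Finset.sum_filter_add_sum_filter_not, digitSum]

/-- The estimate for one level. -/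
lemma l2norm_osc_level_le {b : ℕ} {E E' : Finset ℕ} {M : ℕ → ℕ} {ν k : ℕ} (hE' : E' ⊆ E)
    (hF : ∀ j ∈ E', 2 * j ≤ 2 ^ b)
    (htrim : ∀ j ∈ E', ∀ R ∈ levelTops b E M ν k, InBlock b j R → ∀ x, ¬ InBlock b x R →
      (2 : ℝ) ^ (b - R.1) / 2 ^ (4 * ν + 8) ≤ |(x : ℝ) - j|)
    {g : ℕ → ℂ} (hg : ∀ j, ‖g j‖ ≤ 1) (S : Finset ℤ) :
    l2norm S (osc b E' g fun j n => ∑ i ∈ levelScales b E M ν k j, digitBump (M j) i n)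
      ≤ (5 * ν + 9) * (2 ^ 25 * √(2 ^ b * E.card / 2 ^ ν)) := by
  set X := √(2 ^ b * E.card / 2 ^ ν) with hX
  set F := E'.filter fun j => (levelScales b E M ν k j).Nonempty with hFdef
  have hFE : F ⊆ E := (Finset.filter_subset _ _).trans hE'
  have hFE' : F ⊆ E' := Finset.filter_subset _ _
  have hex : ∀ j ∈ F, ∃ i0 i1 R, i0 ≤ i1 ∧ levelScales b E M ν k j = Finset.Icc i0 i1 ∧
      R ∈ levelTops b E M ν k ∧ TileLE (tile b M j i0) R := fun j hj =>
    exists_interval_top (hFE hj) (Finset.mem_filter.1 hj).2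
  choose! i0 i1 R h01 hlev hR hle using hex
  have hmem : ∀ j ∈ F, ∀ i, i0 j ≤ i → i ≤ i1 j → i ∈ levelScales b E M ν k j := by
    intro j hj i h h'
    rw [hlev j hj]; exact Finset.mem_Icc.2 ⟨h, h'⟩
  have hb : ∀ j ∈ F, i1 j ≤ b := fun j hj =>
    (mem_levelScales.1 (hmem j hj _ (h01 j hj) le_rfl)).1
  have hL : ∀ j ∈ F, IsLight b E M ν j (i1 j) := fun j hj =>
    (mem_levelScales.1 (hmem j hj _ (h01 j hj) le_rfl)).2.1
  have hl0 : ∀ j ∈ F, (R j).1 ≤ i0 j := fun j hj => (hle j hj).1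
  have hle' : ∀ j ∈ F, ∀ i, i0 j ≤ i → i ≤ i1 j → TileLE (tile b M j i) (R j) :=
    fun j hj i h h' => (tileLE_tile h (h'.trans (hb j hj))).trans (hle j hj)
  have hcard : ∀ U : Finset ℕ, U ⊆ F → √(2 ^ b * U.card / 2 ^ ν) ≤ X := fun U hU => by
    rw [hX]
    gcongr
    exact hU.trans hFE
  set m := 5 * ν + 8 with hm
  set A : ℕ → ℕ → ℤ → ℝ := fun r j n => if i0 j ≤ (R j).1 + r ∧ (R j).1 + r ≤ i1 j then
    digitBump (M j) ((R j).1 + r) n else 0 with hA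
  set B : ℕ → ℤ → ℝ := fun j => digitSum (M j) (max (i0 j) ((R j).1 + m)) (i1 j) with hB
  have hAr : ∀ r, l2norm S (osc b F g (A r)) ≤ 2 ^ 25 * X := by
    intro r
    rw [osc_eq_osc_filter (fun j => i0 j ≤ (R j).1 + r ∧ (R j).1 + r ≤ i1 j)
      (v := fun j => digitBump (M j) ((R j).1 + r)) (fun j _ n => rfl)]
    have hsub := Finset.filter_subset (fun j => i0 j ≤ (R j).1 + r ∧ (R j).1 + r ≤ i1 j) F
    have hp := fun j (hj : j ∈ F.filter fun j => i0 j ≤ (R j).1 + r ∧ (R j).1 + r ≤ i1 j) =>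
      (Finset.mem_filter.1 hj).2
    have h := l2norm_osc_atom_le (r := 0) (ν := ν) (sc := fun j => (R j).1 + r)
      (hsub.trans hFE) (fun j hj => (hp j hj).2.trans (hb j (hsub hj)))
      (fun j hj => hF j (hFE' (hsub hj))) (fun j hj => (hL j (hsub hj)).mono (hp j hj).2)
      (fun j _ => isScaleAtom_digitBump (M j) ((R j).1 + r))
      (fun j _ j' _ hs ⟨n, hn, hn'⟩ => div_eq_div_of_digitBump_mul_ne_zero hs hn hn') hg S
    refine h.trans ?_
    have h1 := hcard _ hsub
    have h2 : 0 ≤ X := Real.sqrt_nonneg _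
    rw [pow_zero, mul_one]
    refine (mul_le_mul_of_nonneg_left h1 (by positivity)).trans ?_
    gcongr <;> norm_num
  have hBr : l2norm S (osc b F g B) ≤ 2 ^ 25 * X := by
    rw [osc_eq_osc_filter (fun j => max (i0 j) ((R j).1 + m) ≤ i1 j) (v := B) (fun j _ n => by
      split_ifs with hc
      · rfl
      · simp only [hB, digitSum]
        rw [Finset.Icc_eq_empty hc, Finset.sum_empty])]
    have hsub := Finset.filter_subset (fun j => max (i0 j) ((R j).1 + m) ≤ i1 j) F
    have hp := fun j (hj : j ∈ F.filter fun j => max (i0 j) ((R j).1 + m) ≤ i1 j) =>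
      (Finset.mem_filter.1 hj).2
    refine (l2norm_osc_forest_le (h := 4 * ν + 8) R (fun P => P.1)
      (fun P => P.2.2 * 2 ^ (P.1 + 3)) (hsub.trans hFE) hp (fun j hj => hb j (hsub hj))
      (fun j hj => hF j (hFE' (hsub hj))) (fun j hj => hL j (hsub hj))
      (fun j _ => by omega) ?_ ?_ hg S).trans
      (mul_le_mul_of_nonneg_left (hcard _ hsub) (by positivity))
    · intro j hj
      obtain ⟨h1, -, h3⟩ := hle' j (hsub hj) _ (le_max_left _ _) (hp j hj)
      simp only [tile] at h1 h3
      rw [← h3, show max (i0 j) ((R j).1 + m) + 3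
        = ((R j).1 + 3) + (max (i0 j) ((R j).1 + m) - (R j).1) by omega, pow_add _ ((R j).1 + 3),
        ← Nat.div_div_eq_div_mul, Nat.mul_div_cancel _ (by positivity)]
    · intro j hj j' hj' hne i i' hi hi1 hi' hi1' hii hM
      have hj1 := hsub hj
      have hj1' := hsub hj'
      have hi0 : i0 j ≤ i := (le_max_left _ _).trans hi
      have hi0' : i0 j' ≤ i' := (le_max_left _ _).trans hi'
      have htop' := hle' j' hj1' i' hi0' hi1'
      have hib := hi1.trans (hb j hj1)
      refine htrim j' (hFE' hj1') (R j') (hR j' hj1')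
        ((inBlock_tile b M j' i').of_tileLE htop' (by simp only [tile]; omega)) j fun hin => ?_
      refine hne (levelTops_unique (hmem j hj1 i hi0 hi1) (hR j hj1) (hR j' hj1')
        (hle' j hj1 i hi0 hi1) ?_)
      have h4 : TileLE (tile b M j' i) (R j') := (tileLE_tile hii hib).trans htop'
      obtain ⟨h5, -, h6⟩ := h4
      refine ⟨h5, ?_, ?_⟩
      · simp only [tile] at h5 ⊢
        rw [Nat.div_div_eq_div_mul, ← pow_add, ← hin]
        congr 2; omega
      · simp only [tile] at h6 ⊢
        rw [h6, hM]
  have e : osc b E' g (fun j n => ∑ i ∈ levelScales b E M ν k j, digitBump (M j) i n)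
      = fun n => ∑ r ∈ Finset.range m, osc b F g (A r) n + osc b F g B n := by
    rw [osc_eq_osc_filter (fun j => (levelScales b E M ν k j).Nonempty)
      (v := fun j n => ∑ i ∈ levelScales b E M ν k j, digitBump (M j) i n) (fun j _ n => by
        split_ifs with hc
        · rfl
        · rw [Finset.not_nonempty_iff_eq_empty.1 hc, Finset.sum_empty])]
    ext n
    rw [← osc_sum, ← osc_add]
    refine osc_congr (fun j hj n => ?_) n
    rw [hlev j hj]
    exact digitSum_eq_sum_add (hl0 j hj) m n
  rw [e]
  have h1 := l2norm_add_le S (fun n => ∑ r ∈ Finset.range m, osc b F g (A r) n) (osc b F g B)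
  have h2 := l2norm_sum_le (Finset.range m) S fun r => osc b F g (A r)
  have h3 : ∑ r ∈ Finset.range m, l2norm S (osc b F g (A r)) ≤ m * (2 ^ 25 * X) := by
    refine (Finset.sum_le_sum fun r _ => hAr r).trans (le_of_eq ?_)
    rw [Finset.sum_const, Finset.card_range, nsmul_eq_mul]
  have h4 : (m : ℝ) = 5 * ν + 8 := by rw [hm]; push_cast; ring
  rw [h4] at h3
  linarith

lemma card_near_boundary_le {N s q H : ℕ} (hs : 0 < s) (hH : 0 < H) (p : ℕ → Prop)
    [DecidablePred p]
    (hp : ∀ j, p j → j / s = q ∧ ∃ x : ℕ, x / s ≠ q ∧ |(x : ℝ) - j| < s / H) :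
    ((Finset.range N).filter p).card * H ≤ 2 * s := by
  have hsub : (Finset.range N).filter p ⊆
      Finset.Ico (q * s) (q * s + s / H) ∪ Finset.Ico (q * s + s - s / H) (q * s + s) := by
    intro j hj
    obtain ⟨hq, x, hx, hlt⟩ := hp j (Finset.mem_filter.1 hj).2
    have hj1 : q * s ≤ j := by rw [← hq]; exact Nat.div_mul_le_self _ _
    have hj2 : j < q * s + s := by
      have := Nat.lt_div_mul_add (a := j) hs
      rwa [hq] at this
    rw [Finset.mem_union, Finset.mem_Ico, Finset.mem_Ico]
    rw [lt_div_iff₀ (by exact_mod_cast hH)] at hlt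
    rcases lt_or_ge x (q * s) with h | h
    · left
      refine ⟨hj1, ?_⟩
      have h1 : ((j - x : ℕ) : ℝ) * H < s := by
        rw [Nat.cast_sub (by omega)]
        refine lt_of_le_of_lt ?_ hlt
        rw [abs_sub_comm]
        gcongr
        exact le_abs_self _
      have h2 : (j - x) * H < s := by exact_mod_cast h1
      have h3 := (Nat.le_div_iff_mul_le hH).2 h2.le
      omega
    · right
      have hx' : q * s + s ≤ x := by
        by_contra hc
        push Not at hc
        refine hx (Nat.div_eq_of_lt_le h ?_)
        rw [add_mul, one_mul]; exact hc
      refine ⟨?_, hj2⟩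
      have h1 : ((x - j : ℕ) : ℝ) * H < s := by
        rw [Nat.cast_sub (by omega)]
        refine lt_of_le_of_lt ?_ hlt
        gcongr
        exact le_abs_self _
      have h2 : (x - j) * H < s := by exact_mod_cast h1
      have h3 := (Nat.le_div_iff_mul_le hH).2 h2.le
      omega
  have h1 := (Finset.card_le_card hsub).trans (Finset.card_union_le _ _)
  rw [Nat.card_Ico, Nat.card_Ico] at h1
  have h2 := Nat.div_mul_le_self s H
  have h3 : ((Finset.range N).filter p).card ≤ 2 * (s / H) := by omega
  calc _ ≤ 2 * (s / H) * H := Nat.mul_le_mul_right _ h3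
    _ ≤ _ := by rw [mul_assoc]; omega

lemma two_pow_le_card_block {b i j : ℕ} (hi : i ≤ b) (hj : j < 2 ^ b) :
    2 ^ (b - i) ≤ ((Finset.range (2 ^ b)).filter fun x =>
      x / 2 ^ (b - i) = j / 2 ^ (b - i)).card := by
  have hb : 2 ^ b = 2 ^ i * 2 ^ (b - i) := by rw [← pow_add]; congr 1; omega
  have hs : 0 < 2 ^ (b - i) := by positivity
  set s := 2 ^ (b - i)
  have hq : j / s + 1 ≤ 2 ^ i := (Nat.div_lt_iff_lt_mul hs).2 (hb ▸ hj)
  have hsub : Finset.Ico (j / s * s) (j / s * s + s) ⊆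
      (Finset.range (2 ^ b)).filter fun x => x / s = j / s := by
    intro x hx
    obtain ⟨h1, h2⟩ := Finset.mem_Ico.1 hx
    have h3 : (j / s + 1) * s ≤ 2 ^ i * s := Nat.mul_le_mul_right _ hq
    rw [add_mul, one_mul] at h3
    rw [Finset.mem_filter, Finset.mem_range, hb]
    refine ⟨by omega, Nat.div_eq_of_lt_le h1 ?_⟩
    rw [add_mul, one_mul]; exact h2
  simpa using Finset.card_le_card hsub

open Classical in
/-- The points of `E` covered by too many maximal heavy tiles. -/
noncomputable def crowded (b : ℕ) (E : Finset ℕ) (M : ℕ → ℕ) (ν : ℕ) : Finset ℕ :=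
  E.filter fun j => 2 ^ (2 * ν + 6) < overlap b E M ν j

open Classical in
/-- The points of `E` near the boundary of one of the tops of a level. -/
noncomputable def nearBoundary (b : ℕ) (E : Finset ℕ) (M : ℕ → ℕ) (ν k : ℕ) : Finset ℕ :=
  E.filter fun j => ∃ R ∈ levelTops b E M ν k, InBlock b j R ∧ ∃ x : ℕ, ¬ InBlock b x R ∧
    |(x : ℝ) - j| < (2 : ℝ) ^ (b - R.1) / 2 ^ (4 * ν + 8)

section Exceptional

variable {b : ℕ} {E : Finset ℕ} {M : ℕ → ℕ}

lemma card_crowded_le (hE : E ⊆ Finset.range (2 ^ b)) (ν : ℕ) :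
    (crowded b E M ν).card * 2 ^ (ν + 5) ≤ E.card := by
  have h1 : (crowded b E M ν).card * 2 ^ (2 * ν + 6) ≤ 2 ^ (ν + 1) * E.card := by
    calc (crowded b E M ν).card * 2 ^ (2 * ν + 6)
        = ∑ j ∈ crowded b E M ν, 2 ^ (2 * ν + 6) := by rw [Finset.sum_const, smul_eq_mul]
      _ ≤ ∑ j ∈ crowded b E M ν, overlap b E M ν j :=
          Finset.sum_le_sum fun j hj => (Finset.mem_filter.1 hj).2.le
      _ ≤ ∑ j ∈ Finset.range (2 ^ b), overlap b E M ν j :=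
          Finset.sum_le_sum_of_subset ((Finset.filter_subset _ _).trans hE)
      _ ≤ _ := sum_overlap_le
  have h2 : 2 ^ (2 * ν + 6) = 2 ^ (ν + 5) * 2 ^ (ν + 1) := by rw [← pow_add]; congr 1; omega
  rw [h2, ← mul_assoc, mul_comm (2 ^ (ν + 1))] at h1
  exact Nat.le_of_mul_le_mul_right h1 (by positivity)

lemma card_nearBoundary_le (hE : E ⊆ Finset.range (2 ^ b)) (ν k : ℕ) :
    (nearBoundary b E M ν k).card * 2 ^ (3 * ν + 6) ≤ E.card := by
  classical
  set bad : ℕ × ℕ × ℕ → Finset ℕ := fun R => (Finset.range (2 ^ b)).filter fun j =>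
    InBlock b j R ∧ ∃ x : ℕ, ¬ InBlock b x R ∧
      |(x : ℝ) - j| < (2 : ℝ) ^ (b - R.1) / 2 ^ (4 * ν + 8) with hbad
  have hsub : nearBoundary b E M ν k ⊆ (levelTops b E M ν k).biUnion bad := by
    intro j hj
    obtain ⟨hjE, R, hR, h⟩ := Finset.mem_filter.1 hj
    exact Finset.mem_biUnion.2 ⟨R, hR, Finset.mem_filter.2 ⟨hE hjE, h⟩⟩
  have h1 : (nearBoundary b E M ν k).card * 2 ^ (4 * ν + 8) ≤ 2 * (2 ^ (ν + 1) * E.card) := by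
    calc (nearBoundary b E M ν k).card * 2 ^ (4 * ν + 8)
        ≤ (∑ R ∈ levelTops b E M ν k, (bad R).card) * 2 ^ (4 * ν + 8) :=
          Nat.mul_le_mul_right _ ((Finset.card_le_card hsub).trans Finset.card_biUnion_le)
      _ ≤ ∑ R ∈ levelTops b E M ν k,
            2 * ((Finset.range (2 ^ b)).filter fun x => InBlock b x R).card := by
          rw [Finset.sum_mul]
          refine Finset.sum_le_sum fun R hR => ?_
          have hc : (bad R).card * 2 ^ (4 * ν + 8) ≤ 2 * 2 ^ (b - R.1) :=
            card_near_boundary_le (q := R.2.1) (by positivity) (by positivity) _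
              fun j hj => ⟨hj.1, by simpa [InBlock] using hj.2⟩
          refine hc.trans (Nat.mul_le_mul_left _ ?_)
          obtain ⟨-, j, hj, i, hi, rfl⟩ := Finset.mem_filter.1 (maxTiles_subset _ hR)
          exact two_pow_le_card_block (mem_levelScales.1 hi).1 (Finset.mem_range.1 (hE hj))
      _ = 2 * ∑ x ∈ Finset.range (2 ^ b),
            ((levelTops b E M ν k).filter fun R => InBlock b x R).card := by
          rw [← Finset.mul_sum]
          simp only [Finset.card_filter]
          rw [Finset.sum_comm]
      _ ≤ 2 * ∑ x ∈ Finset.range (2 ^ b), overlap b E M ν x :=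
          Nat.mul_le_mul_left _ (Finset.sum_le_sum fun x _ => card_levelTops_inBlock_le x)
      _ ≤ _ := Nat.mul_le_mul_left _ sum_overlap_le
  have h2 : 2 ^ (4 * ν + 8) = 2 ^ (3 * ν + 6) * 2 ^ (ν + 2) := by rw [← pow_add]; congr 1; omega
  have h3 : 2 * (2 ^ (ν + 1) * E.card) = E.card * 2 ^ (ν + 2) := by ring
  rw [h2, h3, ← mul_assoc] at h1
  exact Nat.le_of_mul_le_mul_right h1 (by positivity)

/-- The points where the estimates of the individual levels are not available. -/
noncomputable def exceptional (b : ℕ) (E : Finset ℕ) (M : ℕ → ℕ) : Finset ℕ :=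
  (Finset.range (b + 1)).biUnion fun ν => crowded b E M ν ∪
    (Finset.range (2 * ν + 7)).biUnion fun k => nearBoundary b E M ν k

lemma two_mul_card_exceptional_le (hE : E ⊆ Finset.range (2 ^ b)) :
    2 * (exceptional b E M).card ≤ E.card := by
  have hν : ∀ ν : ℕ, ((crowded b E M ν ∪
      (Finset.range (2 * ν + 7)).biUnion fun k => nearBoundary b E M ν k).card : ℝ)
      ≤ (5 / 32 * E.card) * (1 / 2) ^ ν := by
    intro ν
    have h1 : ((crowded b E M ν).card : ℝ) ≤ E.card * ((1 / 32) * (1 / 2) ^ ν) := by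
      have h := card_crowded_le (M := M) hE ν
      have h' : ((crowded b E M ν).card : ℝ) * 2 ^ (ν + 5) ≤ E.card := by exact_mod_cast h
      rw [← le_div_iff₀ (by positivity)] at h'
      refine h'.trans (le_of_eq ?_)
      rw [pow_add, one_div, one_div, inv_pow]; field_simp; norm_num
    have h2 : ∀ k, ((nearBoundary b E M ν k).card : ℝ) ≤ E.card * (1 / 64 * (1 / 8) ^ ν) := by
      intro k
      have h := card_nearBoundary_le (M := M) hE ν k
      have h' : ((nearBoundary b E M ν k).card : ℝ) * 2 ^ (3 * ν + 6) ≤ E.card := by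
        exact_mod_cast h
      rw [← le_div_iff₀ (by positivity)] at h'
      refine h'.trans (le_of_eq ?_)
      rw [pow_add, pow_mul, one_div, one_div, inv_pow]
      norm_num
      field_simp
    have h3 : (((Finset.range (2 * ν + 7)).biUnion fun k => nearBoundary b E M ν k).card : ℝ)
        ≤ (2 * ν + 7) * (E.card * (1 / 64 * (1 / 8) ^ ν)) := by
      have h : (((Finset.range (2 * ν + 7)).biUnion fun k => nearBoundary b E M ν k).card : ℝ)
          ≤ ∑ k ∈ Finset.range (2 * ν + 7), ((nearBoundary b E M ν k).card : ℝ) := by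
        exact_mod_cast Finset.card_biUnion_le
      refine h.trans ((Finset.sum_le_sum fun k _ => h2 k).trans (le_of_eq ?_))
      rw [Finset.sum_const, Finset.card_range, nsmul_eq_mul]; push_cast; ring
    have h4 : ((2 : ℝ) * ν + 7) ≤ 8 * 2 ^ ν := by
      have : ((ν + 1 : ℕ) : ℝ) ≤ 2 ^ ν := by exact_mod_cast Nat.lt_two_pow_self
      push_cast at this
      have h0 : (0 : ℝ) ≤ ν := Nat.cast_nonneg ν
      linarith
    have h5 : (((crowded b E M ν ∪
        (Finset.range (2 * ν + 7)).biUnion fun k => nearBoundary b E M ν k).card : ℕ) : ℝ)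
        ≤ (crowded b E M ν).card
          + ((Finset.range (2 * ν + 7)).biUnion fun k => nearBoundary b E M ν k).card := by
      exact_mod_cast Finset.card_union_le _ _
    have h6 : ((2 : ℝ) * ν + 7) * (E.card * (1 / 64 * (1 / 8) ^ ν))
        ≤ E.card * (1 / 8 * (1 / 2) ^ ν) := by
      have e1 : ((1 : ℝ) / 8) ^ ν = (1 / 2) ^ ν * (1 / 4) ^ ν := by
        rw [← mul_pow]; norm_num
      have e2 : (2 : ℝ) ^ ν * (1 / 4) ^ ν ≤ 1 := by
        rw [← mul_pow]; exact pow_le_one₀ (by norm_num) (by norm_num)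
      calc ((2 : ℝ) * ν + 7) * (E.card * (1 / 64 * (1 / 8) ^ ν))
          ≤ (8 * 2 ^ ν) * (E.card * (1 / 64 * (1 / 8) ^ ν)) := by gcongr
        _ = E.card * (1 / 8 * (1 / 2) ^ ν) * (2 ^ ν * (1 / 4) ^ ν) := by rw [e1]; ring
        _ ≤ _ := mul_le_of_le_one_right (by positivity) e2
    linarith
  have h1 : ((exceptional b E M).card : ℝ) ≤ ∑ ν ∈ Finset.range (b + 1),
      ((crowded b E M ν ∪ (Finset.range (2 * ν + 7)).biUnion
        fun k => nearBoundary b E M ν k).card : ℝ) := by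
    exact_mod_cast Finset.card_biUnion_le
  have h2 : ∑ ν ∈ Finset.range (b + 1), ((1 : ℝ) / 2) ^ ν ≤ 2 := by
    have := Summable.sum_le_tsum (Finset.range (b + 1)) (fun i _ => by positivity)
      summable_geometric_two
    rwa [tsum_geometric_two] at this
  have h3 : ((exceptional b E M).card : ℝ) ≤ 5 / 32 * E.card * 2 := by
    refine h1.trans ((Finset.sum_le_sum fun ν _ => hν ν).trans ?_)
    rw [← Finset.mul_sum]
    gcongr
  have h0 : (0 : ℝ) ≤ E.card := Nat.cast_nonneg _
  have : (2 * (exceptional b E M).card : ℝ) ≤ E.card := by linarith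
  exact_mod_cast this

end Exceptional

section Assembly

variable {b : ℕ} {E : Finset ℕ} {M : ℕ → ℕ}

lemma IsLight.of_le {ν ν' j i : ℕ} (h : IsLight b E M ν' j i) (hν : ν ≤ ν') :
    IsLight b E M ν j i := fun l hl ξ hξ =>
  (Nat.mul_le_mul_left _ (Nat.pow_le_pow_right (by norm_num) hν)).trans (h l hl ξ hξ)

lemma isLight_zero (hE : E ⊆ Finset.range (2 ^ b)) (j i : ℕ) : IsLight b E M 0 j i := by
  intro l _ ξ _
  rw [pow_zero, mul_one]
  refine (Finset.card_le_card fun j' hj' => ?_).trans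
    (card_block_le (N := 2 ^ b) (q := j / 2 ^ (b - l)) (by positivity))
  obtain ⟨h1, h2, -⟩ := Finset.mem_filter.1 hj'
  exact Finset.mem_filter.2 ⟨hE h1, h2⟩

lemma not_isLight_succ {j : ℕ} (hj : j ∈ E) (i : ℕ) : ¬ IsLight b E M (b + 1) j i := by
  intro h
  have h1 := h 0 (Nat.zero_le _) (M j) rfl
  have h2 : 1 ≤ (E.filter fun j' => j' / 2 ^ (b - 0) = j / 2 ^ (b - 0) ∧
      M j' / 2 ^ (0 + 3) = M j / 2 ^ (0 + 3)).card :=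
    Finset.card_pos.2 ⟨j, Finset.mem_filter.2 ⟨hj, rfl, rfl⟩⟩
  have h3 := (Nat.mul_le_mul_right (2 ^ (b + 1)) h2).trans h1
  rw [one_mul, Nat.sub_zero, pow_succ] at h3
  have : 0 < 2 ^ b := by positivity
  omega

lemma exists_isLight_not_isLight (hE : E ⊆ Finset.range (2 ^ b)) {j : ℕ} (hj : j ∈ E) (i : ℕ) :
    ∃ ν ≤ b, IsLight b E M ν j i ∧ ¬ IsLight b E M (ν + 1) j i := by
  classical
  refine ⟨Nat.findGreatest (fun ν => IsLight b E M ν j i) b, Nat.findGreatest_le b,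
    Nat.findGreatest_spec (P := fun ν => IsLight b E M ν j i) (Nat.zero_le b)
      (isLight_zero hE j i), fun h => ?_⟩
  by_cases hb : Nat.findGreatest (fun ν => IsLight b E M ν j i) b + 1 ≤ b
  · have := Nat.le_findGreatest (P := fun ν => IsLight b E M ν j i) hb h
    omega
  · exact not_isLight_succ hj i (h.of_le (by omega))

/-- Off the exceptional set every scale belongs to exactly one level. -/
lemma sum_levelScales {j : ℕ} (hE : E ⊆ Finset.range (2 ^ b))
    (hj : j ∈ E \ exceptional b E M) (f : ℕ → ℝ) :
    ∑ i ∈ Finset.range (b + 1), f i = ∑ ν ∈ Finset.range (b + 1),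
      ∑ k ∈ Finset.range (2 * ν + 7), ∑ i ∈ levelScales b E M ν k j, f i := by
  classical
  obtain ⟨hjE, hjX⟩ := Finset.mem_sdiff.1 hj
  have h1 : ∀ ν k, ∑ i ∈ levelScales b E M ν k j, f i
      = ∑ i ∈ Finset.range (b + 1), if i ∈ levelScales b E M ν k j then f i else 0 := by
    intro ν k
    rw [← Finset.sum_filter]
    refine Finset.sum_congr ?_ fun _ _ => rfl
    ext i
    rw [Finset.mem_filter, Finset.mem_range]
    exact ⟨fun h => ⟨by have := (mem_levelScales.1 h).1; omega, h⟩, fun h => h.2⟩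
  simp only [h1]
  have h2 : ∑ ν ∈ Finset.range (b + 1), ∑ k ∈ Finset.range (2 * ν + 7),
      ∑ i ∈ Finset.range (b + 1), (if i ∈ levelScales b E M ν k j then f i else 0)
      = ∑ i ∈ Finset.range (b + 1), ∑ ν ∈ Finset.range (b + 1),
        ∑ k ∈ Finset.range (2 * ν + 7), if i ∈ levelScales b E M ν k j then f i else 0 := by
    rw [Finset.sum_comm (s := Finset.range (b + 1)) (t := Finset.range (b + 1))]
    exact Finset.sum_congr rfl fun ν _ => Finset.sum_comm
  rw [h2]
  refine Finset.sum_congr rfl fun i hi => ?_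
  have hib : i ≤ b := by have := Finset.mem_range.1 hi; omega
  obtain ⟨ν, hν, hl, hnl⟩ := exists_isLight_not_isLight (M := M) hE hjE i
  have hov : overlap b E M ν j ≤ 2 ^ (2 * ν + 6) := by
    by_contra hc
    push Not at hc
    exact hjX (Finset.mem_biUnion.2 ⟨ν, Finset.mem_range.2 (by omega),
      Finset.mem_union_left _ (Finset.mem_filter.2 ⟨hjE, hc⟩)⟩)
  have hk : Nat.log 2 (topCount b E M ν (tile b M j i)) < 2 * ν + 7 := by
    have h := Nat.log_mono_right (b := 2)
      ((topCount_le_overlap (M := M) (E := E) (ν := ν) (P := tile b M j i) hib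
        (inBlock_tile b M j i)).trans hov)
    rw [Nat.log_pow (by norm_num)] at h
    omega
  rw [Finset.sum_eq_single_of_mem ν (Finset.mem_range.2 (by omega)),
    Finset.sum_eq_single_of_mem _ (Finset.mem_range.2 hk),
    if_pos (mem_levelScales.2 ⟨hib, hl, hnl, rfl⟩)]
  · intro k _ hne
    exact if_neg fun h => hne (mem_levelScales.1 h).2.2.2.symm
  · intro ν' _ hne
    refine Finset.sum_eq_zero fun k _ => if_neg fun h => ?_
    obtain ⟨-, h1, h2, -⟩ := mem_levelScales.1 h
    rcases lt_or_gt_of_ne hne with h' | h'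
    · exact h2 (hl.of_le h')
    · exact hnl (h1.of_le h')

lemma summable_level_constants :
    Summable fun ν : ℕ => ((2 : ℝ) * ν + 7) * (5 * ν + 9) * (3 / 4) ^ ν := by
  have h2 := summable_pow_mul_geometric_of_norm_lt_one 2
    (show ‖(3 / 4 : ℝ)‖ < 1 by norm_num)
  have h1 := summable_pow_mul_geometric_of_norm_lt_one 1
    (show ‖(3 / 4 : ℝ)‖ < 1 by norm_num)
  have h0 := summable_pow_mul_geometric_of_norm_lt_one 0
    (show ‖(3 / 4 : ℝ)‖ < 1 by norm_num)
  refine (((h2.mul_left 10).add (h1.mul_left 53)).add (h0.mul_left 63)).congr fun ν => ?_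
  ring

/-- The constant of the linearized maximal estimate on large subsets. -/
noncomputable def levelConst : ℝ :=
  2 ^ 25 * ∑' ν : ℕ, ((2 : ℝ) * ν + 7) * (5 * ν + 9) * (3 / 4) ^ ν

lemma levelConst_nonneg : 0 ≤ levelConst :=
  mul_nonneg (by norm_num) (tsum_nonneg fun ν => by positivity)

/-- The `L²` estimate for the dyadic model operator on a large subset. -/
lemma l2norm_osc_digits_le (hE : E ⊆ Finset.range (2 ^ b)) (hF : ∀ j ∈ E, 2 * j ≤ 2 ^ b)
    {g : ℕ → ℂ} (hg : ∀ j, ‖g j‖ ≤ 1) (S : Finset ℤ) :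
    l2norm S (osc b (E \ exceptional b E M) g fun j n =>
        ∑ i ∈ Finset.range (b + 1), digitBump (M j) i n)
      ≤ levelConst * √(2 ^ b * E.card) := by
  classical
  set E' := E \ exceptional b E M with hE'
  have e : osc b E' g (fun j n => ∑ i ∈ Finset.range (b + 1), digitBump (M j) i n)
      = fun n => ∑ ν ∈ Finset.range (b + 1), ∑ k ∈ Finset.range (2 * ν + 7),
        osc b E' g (fun j n => ∑ i ∈ levelScales b E M ν k j, digitBump (M j) i n) n := by
    ext n
    simp only [← osc_sum]
    exact osc_congr (fun j hj n => sum_levelScales hE hj _) n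
  rw [e]
  refine (l2norm_sum_le _ S _).trans ?_
  set X := √(2 ^ b * (E.card : ℝ)) with hX
  have hν : ∀ ν ∈ Finset.range (b + 1), l2norm S (fun n => ∑ k ∈ Finset.range (2 * ν + 7),
      osc b E' g (fun j n => ∑ i ∈ levelScales b E M ν k j, digitBump (M j) i n) n)
      ≤ (2 ^ 25 * X) * (((2 : ℝ) * ν + 7) * (5 * ν + 9) * (3 / 4) ^ ν) := by
    intro ν hν
    refine (l2norm_sum_le _ S _).trans ?_
    have hk : ∀ k ∈ Finset.range (2 * ν + 7),
        l2norm S (osc b E' g fun j n => ∑ i ∈ levelScales b E M ν k j, digitBump (M j) i n)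
        ≤ (5 * ν + 9) * (2 ^ 25 * (X * (3 / 4) ^ ν)) := by
      intro k hk
      refine (l2norm_osc_level_le (E' := E') Finset.sdiff_subset
        (fun j hj => hF j (Finset.mem_sdiff.1 hj).1) ?_ hg S).trans ?_
      · intro j hj R hR hjR x hx
        by_contra hc
        push Not at hc
        obtain ⟨hjE, hjX⟩ := Finset.mem_sdiff.1 hj
        refine hjX (Finset.mem_biUnion.2 ⟨ν, hν, Finset.mem_union_right _
          (Finset.mem_biUnion.2 ⟨k, hk, Finset.mem_filter.2 ⟨hjE, R, hR, hjR, x, hx, ?_⟩⟩)⟩)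
        exact hc
      · gcongr
        rw [Real.sqrt_div (by positivity), div_eq_mul_inv]
        gcongr
        rw [inv_le_comm₀ (by positivity) (by positivity)]
        refine Real.le_sqrt_of_sq_le ?_
        rw [← inv_pow, ← pow_mul, mul_comm ν, pow_mul]
        gcongr
        norm_num
    refine (Finset.sum_le_sum hk).trans (le_of_eq ?_)
    rw [Finset.sum_const, Finset.card_range, nsmul_eq_mul]; push_cast; ring
  refine (Finset.sum_le_sum hν).trans ?_
  rw [← Finset.mul_sum, levelConst]
  have := summable_level_constants.sum_le_tsum (Finset.range (b + 1)) fun ν _ => by positivity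
  calc _ ≤ (2 ^ 25 * X) * ∑' ν : ℕ, ((2 : ℝ) * ν + 7) * (5 * ν + 9) * (3 / 4) ^ ν := by gcongr
    _ = _ := by ring

end Assembly

lemma norm_sum_mul_le_l2norm (S : Finset ℤ) (a G : ℤ → ℂ) :
    ‖∑ n ∈ S, a n * G n‖ ≤ l2norm S a * l2norm S G := by
  refine (norm_sum_le _ _).trans ?_
  simp only [norm_mul]
  exact Real.sum_mul_le_sqrt_mul_sqrt S (fun n => ‖a n‖) fun n => ‖G n‖

lemma exists_norm_le_one_mul_eq (z : ℂ) : ∃ w : ℂ, ‖w‖ ≤ 1 ∧ w * z = (‖z‖ : ℂ) := by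
  rcases eq_or_ne z 0 with rfl | hz
  · exact ⟨0, by simp, by simp⟩
  · have hz' : (‖z‖ : ℂ) ≠ 0 := by exact_mod_cast norm_ne_zero_iff.2 hz
    refine ⟨(starRingEnd ℂ) z / ‖z‖, ?_, ?_⟩
    · rw [norm_div, RCLike.norm_conj, Complex.norm_real, norm_norm,
        div_self (norm_ne_zero_iff.2 hz)]
    · rw [div_mul_eq_mul_div, mul_comm, Complex.mul_conj, Complex.normSq_eq_norm_sq]
      push_cast
      field_simp

/-- Duality between the oscillating sums `osc` and exponential sums. -/
lemma sum_norm_expSum_le_of_dual {b : ℕ} {F : Finset ℕ} {m : ℕ → ℤ → ℝ} {S : Finset ℤ} {X : ℝ}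
    (h : ∀ g : ℕ → ℂ, (∀ j, ‖g j‖ ≤ 1) → l2norm S (osc b F g m) ≤ X) (a : ℤ → ℂ) :
    ∑ j ∈ F, ‖∑ n ∈ S, a n * ((m j n : ℂ) * unitExp (n * ((j : ℝ) / 2 ^ b)))‖
      ≤ l2norm S a * X := by
  set z : ℕ → ℂ := fun j => ∑ n ∈ S, a n * ((m j n : ℂ) * unitExp (n * ((j : ℝ) / 2 ^ b))) with hz
  choose g hg hgz using fun j => exists_norm_le_one_mul_eq (z j)
  have e : ∑ n ∈ S, a n * osc b F g m n = ((∑ j ∈ F, ‖z j‖ : ℝ) : ℂ) := by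
    push_cast
    simp only [osc, Finset.mul_sum]
    rw [Finset.sum_comm]
    refine Finset.sum_congr rfl fun j _ => ?_
    rw [← hgz j, hz, Finset.mul_sum]
    exact Finset.sum_congr rfl fun n _ => by ring
  have h0 : 0 ≤ ∑ j ∈ F, ‖z j‖ := Finset.sum_nonneg fun j _ => norm_nonneg _
  calc ∑ j ∈ F, ‖z j‖ = ‖∑ n ∈ S, a n * osc b F g m n‖ := by
        rw [e, Complex.norm_real, Real.norm_of_nonneg h0]
    _ ≤ l2norm S a * l2norm S (osc b F g m) := norm_sum_mul_le_l2norm S a _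
    _ ≤ _ := mul_le_mul_of_nonneg_left (h g hg) (l2norm_nonneg S a)

lemma sum_norm_digits_le {b : ℕ} {E : Finset ℕ} (M : ℕ → ℕ) (hE : E ⊆ Finset.range (2 ^ b))
    (hF : ∀ j ∈ E, 2 * j ≤ 2 ^ b) (S : Finset ℤ) (a : ℤ → ℂ) :
    ∑ j ∈ E, ‖∑ n ∈ S, a n * (((∑ i ∈ Finset.range (b + 1), digitBump (M j) i n : ℝ) : ℂ)
        * unitExp (n * ((j : ℝ) / 2 ^ b)))‖
      ≤ 4 * levelConst * l2norm S a * √(2 ^ b * E.card) := by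
  induction hc : E.card using Nat.strong_induction_on generalizing E with
  | _ c ih =>
    rcases Finset.eq_empty_or_nonempty E with rfl | hne
    · have hc0 : c = 0 := by simpa using hc.symm
      simp [hc0]
    set X := E ∩ exceptional b E M with hX
    have hXE : X ⊆ E := Finset.inter_subset_left
    have hXc : 2 * X.card ≤ c := by
      rw [← hc]
      exact (Nat.mul_le_mul_left 2 (Finset.card_le_card Finset.inter_subset_right)).trans
        (two_mul_card_exceptional_le hE)
    have hcpos : 0 < c := by rw [← hc]; exact hne.card_pos
    have h1 := ih X.card (by omega) (hXE.trans hE) (fun j hj => hF j (hXE hj)) rfl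
    have h2 := sum_norm_expSum_le_of_dual (S := S) (fun g hg =>
      l2norm_osc_digits_le (M := M) hE hF hg S) a
    rw [hc] at h2
    have hsplit : E = (E \ exceptional b E M) ∪ X := (Finset.sdiff_union_inter _ _).symm
    have hdisj : Disjoint (E \ exceptional b E M) X := Finset.disjoint_sdiff_inter _ _
    rw [Finset.sum_congr hsplit (fun _ _ => rfl), Finset.sum_union hdisj]
    have h3 : √(2 ^ b * (X.card : ℝ)) ≤ 3 / 4 * √(2 ^ b * c) := by
      rw [Real.sqrt_le_left (by positivity), mul_pow, Real.sq_sqrt (by positivity)]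
      have : (2 : ℝ) * X.card ≤ c := by exact_mod_cast hXc
      have h4 : (0 : ℝ) < 2 ^ b := by positivity
      nlinarith [mul_le_mul_of_nonneg_left this h4.le,
        mul_nonneg h4.le (Nat.cast_nonneg (α := ℝ) c)]
    have h5 : 0 ≤ 4 * levelConst * l2norm S a :=
      mul_nonneg (mul_nonneg (by norm_num) levelConst_nonneg) (l2norm_nonneg S a)
    have h6 := h1.trans (mul_le_mul_of_nonneg_left h3 h5)
    refine (add_le_add h2 h6).trans (le_of_eq ?_)
    ring

lemma sum_range_add_of_periodic {T : ℕ} {f : ℕ → ℝ} (hf : ∀ t, f (t + T) = f t) (s : ℕ) :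
    ∑ t ∈ Finset.range T, f (t + s) = ∑ t ∈ Finset.range T, f t := by
  induction s with
  | zero => rfl
  | succ s ih =>
    have h1 := Finset.sum_range_succ (fun t => f (t + s)) T
    have h2 := Finset.sum_range_succ' (fun t => f (t + s)) T
    have h3 : f (T + s) = f (0 + s) := by rw [add_comm, hf, zero_add]
    rw [← ih]
    have h4 : ∀ t, f (t + 1 + s) = f (t + (s + 1)) := fun t => by congr 1; ring
    simp only [h4] at h2
    linarith

lemma sum_range_digit (M : ℕ) {b i : ℕ} (hi : i ≤ b) :
    ∑ t ∈ Finset.range (2 ^ (b + 3)), (if (M + t) / 2 ^ (i + 2) % 2 = 1 then (1 : ℝ) else 0)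
      = 2 ^ (b + 2) := by
  set f : ℕ → ℝ := fun t => if (M + t) / 2 ^ (i + 2) % 2 = 1 then (1 : ℝ) else 0 with hf
  have hper : ∀ t, f (t + 2 ^ (b + 3)) = f t := by
    intro t
    have e : M + (t + 2 ^ (b + 3)) = M + t + 2 ^ (i + 2) * (2 * 2 ^ (b - i)) := by
      rw [← add_assoc, ← pow_succ', ← pow_add]; congr 2; omega
    simp only [hf]
    rw [e, Nat.add_mul_div_left _ _ (by positivity), Nat.add_mul_mod_self_left]
  have hflip : ∀ t, f (t + 2 ^ (i + 2)) = 1 - f t := by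
    intro t
    simp only [hf]
    rw [← add_assoc, Nat.add_div_right _ (by positivity)]
    rcases Nat.mod_two_eq_zero_or_one ((M + t) / 2 ^ (i + 2)) with h | h
    · rw [if_pos (by omega), if_neg (by omega), sub_zero]
    · rw [if_neg (by omega), if_pos h, sub_self]
  have h1 := sum_range_add_of_periodic hper (2 ^ (i + 2))
  simp only [hflip] at h1
  rw [Finset.sum_sub_distrib, Finset.sum_const, Finset.card_range, nsmul_eq_mul, mul_one] at h1
  push_cast at h1
  have h2 : (2 : ℝ) ^ (b + 3) = 2 * 2 ^ (b + 2) := by ring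
  linarith

lemma sum_digitBump_add (M : ℕ) (b : ℕ) (n : ℤ) :
    ∑ t ∈ Finset.range (2 ^ (b + 3)), ∑ i ∈ Finset.range (b + 1), digitBump (M + t) i (n + t)
      = 2 ^ (b + 2) * (cutoff (b + 1) (M - n) - cutoff 0 (M - n)) := by
  rw [Finset.sum_comm, ← sum_range_bump, Finset.mul_sum]
  refine Finset.sum_congr rfl fun i hi => ?_
  rw [← sum_range_digit M (Nat.lt_succ_iff.1 (Finset.mem_range.1 hi)), Finset.sum_mul]
  refine Finset.sum_congr rfl fun t _ => ?_
  have e : ((M + t : ℕ) : ℤ) - (n + t) = M - n := by push_cast; ring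
  rw [digitBump, e]
  split_ifs <;> simp

lemma l2norm_map_add (S : Finset ℤ) (a : ℤ → ℂ) (t : ℤ) :
    l2norm (S.map (addRightEmbedding t)) (fun n => a (n - t)) = l2norm S a := by
  simp [l2norm]

/-- The maximal estimate with smooth truncations. -/
lemma sum_norm_cutoff_le {b : ℕ} {E : Finset ℕ} (M : ℕ → ℕ) (hE : E ⊆ Finset.range (2 ^ b))
    (hF : ∀ j ∈ E, 2 * j ≤ 2 ^ b) (S : Finset ℤ) (a : ℤ → ℂ) :
    ∑ j ∈ E, ‖∑ n ∈ S, a n * (((cutoff (b + 1) (M j - n) - cutoff 0 (M j - n) : ℝ) : ℂ)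
        * unitExp (n * ((j : ℝ) / 2 ^ b)))‖
      ≤ 8 * levelConst * l2norm S a * √(2 ^ b * E.card) := by
  set z : ℕ → ℂ := fun j => ∑ n ∈ S,
    a n * (((cutoff (b + 1) (M j - n) - cutoff 0 (M j - n) : ℝ) : ℂ)
        * unitExp (n * ((j : ℝ) / 2 ^ b))) with hz
  set y : ℕ → ℕ → ℂ := fun t j => ∑ n ∈ S.map (addRightEmbedding (t : ℤ)), a (n - t) *
    (((∑ i ∈ Finset.range (b + 1), digitBump (M j + t) i n : ℝ) : ℂ)
        * unitExp (n * ((j : ℝ) / 2 ^ b))) with hy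
  have hyz : ∀ j, (2 : ℂ) ^ (b + 2) * z j
      = ∑ t ∈ Finset.range (2 ^ (b + 3)), unitExp (-(t * ((j : ℝ) / 2 ^ b))) * y t j := by
    intro j
    have e1 : ∀ t : ℕ, unitExp (-(t * ((j : ℝ) / 2 ^ b))) * y t j
        = ∑ n ∈ S, a n * (((∑ i ∈ Finset.range (b + 1), digitBump (M j + t) i (n + t) : ℝ) : ℂ)
          * unitExp (n * ((j : ℝ) / 2 ^ b))) := by
      intro t
      rw [hy]
      simp only [Finset.sum_map, addRightEmbedding_apply, add_sub_cancel_right]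
      rw [Finset.mul_sum]
      refine Finset.sum_congr rfl fun n _ => ?_
      have e2 : unitExp (n * ((j : ℝ) / 2 ^ b))
          = unitExp (-(t * ((j : ℝ) / 2 ^ b)))
            * unitExp (((n + t : ℤ) : ℝ) * ((j : ℝ) / 2 ^ b)) := by
        rw [← unitExp_add]; congr 1; push_cast; ring
      rw [e2]; ring
    simp only [e1]
    rw [Finset.sum_comm, hz, Finset.mul_sum]
    refine Finset.sum_congr rfl fun n _ => ?_
    rw [← Finset.mul_sum, ← Finset.sum_mul, ← Complex.ofReal_sum, sum_digitBump_add]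
    push_cast
    ring
  have hnorm : ∀ j, (2 : ℝ) ^ (b + 2) * ‖z j‖ ≤ ∑ t ∈ Finset.range (2 ^ (b + 3)), ‖y t j‖ := by
    intro j
    have h1 : (2 : ℝ) ^ (b + 2) * ‖z j‖ = ‖(2 : ℂ) ^ (b + 2) * z j‖ := by
      rw [norm_mul, norm_pow, Complex.norm_ofNat]
    rw [h1, hyz j]
    refine (norm_sum_le _ _).trans (Finset.sum_le_sum fun t _ => ?_)
    rw [norm_mul, norm_unitExp, one_mul]
  have h2 : ∀ t ∈ Finset.range (2 ^ (b + 3)), ∑ j ∈ E, ‖y t j‖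
      ≤ 4 * levelConst * l2norm S a * √(2 ^ b * E.card) := by
    intro t _
    have := sum_norm_digits_le (fun j => M j + t) hE hF (S.map (addRightEmbedding (t : ℤ)))
      (fun n => a (n - t))
    rwa [l2norm_map_add] at this
  have h3 : (2 : ℝ) ^ (b + 2) * ∑ j ∈ E, ‖z j‖
      ≤ 2 ^ (b + 3) * (4 * levelConst * l2norm S a * √(2 ^ b * E.card)) := by
    rw [Finset.mul_sum]
    refine (Finset.sum_le_sum fun j _ => hnorm j).trans ?_
    rw [Finset.sum_comm]
    refine (Finset.sum_le_sum h2).trans (le_of_eq ?_)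
    rw [Finset.sum_const, Finset.card_range, nsmul_eq_mul]; push_cast; ring
  have h4 : (0 : ℝ) < 2 ^ (b + 2) := by positivity
  refine le_of_mul_le_mul_left (h3.trans (le_of_eq ?_)) h4
  ring

lemma sum_norm_partial_le_of_half {b : ℕ} {E : Finset ℕ} {L : ℕ → ℕ}
    (hE : E ⊆ Finset.range (2 ^ b)) (hF : ∀ j ∈ E, 2 * j ≤ 2 ^ b)
    (hL : ∀ j, L j + 2 ≤ 2 ^ (b + 1)) {S : Finset ℤ} (hS : ∀ n ∈ S, 0 ≤ n) (a : ℤ → ℂ) :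
    ∑ j ∈ E, ‖∑ n ∈ S with n ≤ (L j : ℤ), a n * unitExp (n * ((j : ℝ) / 2 ^ b))‖
      ≤ 8 * levelConst * l2norm S a * √(2 ^ b * E.card) := by
  refine le_trans (le_of_eq (Finset.sum_congr rfl fun j _ => ?_))
    (sum_norm_cutoff_le (fun j => L j + 2) hE hF S a)
  rw [Finset.sum_filter]
  congr 1
  refine Finset.sum_congr rfl fun n hn => ?_
  have hn0 := hS n hn
  have h1 : cutoff (b + 1) ((L j + 2 : ℕ) - n) = 1 := cutoff_eq_one (by
    have : ((L j + 2 : ℕ) : ℤ) ≤ 2 ^ (b + 1) := by exact_mod_cast hL j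
    omega)
  rw [h1]
  split_ifs with h
  · rw [cutoff_eq_zero (by push_cast; omega)]
    simp
  · rw [cutoff_eq_one (by push_cast; omega)]
    simp

/-- The linearized maximal estimate for partial sums of exponential sums, sampled at the points
`j / 2 ^ b`, with the weak-type dependence on the set of points. -/
lemma sum_norm_partial_le {b : ℕ} {E : Finset ℕ} {L : ℕ → ℕ}
    (hE : E ⊆ Finset.range (2 ^ b)) (hL : ∀ j, L j + 2 ≤ 2 ^ (b + 1)) {S : Finset ℤ}
    (hS : ∀ n ∈ S, 0 ≤ n) (a : ℤ → ℂ) :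
    ∑ j ∈ E, ‖∑ n ∈ S with n ≤ (L j : ℤ), a n * unitExp (n * ((j : ℝ) / 2 ^ b))‖
      ≤ 16 * levelConst * l2norm S a * √(2 ^ b * E.card) := by
  have hC : 0 ≤ 8 * levelConst * l2norm S a :=
    mul_nonneg (mul_nonneg (by norm_num) levelConst_nonneg) (l2norm_nonneg S a)
  rw [← Finset.sum_filter_add_sum_filter_not E (fun j => 2 * j ≤ 2 ^ b)]
  set E1 := E.filter fun j => 2 * j ≤ 2 ^ b with hE1
  set E2 := E.filter fun j => ¬ 2 * j ≤ 2 ^ b with hE2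
  have h1 := sum_norm_partial_le_of_half ((Finset.filter_subset _ _).trans hE)
    (fun j hj => (Finset.mem_filter.1 hj).2 : ∀ j ∈ E1, 2 * j ≤ 2 ^ b) hL hS a
  have hcard : ∀ F : Finset ℕ, F.card ≤ E.card → 8 * levelConst * l2norm S a * √(2 ^ b * F.card)
      ≤ 8 * levelConst * l2norm S a * √(2 ^ b * E.card) := fun F hF => by gcongr
  have h2 : ∑ j ∈ E2, ‖∑ n ∈ S with n ≤ (L j : ℤ), a n * unitExp (n * ((j : ℝ) / 2 ^ b))‖
      ≤ 8 * levelConst * l2norm S a * √(2 ^ b * E.card) := by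
    rcases Nat.eq_zero_or_pos b with hb | hb
    · have : E2 = ∅ := by
        refine Finset.filter_eq_empty_iff.2 fun j hj => ?_
        have := Finset.mem_range.1 (hE hj)
        rw [hb] at this ⊢
        omega
      rw [this, Finset.sum_empty]
      positivity
    · have h2b : 2 ^ b = 2 * 2 ^ (b - 1) := by rw [← pow_succ']; congr 1; omega
      set s := 2 ^ (b - 1) with hs
      have hinj : Set.InjOn (fun j => j - s) (E2 : Set ℕ) := by
        intro x hx y hy hxy
        have h3 := (Finset.mem_filter.1 hx).2
        have h4 := (Finset.mem_filter.1 hy).2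
        simp only at hxy
        omega
      have h := sum_norm_partial_le_of_half (b := b) (E := E2.image fun j => j - s)
        (L := fun j => L (j + s)) (fun x hx => by
          obtain ⟨j, hj, rfl⟩ := Finset.mem_image.1 hx
          have := Finset.mem_range.1 (hE (Finset.mem_filter.1 hj).1)
          exact Finset.mem_range.2 (by omega)) (fun x hx => by
          obtain ⟨j, hj, rfl⟩ := Finset.mem_image.1 hx
          have := Finset.mem_range.1 (hE (Finset.mem_filter.1 hj).1)
          omega) (fun j => hL _) hS (fun n => a n * unitExp (n * ((s : ℝ) / 2 ^ b)))
      rw [Finset.sum_image hinj] at h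
      have hl2 : l2norm S (fun n => a n * unitExp (n * ((s : ℝ) / 2 ^ b))) = l2norm S a := by
        simp [l2norm, norm_unitExp]
      rw [hl2] at h
      refine le_trans (le_of_eq (Finset.sum_congr rfl fun j hj => ?_)) (h.trans (hcard _
        (Finset.card_image_le.trans (Finset.card_le_card (Finset.filter_subset _ _)))))
      have hjs : s ≤ j := by
        have := (Finset.mem_filter.1 hj).2
        omega
      rw [Nat.sub_add_cancel hjs]
      congr 1
      refine Finset.sum_congr rfl fun n _ => ?_
      rw [mul_assoc, ← unitExp_add, Nat.cast_sub hjs]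
      congr 2
      ring
  have h3 := h1.trans (hcard E1 (Finset.card_le_card (Finset.filter_subset _ _)))
  refine (add_le_add h3 h2).trans (le_of_eq ?_)
  ring

/-- The periodized second Bernoulli polynomial. -/
noncomputable def periodicBernoulli (y : ℝ) : ℝ := Int.fract y ^ 2 - Int.fract y + 1 / 6

lemma eval_bernoulli_two (x : ℝ) :
    Polynomial.eval x (Polynomial.map (algebraMap ℚ ℝ) (Polynomial.bernoulli 2))
      = x ^ 2 - x + 1 / 6 := by
  simp [Polynomial.bernoulli, Finset.sum_range_succ, bernoulli_two, bernoulli_one]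
  ring

lemma cos_two_pi_mul_fract (h : ℕ) (y : ℝ) :
    Real.cos (2 * π * h * Int.fract y) = Real.cos (2 * π * h * y) := by
  rw [Int.fract, ← Real.cos_sub_int_mul_two_pi (2 * π * h * y) (h * ⌊y⌋)]
  congr 1
  push_cast
  ring

lemma unitExp_re (t : ℝ) : (unitExp t).re = Real.cos (2 * π * t) := by
  rw [unitExp, mul_comm, Complex.exp_ofReal_mul_I_re]

lemma norm_unitExp_sub_le (s t : ℝ) : ‖unitExp s - unitExp t‖ ≤ 2 * π * |s - t| := by
  have e : unitExp s - unitExp t = unitExp t * (unitExp (s - t) - 1) := by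
    rw [mul_sub, ← unitExp_add, mul_one]; congr 2; ring
  rw [e, norm_mul, norm_unitExp, one_mul, unitExp]
  refine Real.norm_exp_I_mul_ofReal_sub_one_le.trans (le_of_eq ?_)
  rw [Real.norm_eq_abs, abs_mul, abs_of_pos Real.two_pi_pos]

lemma hasSum_periodicBernoulli (y : ℝ) :
    HasSum (fun h : ℕ => (unitExp (h * y)).re / (h : ℝ) ^ 2) (π ^ 2 * periodicBernoulli y) := by
  have h := hasSum_one_div_nat_pow_mul_cos one_ne_zero
    (x := Int.fract y) ⟨Int.fract_nonneg y, (Int.fract_lt_one y).le⟩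
  rw [mul_one, eval_bernoulli_two] at h
  convert h using 1
  · ext h
    rw [unitExp_re, cos_two_pi_mul_fract, ← mul_assoc]
    ring
  · rw [periodicBernoulli, Nat.factorial_two]
    push_cast
    ring

lemma fract_sub_eq (y w : ℝ) (hw : 0 ≤ w) (hw' : w ≤ 1) :
    (w ≤ Int.fract y ∧ Int.fract (y - w) = Int.fract y - w) ∨
      (Int.fract y < w ∧ Int.fract (y - w) = Int.fract y - w + 1) := by
  have h0 := Int.fract_nonneg y
  have h1 := Int.fract_lt_one y
  have e : y = Int.fract y + ⌊y⌋ := (Int.fract_add_floor y).symm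
  rcases le_or_gt w (Int.fract y) with h | h
  · refine Or.inl ⟨h, Int.fract_eq_iff.2 ⟨by linarith, by linarith, ⌊y⌋, by linarith⟩⟩
  · refine Or.inr ⟨h, ?_⟩
    rcases eq_or_lt_of_le h0 with h2 | h2
    · refine Int.fract_eq_iff.2 ⟨by linarith, ?_, ⌊y⌋ - 1, by push_cast; linarith⟩
      linarith
    · refine Int.fract_eq_iff.2 ⟨by linarith, by linarith, ⌊y⌋ - 1, by push_cast; linarith⟩

lemma fract_add_eq (y w : ℝ) (hw : 0 ≤ w) (hw' : w ≤ 1) :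
    (Int.fract y + w < 1 ∧ Int.fract (y + w) = Int.fract y + w) ∨
      (1 ≤ Int.fract y + w ∧ Int.fract (y + w) = Int.fract y + w - 1) := by
  have h0 := Int.fract_nonneg y
  have h1 := Int.fract_lt_one y
  have e : y = Int.fract y + ⌊y⌋ := (Int.fract_add_floor y).symm
  rcases lt_or_ge (Int.fract y + w) 1 with h | h
  · exact Or.inl ⟨h, Int.fract_eq_iff.2 ⟨by linarith, by linarith, ⌊y⌋, by linarith⟩⟩
  · exact Or.inr ⟨h, Int.fract_eq_iff.2 ⟨by linarith, by linarith, ⌊y⌋ + 1,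
      by push_cast; linarith⟩⟩

lemma sawtooth_le (y : ℝ) {w : ℝ} (hw : 0 < w) (hw' : w ≤ 1) :
    2 * w * (Int.fract y - 1 / 2) ≤ periodicBernoulli y - periodicBernoulli (y - w) + w ^ 2 := by
  unfold periodicBernoulli
  rcases fract_sub_eq y w hw.le hw' with ⟨h, e⟩ | ⟨h, e⟩ <;> rw [e] <;> nlinarith

lemma le_sawtooth (y : ℝ) {w : ℝ} (hw : 0 < w) (hw' : w ≤ 1) :
    periodicBernoulli (y + w) - periodicBernoulli y - w ^ 2 ≤ 2 * w * (Int.fract y - 1 / 2) := by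
  unfold periodicBernoulli
  rcases fract_add_eq y w hw.le hw' with ⟨h, e⟩ | ⟨h, e⟩ <;> rw [e] <;> nlinarith

lemma indicator_fract_sub (y : ℝ) {a : ℝ} (ha : a ∈ Set.Icc (0 : ℝ) 1) :
    (Set.Ico (0 : ℝ) a).indicator (fun _ => (1 : ℝ)) (Int.fract y) - a
      = Int.fract (y - a) - Int.fract y := by
  rcases fract_sub_eq y a ha.1 ha.2 with ⟨h, e⟩ | ⟨h, e⟩ <;> rw [e]
  · rw [Set.indicator_of_notMem (fun hc => absurd hc.2 (not_lt.2 h))]; ring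
  · have hm : Int.fract y ∈ Set.Ico (0 : ℝ) a := ⟨Int.fract_nonneg y, h⟩
    rw [Set.indicator_of_mem hm]; ring

lemma abs_sum_periodicBernoulli_sub_le (y : ℕ → ℝ) (K : ℕ) {P : ℕ} (hP : 0 < P) {c c' : ℝ}
    (hc : |c - c'| = 1 / P) :
    |∑ k ∈ Finset.Icc 1 K, periodicBernoulli (y k + c)
        - ∑ k ∈ Finset.Icc 1 K, periodicBernoulli (y k + c')|
      ≤ (2 / π) / P * (∑ h ∈ Finset.Icc 1 (P ^ 2),
          ‖∑ k ∈ Finset.Icc 1 K, unitExp (h * y k)‖ / h) + 2 / π ^ 2 * K / (P : ℝ) ^ 2 := by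
  set s : ℕ → ℂ := fun h => ∑ k ∈ Finset.Icc 1 K, unitExp (h * y k) with hs
  set f : ℕ → ℝ := fun h => ((unitExp (h * c) - unitExp (h * c')) * s h).re / (h : ℝ) ^ 2 with hf
  have hPR : (0 : ℝ) < P := by exact_mod_cast hP
  have hsum : HasSum f (π ^ 2 * (∑ k ∈ Finset.Icc 1 K, periodicBernoulli (y k + c)
        - ∑ k ∈ Finset.Icc 1 K, periodicBernoulli (y k + c'))) := by
    have h := hasSum_sum (s := Finset.Icc 1 K) fun k _ =>
      (hasSum_periodicBernoulli (y k + c)).sub (hasSum_periodicBernoulli (y k + c'))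
    have e1 : f = fun h : ℕ => ∑ k ∈ Finset.Icc 1 K, ((unitExp (h * (y k + c))).re / (h : ℝ) ^ 2
        - (unitExp (h * (y k + c'))).re / (h : ℝ) ^ 2) := by
      ext h
      simp only [hf, hs]
      rw [Finset.mul_sum, Complex.re_sum, Finset.sum_div]
      refine Finset.sum_congr rfl fun k _ => ?_
      rw [sub_mul, ← unitExp_add, ← unitExp_add, Complex.sub_re, sub_div, mul_add, mul_add,
        add_comm (h * c), add_comm (h * c')]
    have e2 : π ^ 2 * (∑ k ∈ Finset.Icc 1 K, periodicBernoulli (y k + c)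
        - ∑ k ∈ Finset.Icc 1 K, periodicBernoulli (y k + c'))
        = ∑ k ∈ Finset.Icc 1 K, (π ^ 2 * periodicBernoulli (y k + c)
          - π ^ 2 * periodicBernoulli (y k + c')) := by
      rw [← Finset.sum_sub_distrib, Finset.mul_sum]
      exact Finset.sum_congr rfl fun k _ => by ring
    rw [e1, e2]
    exact h
  have hsK : ∀ h, ‖s h‖ ≤ K := by
    intro h
    refine (norm_sum_le _ _).trans (le_of_eq ?_)
    simp [norm_unitExp]
  have hf1 : ∀ h, |f h| ≤ 2 * π / P * (‖s h‖ / h) := by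
    intro h
    rcases Nat.eq_zero_or_pos h with rfl | hh
    · simp [hf]
    have hhR : (0 : ℝ) < h := by exact_mod_cast hh
    rw [hf]
    simp only
    rw [abs_div, abs_of_pos (by positivity : (0 : ℝ) < (h : ℝ) ^ 2), div_le_iff₀ (by positivity)]
    refine (Complex.abs_re_le_norm _).trans ?_
    rw [norm_mul]
    have h1 := norm_unitExp_sub_le (h * c) (h * c')
    rw [← mul_sub, abs_mul, hc, abs_of_pos hhR] at h1
    refine (mul_le_mul_of_nonneg_right h1 (norm_nonneg _)).trans (le_of_eq ?_)
    field_simp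
  have hf2 : ∀ h, |f h| ≤ 2 * K * ((h : ℝ) ^ 2)⁻¹ := by
    intro h
    rw [hf]
    simp only
    rw [abs_div, abs_of_nonneg (by positivity : (0 : ℝ) ≤ (h : ℝ) ^ 2), div_eq_mul_inv]
    gcongr
    refine (Complex.abs_re_le_norm _).trans ?_
    rw [norm_mul]
    gcongr
    · refine (norm_sub_le _ _).trans (le_of_eq ?_)
      rw [norm_unitExp, norm_unitExp]; norm_num
    · exact hsK h
  set W := ∑ h ∈ Finset.Icc 1 (P ^ 2), ‖s h‖ / h with hW
  have hpart : ∀ n, P ^ 2 ≤ n → |∑ h ∈ Finset.range (n + 1), f h|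
      ≤ 2 * π / P * W + 2 * K / (P : ℝ) ^ 2 := by
    intro n hn
    have hsplit : Finset.range (n + 1)
        = insert 0 (Finset.Icc 1 (P ^ 2) ∪ Finset.Ioc (P ^ 2) n) := by
      ext h; simp only [Finset.mem_range, Finset.mem_insert, Finset.mem_union, Finset.mem_Icc,
        Finset.mem_Ioc]; omega
    have hd : Disjoint (Finset.Icc 1 (P ^ 2)) (Finset.Ioc (P ^ 2) n) :=
      Finset.disjoint_left.2 fun h h1 h2 => by
        have := (Finset.mem_Icc.1 h1).2
        have := (Finset.mem_Ioc.1 h2).1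
        omega
    rw [hsplit, Finset.sum_insert (by simp), Finset.sum_union hd]
    have h0 : f 0 = 0 := by simp [hf]
    rw [h0, zero_add]
    have h1 : |∑ h ∈ Finset.Icc 1 (P ^ 2), f h| ≤ 2 * π / P * W := by
      rw [hW, Finset.mul_sum]
      exact (Finset.abs_sum_le_sum_abs _ _).trans (Finset.sum_le_sum fun h _ => hf1 h)
    have h2 : |∑ h ∈ Finset.Ioc (P ^ 2) n, f h| ≤ 2 * K / (P : ℝ) ^ 2 := by
      refine (Finset.abs_sum_le_sum_abs _ _).trans
        ((Finset.sum_le_sum fun h _ => hf2 h).trans ?_)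
      rw [← Finset.mul_sum, div_eq_mul_inv]
      gcongr
      have h3 := sum_Ioc_inv_sq_le_sub (α := ℝ) (k := P ^ 2) (n := n) (by positivity) hn
      have h4 : (0 : ℝ) ≤ (n : ℝ)⁻¹ := by positivity
      push_cast at h3
      linarith
    exact (abs_add_le _ _).trans (add_le_add h1 h2)
  have hlim := (hsum.tendsto_sum_nat.comp (tendsto_add_atTop_nat 1)).abs
  have hle := le_of_tendsto hlim (Filter.eventually_atTop.2 ⟨P ^ 2, fun n hn => hpart n hn⟩)
  rw [abs_mul, abs_of_pos (by positivity : (0 : ℝ) < π ^ 2)] at hle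
  rw [← le_div_iff₀' (by positivity)] at hle
  refine hle.trans (le_of_eq ?_)
  have := Real.pi_ne_zero
  field_simp

/-- An Erdős–Turán type inequality. -/
lemma abs_sum_indicator_sub_le (y : ℕ → ℝ) (K : ℕ) {P : ℕ} (hP : 0 < P) {a : ℝ}
    (ha : a ∈ Set.Icc (0 : ℝ) 1) :
    |∑ k ∈ Finset.Icc 1 K, (Set.Ico (0 : ℝ) a).indicator (fun _ => (1 : ℝ)) (Int.fract (y k))
        - K * a|
      ≤ 2 * K / P + ∑ h ∈ Finset.Icc 1 (P ^ 2),
          ‖∑ k ∈ Finset.Icc 1 K, unitExp (h * y k)‖ / h := by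
  have hPR : (0 : ℝ) < P := by exact_mod_cast hP
  set W := ∑ h ∈ Finset.Icc 1 (P ^ 2), ‖∑ k ∈ Finset.Icc 1 K, unitExp (h * y k)‖ / h with hW
  have hW0 : 0 ≤ W := Finset.sum_nonneg fun h _ => by positivity
  set w : ℝ := 1 / P with hw
  have hw0 : 0 < w := by positivity
  have hw1 : w ≤ 1 := by rw [hw, div_le_one hPR]; exact_mod_cast hP
  set Φ : ℝ → ℝ := fun c => ∑ k ∈ Finset.Icc 1 K, periodicBernoulli (y k + c) with hΦ
  have hΦ' : ∀ c c', |c - c'| = w → |Φ c - Φ c'|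
      ≤ (2 / π) / P * W + 2 / π ^ 2 * K / (P : ℝ) ^ 2 := fun c c' h =>
    abs_sum_periodicBernoulli_sub_le y K hP h
  have hσ1 : ∀ c, 2 * w * ∑ k ∈ Finset.Icc 1 K, (Int.fract (y k + c) - 1 / 2)
      ≤ Φ c - Φ (c - w) + K * w ^ 2 := by
    intro c
    rw [Finset.mul_sum]
    refine (Finset.sum_le_sum fun k _ => sawtooth_le (y k + c) hw0 hw1).trans (le_of_eq ?_)
    rw [Finset.sum_add_distrib, Finset.sum_sub_distrib, Finset.sum_const, Nat.card_Icc,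
      Nat.add_sub_cancel, nsmul_eq_mul]
    simp only [hΦ, add_sub_assoc]
  have hσ2 : ∀ c, Φ (c + w) - Φ c - K * w ^ 2
      ≤ 2 * w * ∑ k ∈ Finset.Icc 1 K, (Int.fract (y k + c) - 1 / 2) := by
    intro c
    rw [Finset.mul_sum]
    refine le_trans (le_of_eq ?_) (Finset.sum_le_sum fun k _ => le_sawtooth (y k + c) hw0 hw1)
    rw [Finset.sum_sub_distrib, Finset.sum_sub_distrib, Finset.sum_const, Nat.card_Icc,
      Nat.add_sub_cancel, nsmul_eq_mul]
    simp only [hΦ, add_assoc]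
  have e : ∑ k ∈ Finset.Icc 1 K, (Set.Ico (0 : ℝ) a).indicator (fun _ => (1 : ℝ))
      (Int.fract (y k)) - K * a = ∑ k ∈ Finset.Icc 1 K, (Int.fract (y k + -a) - 1 / 2)
        - ∑ k ∈ Finset.Icc 1 K, (Int.fract (y k + 0) - 1 / 2) := by
    have h1 : (K : ℝ) * a = ∑ k ∈ Finset.Icc 1 K, a := by simp
    rw [h1, ← Finset.sum_sub_distrib, ← Finset.sum_sub_distrib]
    refine Finset.sum_congr rfl fun k _ => ?_
    rw [indicator_fract_sub (y k) ha, add_zero, ← sub_eq_add_neg]; ring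
  rw [e]
  set T := ∑ k ∈ Finset.Icc 1 K, (Int.fract (y k + -a) - 1 / 2) with hT
  set T0 := ∑ k ∈ Finset.Icc 1 K, (Int.fract (y k + 0) - 1 / 2) with hT0
  have hb : ∀ c, |Φ c - Φ (c - w)| ≤ (2 / π) / P * W + 2 / π ^ 2 * K / (P : ℝ) ^ 2 := fun c =>
    hΦ' _ _ (by rw [sub_sub_cancel, abs_of_pos hw0])
  have hb' : ∀ c, |Φ (c + w) - Φ c| ≤ (2 / π) / P * W + 2 / π ^ 2 * K / (P : ℝ) ^ 2 := fun c =>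
    hΦ' _ _ (by rw [add_sub_cancel_left, abs_of_pos hw0])
  have hmain : 2 * w * |T - T0|
      ≤ 2 * ((2 / π) / P * W + 2 / π ^ 2 * K / (P : ℝ) ^ 2) + 2 * (K * w ^ 2) := by
    rw [show 2 * w * |T - T0| = |2 * w * T - 2 * w * T0| by
      rw [← mul_sub, abs_mul, abs_of_pos (by positivity : 0 < 2 * w)]]
    have a1 := hσ1 (-a)
    have a2 := hσ2 (-a)
    have a3 := hσ1 0
    have a4 := hσ2 0
    have b1 := abs_le.1 (hb (-a))
    have b2 := abs_le.1 (hb' (-a))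
    have b3 := abs_le.1 (hb 0)
    have b4 := abs_le.1 (hb' 0)
    rw [abs_le]
    constructor <;> linarith [b1.1, b1.2, b2.1, b2.2, b3.1, b3.2, b4.1, b4.2]
  have hpi : 2 / π ≤ 1 := by rw [div_le_one Real.pi_pos]; linarith [Real.pi_gt_three]
  have hpi2 : 2 / π ^ 2 ≤ 1 := by
    rw [div_le_one (by positivity)]; nlinarith [Real.pi_gt_three]
  have h1 : 2 * ((2 / π) / P * W + 2 / π ^ 2 * K / (P : ℝ) ^ 2) + 2 * (K * w ^ 2)
      ≤ 2 * (1 / P * W + 1 * K / (P : ℝ) ^ 2) + 2 * (K * w ^ 2) := by gcongr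
  have h2 : 2 * (1 / P * W + 1 * K / (P : ℝ) ^ 2) + 2 * (K * w ^ 2)
      = 2 * w * (2 * K / P + W) := by
    rw [hw]; field_simp; ring
  rw [h2] at h1
  exact le_of_mul_le_mul_left (hmain.trans h1) (by positivity)

/-- If every translate of the grid of step `1 / Q` meets `A` in at most `B` points, then
`A ∩ [0, 1)` has measure at most `B / Q`. -/
lemma volume_inter_Ico_le_of_grid {A : Set ℝ} (hA : MeasurableSet A) {Q : ℕ} (hQ : 0 < Q) {B : ℝ}
    (h : ∀ t : ℝ, ∀ E : Finset ℕ, E ⊆ Finset.range Q → (∀ j ∈ E, (j : ℝ) / Q + t ∈ A) →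
      (E.card : ℝ) ≤ B) :
    volume (A ∩ Set.Ico 0 1) ≤ ENNReal.ofReal (B / Q) := by
  classical
  have hQR : (0 : ℝ) < Q := by exact_mod_cast hQ
  have hcover : A ∩ Set.Ico 0 1 ⊆ ⋃ j ∈ Finset.range Q,
      (A ∩ Set.Ico ((j : ℝ) / Q) ((j + 1 : ℝ) / Q)) := by
    rintro x ⟨hx, hx0, hx1⟩
    simp only [Set.mem_iUnion]
    have hxQ : 0 ≤ x * Q := by positivity
    refine ⟨⌊x * Q⌋₊, ?_, hx, ?_, ?_⟩
    · rw [Finset.mem_range, Nat.floor_lt hxQ]; nlinarith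
    · rw [div_le_iff₀ hQR]; exact Nat.floor_le hxQ
    · rw [lt_div_iff₀ hQR]; exact Nat.lt_floor_add_one _
  set I : Set ℝ := Set.Ico 0 (1 / (Q : ℝ)) with hI
  have hpre : ∀ j : ℕ, volume (A ∩ Set.Ico ((j : ℝ) / Q) ((j + 1 : ℝ) / Q))
      = ∫⁻ t in I, ((fun t : ℝ => (j : ℝ) / Q + t) ⁻¹' A).indicator 1 t := by
    intro j
    have hm : MeasurableSet ((fun t : ℝ => (j : ℝ) / Q + t) ⁻¹' A) :=
      (measurable_const_add _) hA
    rw [lintegral_indicator_one hm, Measure.restrict_apply hm,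
      ← measure_preimage_add volume ((j : ℝ) / Q)]
    congr 1
    ext t
    simp only [Set.mem_preimage, Set.mem_inter_iff, Set.mem_Ico, hI, add_div]
    constructor
    · rintro ⟨h1, h2, h3⟩; exact ⟨h1, by linarith, by linarith⟩
    · rintro ⟨h1, h2, h3⟩; exact ⟨h1, by linarith, by linarith⟩
  calc volume (A ∩ Set.Ico 0 1)
      ≤ ∑ j ∈ Finset.range Q, volume (A ∩ Set.Ico ((j : ℝ) / Q) ((j + 1 : ℝ) / Q)) :=
        (measure_mono hcover).trans (measure_biUnion_finset_le _ _)
    _ = ∑ j ∈ Finset.range Q,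
          ∫⁻ t in I, ((fun t : ℝ => (j : ℝ) / Q + t) ⁻¹' A).indicator 1 t :=
        Finset.sum_congr rfl fun j _ => hpre j
    _ = ∫⁻ t in I, ∑ j ∈ Finset.range Q,
          ((fun t : ℝ => (j : ℝ) / Q + t) ⁻¹' A).indicator 1 t := by
        rw [lintegral_finsetSum]
        intro j _
        exact measurable_one.indicator ((measurable_const_add _) hA)
    _ ≤ ∫⁻ _ in I, ENNReal.ofReal B := by
        refine lintegral_mono fun t => ?_
        have e : ∑ j ∈ Finset.range Q, ((fun t : ℝ => (j : ℝ) / Q + t) ⁻¹' A).indicator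
            (1 : ℝ → ENNReal) t
            = (((Finset.range Q).filter fun j : ℕ => (j : ℝ) / Q + t ∈ A).card : ENNReal) := by
          rw [Finset.card_filter]
          push_cast
          refine Finset.sum_congr rfl fun j _ => ?_
          simp [Set.indicator_apply]
        simp only [e]
        rw [← ENNReal.ofReal_natCast]
        exact ENNReal.ofReal_le_ofReal (h t _ (Finset.filter_subset _ _)
          fun j hj => (Finset.mem_filter.1 hj).2)
    _ = ENNReal.ofReal (B / Q) := by
        have hB : 0 ≤ B := by simpa using h 0 ∅ (by simp) (by simp)
        rw [setLIntegral_const, hI, Real.volume_Ico, sub_zero, ← ENNReal.ofReal_mul hB,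
          mul_one_div]

/-- Partial sums of an exponential sum over a dyadic grid, with a translation. -/
lemma sum_norm_unitExp_partial_le {n : ℕ → ℕ} (hn : ∀ i j, 1 ≤ i → i < j → n i < n j)
    {h : ℕ} (hh : 0 < h) {N b : ℕ} (hb : h * n N + 2 ≤ 2 ^ (b + 1)) {E : Finset ℕ}
    (hE : E ⊆ Finset.range (2 ^ b)) {κ : ℕ → ℕ} (hκ : ∀ j, 1 ≤ κ j ∧ κ j ≤ N) (t : ℝ) :
    ∑ j ∈ E, ‖∑ k ∈ Finset.Icc 1 (κ j), unitExp (h * (n k * ((j : ℝ) / 2 ^ b + t)))‖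
      ≤ 16 * levelConst * √N * √(2 ^ b * E.card) := by
  classical
  have hle : ∀ i j, 1 ≤ i → i ≤ j → n i ≤ n j := fun i j hi hij => by
    rcases hij.eq_or_lt with rfl | h1
    · exact le_rfl
    · exact (hn i j hi h1).le
  set g : ℕ → ℤ := fun k => ((h * n k : ℕ) : ℤ) with hg
  have hinj : Set.InjOn g (Finset.Icc 1 N : Finset ℕ) := by
    intro i hi j hj hij
    have hi1 := (Finset.mem_Icc.1 hi).1
    have hj1 := (Finset.mem_Icc.1 hj).1
    have h1 : n i = n j := Nat.eq_of_mul_eq_mul_left hh (Int.ofNat.inj hij)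
    rcases lt_trichotomy i j with h2 | h2 | h2
    · exact absurd h1 (hn i j hi1 h2).ne
    · exact h2
    · exact absurd h1 (hn j i hj1 h2).ne'
  have key := sum_norm_partial_le (b := b) (E := E) (L := fun j => h * n (κ j)) hE
    (fun j => (Nat.add_le_add_right (Nat.mul_le_mul_left h
      (hle _ _ (hκ j).1 (hκ j).2)) 2).trans hb)
    (S := (Finset.Icc 1 N).image g)
    (by intro x hx; obtain ⟨k, _, rfl⟩ := Finset.mem_image.1 hx; exact Int.natCast_nonneg _)
    (fun x => unitExp (x * t))
  have e1 : l2norm ((Finset.Icc 1 N).image g) (fun x : ℤ => unitExp (x * t)) = √N := by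
    rw [l2norm, Finset.sum_image hinj]
    simp [norm_unitExp]
  rw [e1] at key
  refine le_trans (le_of_eq (Finset.sum_congr rfl fun j _ => ?_)) key
  have hf : ((Finset.Icc 1 N).image g).filter (fun x => x ≤ ((h * n (κ j) : ℕ) : ℤ))
      = (Finset.Icc 1 (κ j)).image g := by
    ext x
    simp only [Finset.mem_filter, Finset.mem_image, Finset.mem_Icc]
    constructor
    · rintro ⟨⟨k, ⟨hk1, hk2⟩, rfl⟩, hx⟩
      refine ⟨k, ⟨hk1, ?_⟩, rfl⟩
      by_contra hc
      have h1 := hn (κ j) k (hκ j).1 (not_le.1 hc)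
      have h2 : h * n k ≤ h * n (κ j) := Int.ofNat_le.1 hx
      exact absurd (Nat.le_of_mul_le_mul_left h2 hh) (not_le.2 h1)
    · rintro ⟨k, ⟨hk1, hk2⟩, rfl⟩
      refine ⟨⟨k, ⟨hk1, hk2.trans (hκ j).2⟩, rfl⟩, ?_⟩
      exact Int.ofNat_le.2 (Nat.mul_le_mul_left h (hle _ _ hk1 hk2))
  have hsub : Set.InjOn g (Finset.Icc 1 (κ j) : Finset ℕ) := by
    refine hinj.mono ?_
    intro k hk
    have hk' := Finset.mem_Icc.1 hk
    exact Finset.mem_coe.2 (Finset.mem_Icc.2 ⟨hk'.1, hk'.2.trans (hκ j).2⟩)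
  rw [hf, Finset.sum_image hsub]
  congr 1
  refine Finset.sum_congr rfl fun k _ => ?_
  rw [← unitExp_add]
  congr 1
  simp only [hg]
  push_cast
  ring

/-- The points at which some partial sum up to `N` has large weighted Weyl sums. -/
def weylExceptionalSet (n : ℕ → ℕ) (N H : ℕ) (c : ℝ) : Set ℝ :=
  {x | ∃ K ∈ Finset.Icc 1 N, c < ∑ h ∈ Finset.Icc 1 H,
    ‖∑ k ∈ Finset.Icc 1 K, unitExp (h * (n k * x))‖ / h}

lemma continuous_unitExp : Continuous unitExp := by
  unfold unitExp
  fun_prop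

lemma measurableSet_weylExceptionalSet (n : ℕ → ℕ) (N H : ℕ) (c : ℝ) :
    MeasurableSet (weylExceptionalSet n N H c) := by
  have e : weylExceptionalSet n N H c = ⋃ K ∈ Finset.Icc 1 N, {x : ℝ | c < ∑ h ∈ Finset.Icc 1 H,
      ‖∑ k ∈ Finset.Icc 1 K, unitExp (h * (n k * x))‖ / h} := by
    ext x
    simp only [weylExceptionalSet, Set.mem_iUnion, Set.mem_ofPred_eq, exists_prop]
  rw [e]
  refine Finset.measurableSet_biUnion _ fun K _ => (isOpen_lt continuous_const ?_).measurableSet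
  refine continuous_finsetSum _ fun h _ => (Continuous.norm ?_).div_const _
  exact continuous_finsetSum _ fun k _ => continuous_unitExp.comp (by fun_prop)

lemma volume_weylExceptionalSet_le {n : ℕ → ℕ} (hn : ∀ i j, 1 ≤ i → i < j → n i < n j)
    {N : ℕ} (hN : 1 ≤ N) (H : ℕ) {c : ℝ} (hc : 0 < c) :
    volume (weylExceptionalSet n N H c ∩ Set.Ico 0 1)
      ≤ ENNReal.ofReal ((16 * levelConst * √N * (∑ h ∈ Finset.Icc 1 H, 1 / (h : ℝ)) / c) ^ 2) := by
  classical
  set s : ℝ := ∑ h ∈ Finset.Icc 1 H, 1 / (h : ℝ) with hs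
  set M : ℝ := 16 * levelConst * √N * s with hM
  set b : ℕ := H * n N + 2 with hb
  have hQ : (0 : ℝ) < (2 : ℝ) ^ b := by positivity
  have hmain := volume_inter_Ico_le_of_grid (measurableSet_weylExceptionalSet n N H c)
    (Q := 2 ^ b) (by positivity) (B := 2 ^ b * (M / c) ^ 2) ?_
  · refine hmain.trans (le_of_eq ?_)
    congr 1
    push_cast
    field_simp
  intro t E hE hA
  push_cast at hA
  have hκ : ∀ j : ℕ, ∃ K, (1 ≤ K ∧ K ≤ N) ∧ (j ∈ E → c < ∑ h ∈ Finset.Icc 1 H,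
      ‖∑ k ∈ Finset.Icc 1 K, unitExp (h * (n k * ((j : ℝ) / 2 ^ b + t)))‖ / h) := by
    intro j
    by_cases hj : j ∈ E
    · obtain ⟨K, hK, h⟩ := hA j hj
      exact ⟨K, Finset.mem_Icc.1 hK, fun _ => h⟩
    · exact ⟨1, ⟨le_rfl, hN⟩, fun h => absurd h hj⟩
  choose κ hκ1 hκ2 using hκ
  have h1 : c * E.card ≤ M * √(2 ^ b * E.card) := by
    calc c * E.card = ∑ j ∈ E, c := by rw [Finset.sum_const, nsmul_eq_mul, mul_comm]
      _ ≤ ∑ j ∈ E, ∑ h ∈ Finset.Icc 1 H,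
          ‖∑ k ∈ Finset.Icc 1 (κ j), unitExp (h * (n k * ((j : ℝ) / 2 ^ b + t)))‖ / h :=
          Finset.sum_le_sum fun j hj => (hκ2 j hj).le
      _ = ∑ h ∈ Finset.Icc 1 H, (∑ j ∈ E,
          ‖∑ k ∈ Finset.Icc 1 (κ j), unitExp (h * (n k * ((j : ℝ) / 2 ^ b + t)))‖) / h := by
          rw [Finset.sum_comm]
          exact Finset.sum_congr rfl fun h _ => (Finset.sum_div _ _ _).symm
      _ ≤ ∑ h ∈ Finset.Icc 1 H, (16 * levelConst * √N * √(2 ^ b * E.card)) / h := by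
          refine Finset.sum_le_sum fun h hh => ?_
          obtain ⟨hh1, hh2⟩ := Finset.mem_Icc.1 hh
          have h2 : h * n N + 2 ≤ 2 ^ (b + 1) := by
            have h3 : h * n N ≤ H * n N := Nat.mul_le_mul_right _ hh2
            have h4 : b < 2 ^ b := Nat.lt_two_pow_self
            rw [pow_succ]
            omega
          exact div_le_div_of_nonneg_right
            (sum_norm_unitExp_partial_le hn hh1 h2 hE hκ1 t) (Nat.cast_nonneg _)
      _ = M * √(2 ^ b * E.card) := by
          rw [hM, hs, Finset.mul_sum, Finset.sum_mul]
          exact Finset.sum_congr rfl fun h _ => by ring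
  rcases E.card.eq_zero_or_pos with h0 | h0
  · rw [h0]; push_cast; positivity
  have h0' : (0 : ℝ) < E.card := by exact_mod_cast h0
  have h2 : (c * E.card) ^ 2 ≤ M ^ 2 * (2 ^ b * E.card) := by
    refine (pow_le_pow_left₀ (by positivity) h1 2).trans (le_of_eq ?_)
    rw [mul_pow, Real.sq_sqrt (by positivity)]
  have h3 : (c ^ 2 * E.card) * E.card ≤ (M ^ 2 * 2 ^ b) * E.card := by
    linarith
  have h4 := le_of_mul_le_mul_right h3 h0'
  rw [div_pow, ← mul_div_assoc, le_div_iff₀ (by positivity)]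
  linarith

lemma sum_one_div_four_pow_le (m : ℕ) :
    ∑ h ∈ Finset.Icc (1 : ℕ) (4 ^ m), 1 / (h : ℝ) ≤ 2 * (m + 1) := by
  have h1 := harmonic_le_one_add_log (4 ^ m)
  rw [harmonic_eq_sum_Icc] at h1
  push_cast at h1
  simp only [one_div]
  refine h1.trans ?_
  rw [Real.log_pow, show (4 : ℝ) = 2 ^ 2 by norm_num, Real.log_pow]
  have h2 := Real.log_two_lt_d9
  have h3 : (0 : ℝ) ≤ m := Nat.cast_nonneg _
  push_cast
  nlinarith

lemma volume_weylExceptionalSet_dyadic_le {n : ℕ → ℕ} (hn : ∀ i j, 1 ≤ i → i < j → n i < n j)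
    (m : ℕ) (ε : ℝ) :
    volume (weylExceptionalSet n (2 ^ (m + 1)) (4 ^ m)
        (√(2 ^ m) * ((m : ℝ) + 1) ^ ((3 : ℝ) / 2 + ε)) ∩ Set.Ico 0 1)
      ≤ ENNReal.ofReal (2 * (32 * levelConst) ^ 2 * (1 / ((m : ℝ) + 1) ^ (1 + 2 * ε))) := by
  have hm : (0 : ℝ) < (m : ℝ) + 1 := by positivity
  have hL := levelConst_nonneg
  refine (volume_weylExceptionalSet_le hn Nat.one_le_two_pow _ (by positivity)).trans
    (ENNReal.ofReal_le_ofReal ?_)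
  have hs0 : 0 ≤ ∑ h ∈ Finset.Icc (1 : ℕ) (4 ^ m), 1 / (h : ℝ) :=
    Finset.sum_nonneg fun h _ => by positivity
  have hp : (((m : ℝ) + 1) ^ ((3 : ℝ) / 2 + ε)) ^ 2
      = ((m : ℝ) + 1) ^ (1 + 2 * ε) * ((m : ℝ) + 1) ^ 2 := by
    rw [← Real.rpow_natCast, ← Real.rpow_mul hm.le, ← Real.rpow_natCast, ← Real.rpow_add hm]
    congr 1
    push_cast
    ring
  have hpos : (0 : ℝ) < ((m : ℝ) + 1) ^ (1 + 2 * ε) := Real.rpow_pos_of_pos hm _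
  rw [div_pow, mul_pow (√(2 ^ m)), hp, Real.sq_sqrt (by positivity), mul_pow, mul_pow,
    Real.sq_sqrt (by positivity)]
  calc _ ≤ (16 * levelConst) ^ 2 * ((2 ^ (m + 1) : ℕ) : ℝ) * (2 * ((m : ℝ) + 1)) ^ 2
        / (2 ^ m * (((m : ℝ) + 1) ^ (1 + 2 * ε) * ((m : ℝ) + 1) ^ 2)) := by
        gcongr
        exact sum_one_div_four_pow_le m
    _ = _ := by
        push_cast
        rw [pow_succ]
        field_simp
        ring

lemma ae_eventually_notMem_weylExceptionalSet {n : ℕ → ℕ}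
    (hn : ∀ i j, 1 ≤ i → i < j → n i < n j) {ε : ℝ} (hε : 0 < ε) :
    ∀ᵐ x ∂(volume.restrict (Set.Icc (0 : ℝ) 1)), ∀ᶠ m : ℕ in atTop,
      x ∉ weylExceptionalSet n (2 ^ (m + 1)) (4 ^ m)
        (√(2 ^ m) * ((m : ℝ) + 1) ^ ((3 : ℝ) / 2 + ε)) := by
  refine ae_eventually_notMem (ne_top_of_le_ne_top ?_ (ENNReal.tsum_le_tsum
    (g := fun m : ℕ => ENNReal.ofReal
      (2 * (32 * levelConst) ^ 2 * (1 / ((m : ℝ) + 1) ^ (1 + 2 * ε)))) fun m => ?_))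
  · have hsum : Summable fun m : ℕ =>
        2 * (32 * levelConst) ^ 2 * (1 / ((m : ℝ) + 1) ^ (1 + 2 * ε)) := by
      refine Summable.mul_left _ ?_
      have h := (summable_nat_add_iff 1).2
        (Real.summable_one_div_nat_rpow.2 (by linarith : 1 < 1 + 2 * ε))
      simpa using h
    exact hsum.tsum_ofReal_ne_top
  · rw [Measure.restrict_congr_set (Ico_ae_eq_Icc (a := (0 : ℝ)) (b := 1)).symm,
      Measure.restrict_apply (measurableSet_weylExceptionalSet _ _ _ _)]
    exact volume_weylExceptionalSet_dyadic_le hn m ε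

lemma starDiscrepancy_nonneg (N : ℕ) (x : ℕ → ℝ) : 0 ≤ starDiscrepancy N x :=
  Real.iSup_nonneg fun _ => abs_nonneg _

lemma starDiscrepancy_le_of_notMem_weylExceptionalSet {n : ℕ → ℕ} {x ε : ℝ} (hε : 0 < ε)
    {m K : ℕ} (hm : 1 ≤ m) (hK : 2 ^ m ≤ K) (hK' : K < 2 ^ (m + 1))
    (hx : x ∉ weylExceptionalSet n (2 ^ (m + 1)) (4 ^ m)
        (√(2 ^ m) * ((m : ℝ) + 1) ^ ((3 : ℝ) / 2 + ε))) :
    starDiscrepancy K (fun k => Int.fract ((n k : ℝ) * x))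
      ≤ 5 * 3 ^ ((3 : ℝ) / 2 + ε) * ((Real.log K) ^ ((3 : ℝ) / 2 + ε) / √K) := by
  set c : ℝ := √(2 ^ m) * ((m : ℝ) + 1) ^ ((3 : ℝ) / 2 + ε) with hc
  have hK1 : 1 ≤ K := Nat.one_le_two_pow.trans hK
  have hKR : (0 : ℝ) < K := by exact_mod_cast hK1
  have hKm : (2 : ℝ) ^ m ≤ K := by exact_mod_cast hK
  have hKm' : (K : ℝ) ≤ 2 ^ m * 2 := by rw [← pow_succ]; exact_mod_cast hK'.le
  have hmR : (1 : ℝ) ≤ m := by exact_mod_cast hm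
  have hr : 0 ≤ (3 : ℝ) / 2 + ε := by positivity
  have hc1 : 1 ≤ c := by
    have h1 : (1 : ℝ) ≤ √(2 ^ m) := Real.one_le_sqrt.2 (one_le_pow₀ one_le_two)
    have h2 : (1 : ℝ) ≤ ((m : ℝ) + 1) ^ ((3 : ℝ) / 2 + ε) :=
      Real.one_le_rpow (by linarith) hr
    exact one_le_mul_of_one_le_of_one_le h1 h2
  have hlog : (m : ℝ) + 1 ≤ 3 * Real.log K := by
    have h1 : (m : ℝ) * Real.log 2 ≤ Real.log K := by
      rw [← Real.log_pow]; exact Real.log_le_log (by positivity) hKm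
    have h2 := Real.log_two_gt_d9
    nlinarith
  have hlog0 : 0 ≤ Real.log K := by linarith
  have hcK : c ≤ √K * (3 ^ ((3 : ℝ) / 2 + ε) * (Real.log K) ^ ((3 : ℝ) / 2 + ε)) := by
    rw [← Real.mul_rpow (by norm_num) hlog0, hc]
    gcongr
  have hW : ∑ h ∈ Finset.Icc (1 : ℕ) (4 ^ m),
      ‖∑ k ∈ Finset.Icc 1 K, unitExp (h * (n k * x))‖ / h ≤ c := by
    by_contra hcon
    exact hx ⟨K, Finset.mem_Icc.2 ⟨hK1, hK'.le⟩, not_le.1 hcon⟩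
  have hnn : 0 ≤ 5 * 3 ^ ((3 : ℝ) / 2 + ε) * ((Real.log K) ^ ((3 : ℝ) / 2 + ε) / √K) := by
    positivity
  refine Real.iSup_le (fun a => ?_) hnn
  have h1 := abs_sum_indicator_sub_le (fun k => (n k : ℝ) * x) K (P := 2 ^ m)
    (by positivity) a.2
  rw [← pow_mul, mul_comm m 2, pow_mul, show 2 ^ 2 = 4 by norm_num] at h1
  have h2 : 2 * (K : ℝ) / ((2 ^ m : ℕ) : ℝ) ≤ 4 := by
    push_cast
    rw [div_le_iff₀ (by positivity)]
    linarith
  have h3 : |∑ k ∈ Finset.Icc 1 K, (Set.Ico (0 : ℝ) (a : ℝ)).indicator (fun _ => (1 : ℝ))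
      (Int.fract ((n k : ℝ) * x)) - K * a| ≤ 5 * c := by
    linarith
  have e : (∑ k ∈ Finset.Icc 1 K, (Set.Ico (0 : ℝ) (a : ℝ)).indicator (fun _ => (1 : ℝ))
      (Int.fract ((n k : ℝ) * x))) / K - (a : ℝ)
      = (∑ k ∈ Finset.Icc 1 K, (Set.Ico (0 : ℝ) (a : ℝ)).indicator (fun _ => (1 : ℝ))
        (Int.fract ((n k : ℝ) * x)) - K * a) / K := by
    rw [sub_div, mul_div_cancel_left₀ _ hKR.ne']
  rw [e, abs_div, abs_of_pos hKR, div_le_iff₀ hKR]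
  refine h3.trans ((mul_le_mul_of_nonneg_left hcK (by norm_num)).trans (le_of_eq ?_))
  have hs : √(K : ℝ) * √K = K := Real.mul_self_sqrt hKR.le
  have hs0 : 0 < √(K : ℝ) := Real.sqrt_pos.2 hKR
  calc 5 * (√(K : ℝ) * (3 ^ ((3 : ℝ) / 2 + ε) * (Real.log K) ^ ((3 : ℝ) / 2 + ε)))
      = 5 * 3 ^ ((3 : ℝ) / 2 + ε) * ((Real.log K) ^ ((3 : ℝ) / 2 + ε) / √K) * (√K * √K) := by
        field_simp
    _ = _ := by rw [hs]

/-- (Baker's metric discrepancy bound) For any strictly increasing sequence `(n_k)_{k ≥ 1}` of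
positive integers and any `ε > 0`, for almost every `x ∈ [0,1]`,
`D_N^*(⟨n_1 x⟩, …, ⟨n_N x⟩) = O((log N)^{3/2+ε} / √N)` as `N → ∞`. -/
theorem baker_discrepancy_bound (n : ℕ → ℕ) (hpos : ∀ k, 1 ≤ k → 0 < n k)
    (hmono : ∀ k, 1 ≤ k → n k < n (k + 1)) (ε : ℝ) (hε : 0 < ε) :
    ∀ᵐ x ∂(volume.restrict (Set.Icc (0 : ℝ) 1)),
      (fun N : ℕ => starDiscrepancy N (fun k => Int.fract ((n k : ℝ) * x)))
        =O[atTop] (fun N : ℕ => (Real.log N) ^ ((3:ℝ)/2 + ε) / Real.sqrt N) := by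
  have hn : ∀ i j, 1 ≤ i → i < j → n i < n j := by
    intro i j hi hij
    induction j, hij using Nat.le_induction with
    | base => exact hmono i hi
    | succ j hj ih => exact ih.trans (hmono j (by omega))
  filter_upwards [ae_eventually_notMem_weylExceptionalSet hn hε] with x hx
  obtain ⟨m₀, hm₀⟩ := Filter.eventually_atTop.1 hx
  refine IsBigO.of_bound (5 * 3 ^ ((3 : ℝ) / 2 + ε)) (Filter.eventually_atTop.2
    ⟨2 ^ (m₀ + 1), fun K hK => ?_⟩)
  have hK0 : K ≠ 0 := (lt_of_lt_of_le (by positivity) hK).ne'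
  have hm : m₀ + 1 ≤ Nat.log 2 K := (Nat.le_log_iff_pow_le one_lt_two hK0).2 hK
  rw [Real.norm_eq_abs, abs_of_nonneg (starDiscrepancy_nonneg _ _)]
  refine (starDiscrepancy_le_of_notMem_weylExceptionalSet hε (m := Nat.log 2 K) (by omega)
    (Nat.pow_log_le_self 2 hK0) (Nat.lt_pow_succ_log_self one_lt_two K)
    (hm₀ _ (by omega))).trans ?_
  exact mul_le_mul_of_nonneg_left (le_abs_self _) (by positivity)
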